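/- Let M be a weight sequence satisfying (M.2) and (M.2)*, and let 𝒲 = (w_n)_{n∈ℕ} be an increasing weight system on ℝ^d. Then 𝒦^{(M)}(ℝ^d) ∗ ℬ^{(M)}_𝒲(ℝ^d) = ℬ^{(M)}_𝒲(ℝ^d) and 𝒦^{{M}}(ℝ^d) ∗ ℬ^{{M}}_𝒲(ℝ^d) = ℬ^{{M}}_𝒲(ℝ^d). Moreover: (Beurling) for every set B ⊆ ℬ^{(M)}_𝒲(ℝ^d) with sup_{φ∈B} ‖φ‖_{ℬ^{M,n}_{w_n}} < ∞ for all n, there exist ψ ∈ 𝒦^{(M)}(ℝ^d) and a bounded set A ⊆ ℬ^{(M)}_𝒲(ℝ^d) with ψ ∗ A = B; (Roumieu) for every h > 0 and every B ⊆ ℬ^{M,h}_𝒲(ℝ^d) with sup_{φ∈B} ‖φ‖_{ℬ^{M,h}_{w_n}} < ∞ for all n, there exist ψ ∈ 𝒦^{{M}}(ℝ^d), k > 0, and a set A ⊆ ℬ^{M,k}_𝒲(ℝ^d) bounded in ℬ^{M,k}_𝒲(ℝ^d) with ψ ∗ A = B. -/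

import Mathlib

open Filter MeasureTheory
open scoped BigOperators

noncomputable section

abbrev Rd (d : ℕ) := EuclideanSpace ℝ (Fin d)

/-- Partial derivative in the `j`-th coordinate direction. -/
def dop {d : ℕ} {E : Type*} [NormedAddCommGroup E] [NormedSpace ℝ E]
    (j : Fin d) (f : Rd d → E) : Rd d → E :=
  fun x => fderiv ℝ f x (EuclideanSpace.single j (1:ℝ))

/-- Iterated partial derivative `∂^α` for a multi-index `α : Fin d → ℕ`. -/
def pD {d : ℕ} {E : Type*} [NormedAddCommGroup E] [NormedSpace ℝ E]
    (α : Fin d → ℕ) (f : Rd d → E) : Rd d → E :=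
  (List.finRange d).foldr (fun j g => (dop j)^[α j] g) f

/-- Length `|α|` of a multi-index. -/
def msize {d : ℕ} (α : Fin d → ℕ) : ℕ := ∑ j, α j

/-- `M` is a weight sequence: positive, normalized, `M_p^{1/p} → ∞`, log-convex. -/
def IsWeightSeq (M : ℕ → ℝ) : Prop :=
  (∀ p, 0 < M p) ∧ M 0 = 1 ∧ M 1 = 1 ∧
  Tendsto (fun p : ℕ => (M p) ^ ((p : ℝ)⁻¹)) atTop atTop ∧
  ∀ p : ℕ, 1 ≤ p → (M p)^2 ≤ M (p-1) * M (p+1)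

/-- Condition (M.2) with explicit constants `C₀, H ≥ 1`. -/
def HasM2 (M : ℕ → ℝ) (C₀ H : ℝ) : Prop :=
  1 ≤ C₀ ∧ 1 ≤ H ∧ ∀ p q : ℕ, M (p+q) ≤ C₀ * H^(p+q) * M p * M q

/-- Condition (M.2). -/
def M2 (M : ℕ → ℝ) : Prop := ∃ C₀ H, HasM2 M C₀ H

/-- Condition (M.2)*: `2 m_p ≤ m_{Np}` for `p ≥ p₀`. -/
def M2star (M : ℕ → ℝ) : Prop :=
  ∃ p₀ N : ℕ, 0 < p₀ ∧ 0 < N ∧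
    ∀ p, p₀ ≤ p → 2 * (M p / M (p-1)) ≤ M (N*p) / M (N*p - 1)

/-- Associated function `ν_M(t) = sup_p log(t^p / M_p)`. -/
def nuA (M : ℕ → ℝ) (t : ℝ) : ℝ := ⨆ p : ℕ, Real.log (t ^ p / M p)

/-- `φ ∈ 𝒦^{(M)}(ℝ^d)` (Beurling type). -/
def KBeu (d : ℕ) (M : ℕ → ℝ) (φ : Rd d → ℂ) : Prop :=
  ContDiff ℝ (⊤ : ℕ∞) φ ∧ ∀ k : ℝ, 0 < k → ∀ n : ℕ, ∃ C : ℝ,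
    ∀ (α : Fin d → ℕ) (x : Rd d),
      k ^ msize α * ‖pD α φ x‖ * Real.exp ((n : ℝ) * ‖x‖) ≤ C * M (msize α)

/-- `φ ∈ 𝒦^{{M}}(ℝ^d)` (Roumieu type). -/
def KRou (d : ℕ) (M : ℕ → ℝ) (φ : Rd d → ℂ) : Prop :=
  ContDiff ℝ (⊤ : ℕ∞) φ ∧ ∃ k : ℝ, 0 < k ∧ ∀ n : ℕ, ∃ C : ℝ,
    ∀ (α : Fin d → ℕ) (x : Rd d),
      k ^ msize α * ‖pD α φ x‖ * Real.exp ((n : ℝ) * ‖x‖) ≤ C * M (msize α)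

/-- Convolution `(ψ ∗ χ)(x) = ∫ ψ(t) χ(x - t) dt`. -/
def convF {d : ℕ} (ψ χ : Rd d → ℂ) : Rd d → ℂ := fun x => ∫ t : Rd d, ψ t * χ (x - t)

/-- The set of all convolutions `ψ ∗ χ` with `ψ ∈ X`, `χ ∈ Y`. -/
def convSet {d : ℕ} (X Y : Set (Rd d → ℂ)) : Set (Rd d → ℂ) :=
  {f | ∃ ψ ∈ X, ∃ χ ∈ Y, f = convF ψ χ}

/-- Increasing weight system `𝒲 = (w_n)_n` on `ℝ^d`. -/
def IncWS (d : ℕ) (w : ℕ → Rd d → ℝ) : Prop :=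
  (∀ n x, 0 < w n x) ∧ (∀ n, Continuous (w n)) ∧
  (∀ n m : ℕ, n ≤ m → ∀ x, w n x ≤ w m x) ∧
  (∀ n : ℕ, ∃ m : ℕ, n ≤ m ∧ ∀ ε : ℝ, 0 < ε →
    ∃ R : ℝ, ∀ x : Rd d, R ≤ ‖x‖ → w n x / w m x < ε) ∧
  (∀ n : ℕ, ∃ m : ℕ, n ≤ m ∧ ∃ κ C : ℝ, 0 < κ ∧ 0 < C ∧
    ∀ x y : Rd d, w n (x + y) ≤ C * w m x * Real.exp (κ * ‖y‖))

/-- Finiteness of the norm `‖φ‖_{ℬ^{M,h}_w}`. -/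
def BNorm (d : ℕ) (M : ℕ → ℝ) (h : ℝ) (w : Rd d → ℝ) (φ : Rd d → ℂ) : Prop :=
  ∃ C : ℝ, ∀ (α : Fin d → ℕ) (x : Rd d),
    h ^ msize α * ‖pD α φ x‖ * w x ≤ C * M (msize α)

/-- `φ ∈ ℬ^{(M)}_𝒲(ℝ^d) = ⋂_n ℬ^{M,n}_{w_n}(ℝ^d)`. -/
def BBeuW (d : ℕ) (M : ℕ → ℝ) (w : ℕ → Rd d → ℝ) (φ : Rd d → ℂ) : Prop :=
  ContDiff ℝ (⊤ : ℕ∞) φ ∧ ∀ n : ℕ, BNorm d M (n : ℝ) (w n) φ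

/-- `φ ∈ ℬ^{M,h}_𝒲(ℝ^d) = ⋂_n ℬ^{M,h}_{w_n}(ℝ^d)`. -/
def BhW (d : ℕ) (M : ℕ → ℝ) (h : ℝ) (w : ℕ → Rd d → ℝ) (φ : Rd d → ℂ) : Prop :=
  ContDiff ℝ (⊤ : ℕ∞) φ ∧ ∀ n : ℕ, BNorm d M h (w n) φ

/-- `φ ∈ ℬ^{{M}}_𝒲(ℝ^d) = ⋃_{h>0} ℬ^{M,h}_𝒲(ℝ^d)`. -/
def BRouW (d : ℕ) (M : ℕ → ℝ) (w : ℕ → Rd d → ℝ) (φ : Rd d → ℂ) : Prop :=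
  ∃ h : ℝ, 0 < h ∧ BhW d M h w φ

/-- Bounded subset of `ℬ^{(M)}_𝒲(ℝ^d)`. -/
def BBeuWBdd (d : ℕ) (M : ℕ → ℝ) (w : ℕ → Rd d → ℝ) (B : Set (Rd d → ℂ)) : Prop :=
  (∀ φ ∈ B, BBeuW d M w φ) ∧ ∀ n : ℕ, ∃ C : ℝ,
    ∀ φ ∈ B, ∀ (α : Fin d → ℕ) (x : Rd d),
      (n : ℝ) ^ msize α * ‖pD α φ x‖ * w n x ≤ C * M (msize α)

/-- Bounded subset of `ℬ^{M,h}_𝒲(ℝ^d)`. -/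
def BhWBdd (d : ℕ) (M : ℕ → ℝ) (h : ℝ) (w : ℕ → Rd d → ℝ) (B : Set (Rd d → ℂ)) : Prop :=
  (∀ φ ∈ B, BhW d M h w φ) ∧ ∀ n : ℕ, ∃ C : ℝ,
    ∀ φ ∈ B, ∀ (α : Fin d → ℕ) (x : Rd d),
      h ^ msize α * ‖pD α φ x‖ * w n x ≤ C * M (msize α)

open scoped Topology FourierTransform

/-- `u` is holomorphic near the closed strip `|Im z| ≤ n` and decays there faster than any power of
`|Re z|`. -/
structure StripRapid (n : ℝ) (u : ℂ → ℂ) : Prop where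
  diff : ∀ z : ℂ, |z.im| ≤ n → DifferentiableAt ℂ u z
  decay : ∀ p : ℕ, ∃ C : ℝ, ∀ z : ℂ, |z.im| ≤ n → ‖u z‖ * (1 + |z.re|) ^ p ≤ C

/-- Inverse Fourier transform of the restriction of `u` to the real line. -/
def invFT (u : ℂ → ℂ) (t : ℝ) : ℂ :=
  ((2 * Real.pi)⁻¹ : ℝ) * ∫ x : ℝ, u x * Complex.exp (x * t * Complex.I)

theorem integrable_of_norm_mul_le {f : ℝ → ℂ} (hf : Continuous f) {C : ℝ}
    (h : ∀ x, ‖f x‖ * (1 + |x|) ^ 2 ≤ C) : Integrable f := by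
  refine (integrable_inv_one_add_sq.const_mul C).mono' hf.aestronglyMeasurable
    (Eventually.of_forall fun x => ?_)
  have h1 : (1 + x ^ 2) ≤ (1 + |x|) ^ 2 := by
    nlinarith [abs_nonneg x, sq_abs x]
  have h2 : 0 < 1 + x ^ 2 := by positivity
  rw [← div_eq_mul_inv, le_div_iff₀ h2]
  exact (mul_le_mul_of_nonneg_left h1 (norm_nonneg _)).trans (h x)

namespace StripRapid

variable {n : ℝ} {u : ℂ → ℂ}

theorem continuous_line (h : StripRapid n u) {y : ℝ} (hy : |y| ≤ n) :
    Continuous fun x : ℝ => u (x + y * Complex.I) := by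
  rw [continuous_iff_continuousAt]
  intro x
  have h1 : ContinuousAt u (x + y * Complex.I) :=
    (h.diff _ (by simpa using hy)).continuousAt
  exact ContinuousAt.comp (f := fun x : ℝ => (x + y * Complex.I : ℂ)) h1
    (by fun_prop)

theorem integrable_line (h : StripRapid n u) {y : ℝ} (hy : |y| ≤ n) :
    Integrable fun x : ℝ => u (x + y * Complex.I) := by
  obtain ⟨C, hC⟩ := h.decay 2
  refine integrable_of_norm_mul_le (h.continuous_line hy) (C := C) fun x => ?_
  simpa using hC (x + y * Complex.I) (by simpa using hy)

theorem continuous_real (h : StripRapid n u) (hn : 0 ≤ n) : Continuous fun x : ℝ => u x := by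
  simpa using h.continuous_line (y := 0) (by simpa using hn)

theorem integrable_real (h : StripRapid n u) (hn : 0 ≤ n) : Integrable fun x : ℝ => u x := by
  simpa using h.integrable_line (y := 0) (by simpa using hn)

theorem mul_pow (h : StripRapid n u) (hn : 0 ≤ n) (k : ℕ) :
    StripRapid n fun z => (Complex.I * z) ^ k * u z := by
  refine ⟨fun z hz => ((differentiableAt_id.const_mul _).pow k).mul (h.diff z hz), fun p => ?_⟩
  obtain ⟨C, hC⟩ := h.decay (p + k)
  refine ⟨(1 + n) ^ k * C, fun z hz => ?_⟩
  have h1 : ‖z‖ ≤ (1 + n) * (1 + |z.re|) := by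
    have := Complex.norm_le_abs_re_add_abs_im z
    nlinarith [abs_nonneg z.re]
  rw [norm_mul, norm_pow, norm_mul, Complex.norm_I, one_mul]
  calc ‖z‖ ^ k * ‖u z‖ * (1 + |z.re|) ^ p
      ≤ ((1 + n) * (1 + |z.re|)) ^ k * ‖u z‖ * (1 + |z.re|) ^ p := by gcongr
    _ = (1 + n) ^ k * (‖u z‖ * (1 + |z.re|) ^ (p + k)) := by rw [_root_.mul_pow]; ring
    _ ≤ (1 + n) ^ k * C := by gcongr; exact hC z hz

theorem sub (h : StripRapid n u) {v : ℂ → ℂ} (hv : StripRapid n v) :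
    StripRapid n fun z => u z - v z := by
  refine ⟨fun z hz => (h.diff z hz).sub (hv.diff z hz), fun p => ?_⟩
  obtain ⟨C, hC⟩ := h.decay p
  obtain ⟨C', hC'⟩ := hv.decay p
  refine ⟨C + C', fun z hz => ?_⟩
  have := norm_sub_le (u z) (v z)
  have h3 : (0 : ℝ) ≤ (1 + |z.re|) ^ p := by positivity
  nlinarith [hC z hz, hC' z hz, mul_le_mul_of_nonneg_right this h3]

theorem integral_shift (h : StripRapid n u) (t : ℝ) {y : ℝ} (hy : |y| ≤ n) :
    ∫ x : ℝ, u x * Complex.exp (x * t * Complex.I) =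
      ∫ x : ℝ, u (x + y * Complex.I) * Complex.exp ((x + y * Complex.I) * t * Complex.I) := by
  have hn : 0 ≤ n := (abs_nonneg y).trans hy
  set f : ℂ → ℂ := fun z => u z * Complex.exp (z * t * Complex.I) with hf
  have hexp : ∀ z : ℂ, ‖Complex.exp (z * t * Complex.I)‖ = Real.exp (-z.im * t) := by
    intro z; rw [Complex.norm_exp]; simp
  have hline : ∀ y' : ℝ, |y'| ≤ n → Integrable fun x : ℝ => f (x + y' * Complex.I) := by
    intro y' hy'
    refine ((h.integrable_line hy').norm.mul_const (Real.exp (-y' * t))).mono' ?_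
      (Eventually.of_forall fun x => ?_)
    · exact ((h.continuous_line hy').mul (by fun_prop)).aestronglyMeasurable
    · simp only [hf, norm_mul, hexp]
      simp
  have hrect : ∀ T : ℝ, (∫ x : ℝ in -T..T, f (x + (0 : ℝ) * Complex.I)) -
      (∫ x : ℝ in -T..T, f (x + y * Complex.I)) +
      Complex.I • (∫ s : ℝ in (0 : ℝ)..y, f (T + s * Complex.I)) -
      Complex.I • (∫ s : ℝ in (0 : ℝ)..y, f ((-T : ℝ) + s * Complex.I)) = 0 := by
    intro T
    have := Complex.integral_boundary_rect_eq_zero_of_differentiableOn f ((-T : ℝ))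
      (T + y * Complex.I) (fun z hz => by
        have hz2 : z.im ∈ Set.uIcc 0 y := by simpa using hz.2
        have : |z.im| ≤ n := by
          have := Set.abs_sub_left_of_mem_uIcc hz2
          simp at this
          exact this.trans hy
        exact ((h.diff z this).mul (by fun_prop)).differentiableWithinAt)
    simpa using this
  obtain ⟨C, hC⟩ := h.decay 1
  have hC0 : 0 ≤ C := by
    have := hC 0 (by simpa using hn)
    exact le_trans (by positivity) this
  have hvert : ∀ g : ℝ → ℝ, Tendsto (fun T => |g T|) atTop atTop →
      Tendsto (fun T : ℝ => Complex.I • (∫ s : ℝ in (0 : ℝ)..y, f ((g T : ℝ) + s * Complex.I))) atTop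
        (𝓝 0) := by
    intro g hg
    have h1 : Tendsto (fun T : ℝ => C * Real.exp (n * |t|) * |y - 0| / (1 + |g T|)) atTop (𝓝 0) :=
      Tendsto.div_atTop tendsto_const_nhds (tendsto_atTop_add_const_left _ _ hg)
    refine squeeze_zero_norm (fun T => ?_) h1
    rw [norm_smul, Complex.norm_I, one_mul]
    refine (intervalIntegral.norm_integral_le_of_norm_le_const
      (C := C * Real.exp (n * |t|) / (1 + |g T|)) fun s hs => ?_).trans (le_of_eq (by ring))
    have hs' : |s| ≤ n := by
      have := Set.abs_sub_left_of_mem_uIcc (Set.uIoc_subset_uIcc hs)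
      simp at this
      exact this.trans hy
    have h2 := hC ((g T : ℝ) + s * Complex.I) (by simpa using hs')
    simp only [pow_one, Complex.add_re, Complex.ofReal_re, Complex.mul_re, Complex.I_re, mul_zero,
      Complex.ofReal_im, Complex.I_im, mul_one, sub_self, add_zero] at h2
    have hpos : 0 < 1 + |g T| := by positivity
    rw [le_div_iff₀ hpos]
    simp only [hf, norm_mul, hexp]
    have h3 : Real.exp (-((g T : ℂ) + s * Complex.I).im * t) ≤ Real.exp (n * |t|) := by
      apply Real.exp_le_exp.2
      simp only [Complex.add_im, Complex.ofReal_im, Complex.mul_im, Complex.ofReal_re,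
        Complex.I_im, mul_one, Complex.I_re, mul_zero, add_zero, zero_add]
      calc -s * t ≤ |-s * t| := le_abs_self _
        _ = |s| * |t| := by rw [abs_mul, abs_neg]
        _ ≤ n * |t| := by gcongr
    calc _ = (‖u (↑(g T) + ↑s * Complex.I)‖ * (1 + |g T|)) *
        Real.exp (-((g T : ℂ) + s * Complex.I).im * t) := by ring
      _ ≤ C * Real.exp (n * |t|) := by gcongr
  have hh : ∀ y' : ℝ, |y'| ≤ n → Tendsto (fun T : ℝ => ∫ x : ℝ in -T..T, f (x + y' * Complex.I)) atTop
      (𝓝 (∫ x : ℝ, f (x + y' * Complex.I))) := fun y' hy' =>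
    intervalIntegral_tendsto_integral (hline y' hy') tendsto_neg_atTop_atBot tendsto_id
  have hlim := (((hh 0 (by simpa using hn)).sub (hh y hy)).add
    (hvert (fun T => T) tendsto_abs_atTop_atTop)).sub
    (hvert (fun T => -T) (by simpa using tendsto_abs_atTop_atTop))
  have h0 := tendsto_nhds_unique (hlim.congr fun T => hrect T) tendsto_const_nhds
  simp only [add_zero, sub_zero, Complex.ofReal_zero, zero_mul] at h0
  exact sub_eq_zero.1 h0

theorem norm_invFT_le (h : StripRapid n u) (hn : 0 ≤ n) (t : ℝ) :
    ‖invFT u t‖ ≤ ((∫ x : ℝ, ‖u (x + n * Complex.I)‖) + ∫ x : ℝ, ‖u (x - n * Complex.I)‖) *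
      Real.exp (-n * |t|) := by
  have key : ∀ y : ℝ, |y| = n → ‖invFT u t‖ ≤ (∫ x : ℝ, ‖u (x + y * Complex.I)‖) *
      Real.exp (-y * t) := by
    intro y hy
    have hpi : (2 * Real.pi)⁻¹ ≤ 1 := inv_le_one_of_one_le₀ (by nlinarith [Real.pi_gt_three])
    rw [invFT, h.integral_shift t hy.le, norm_mul, Complex.norm_real, Real.norm_eq_abs,
      abs_of_nonneg (by positivity)]
    refine (mul_le_of_le_one_left (norm_nonneg _) hpi).trans ?_
    refine (norm_integral_le_integral_norm _).trans (le_of_eq ?_)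
    rw [← integral_mul_const]
    congr 1; ext x
    rw [norm_mul, Complex.norm_exp]
    congr 2
    simp
  have hA : 0 ≤ ∫ x : ℝ, ‖u (x + n * Complex.I)‖ := integral_nonneg fun _ => norm_nonneg _
  have hB : 0 ≤ ∫ x : ℝ, ‖u (x - n * Complex.I)‖ := integral_nonneg fun _ => norm_nonneg _
  rcases le_total 0 t with ht | ht
  · refine (key n (abs_of_nonneg hn)).trans ?_
    rw [abs_of_nonneg ht]
    gcongr
    linarith
  · refine (key (-n) (by rw [abs_neg, abs_of_nonneg hn])).trans ?_
    rw [abs_of_nonpos ht]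
    have : (fun x : ℝ => ‖u (x + (-n : ℝ) * Complex.I)‖) = fun x : ℝ => ‖u (x - n * Complex.I)‖ := by
      ext x; congr 2; push_cast; ring
    rw [this]
    have e : - -n * t = -n * -t := by ring
    rw [e]
    gcongr
    linarith

theorem hasDerivAt_invFT (h : StripRapid n u) (hn : 0 ≤ n) (t : ℝ) :
    HasDerivAt (invFT u) (invFT (fun z => Complex.I * z * u z) t) t := by
  have hexp : ∀ x s : ℝ, ‖Complex.exp (x * s * Complex.I)‖ = 1 := by
    intro x s
    rw [Complex.norm_exp]; simp
  have hu := h.continuous_real hn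
  have h1 : StripRapid n fun z => Complex.I * z * u z := by simpa using h.mul_pow hn 1
  have hmeas := ((h1.continuous_real hn).mul (g := fun x : ℝ => Complex.exp (x * t * Complex.I))
    (by fun_prop)).aestronglyMeasurable (μ := volume)
  suffices key : HasDerivAt (fun s : ℝ => ∫ x : ℝ, u x * Complex.exp (x * s * Complex.I))
      (∫ x : ℝ, Complex.I * x * u x * Complex.exp (x * t * Complex.I)) t from key.const_mul _
  refine (hasDerivAt_integral_of_dominated_loc_of_deriv_le (s := Set.univ) (𝕜 := ℝ)
    (F := fun (s : ℝ) (x : ℝ) => u x * Complex.exp (x * s * Complex.I))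
    (F' := fun (s : ℝ) (x : ℝ) => Complex.I * x * u x * Complex.exp (x * s * Complex.I))
    (bound := fun x : ℝ => ‖Complex.I * x * u x‖) Filter.univ_mem
    (Eventually.of_forall fun s => ?_) ?_ ?_ ?_ ?_ ?_).2
  · exact (hu.mul (by fun_prop)).aestronglyMeasurable
  · refine (h.integrable_real hn).norm.mono' (hu.mul (by fun_prop)).aestronglyMeasurable
      (Eventually.of_forall fun x => ?_)
    rw [norm_mul, hexp, mul_one]
  · exact hmeas
  · refine Eventually.of_forall fun x s _ => ?_
    rw [norm_mul, hexp, mul_one]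
  · exact (h1.integrable_real hn).norm
  · refine Eventually.of_forall fun x s _ => ?_
    have e1 : HasDerivAt (fun s : ℝ => (x * s * Complex.I : ℂ)) (x * Complex.I) s := by
      simpa using ((Complex.ofRealCLM.hasDerivAt (x := s)).const_mul (x : ℂ)).mul_const Complex.I
    have e2 := (e1.cexp).const_mul (u x)
    rw [show Complex.I * x * u x * Complex.exp (x * s * Complex.I)
      = u x * (Complex.exp (x * s * Complex.I) * (x * Complex.I)) by ring]
    exact e2

theorem iteratedDeriv_invFT (h : StripRapid n u) (hn : 0 ≤ n) (k : ℕ) :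
    iteratedDeriv k (invFT u) = invFT fun z => (Complex.I * z) ^ k * u z := by
  induction k with
  | zero => simp
  | succ k ih =>
    rw [iteratedDeriv_succ, ih]
    ext t
    rw [((h.mul_pow hn k).hasDerivAt_invFT hn t).deriv]
    congr 1
    ext z
    ring

theorem contDiff_invFT (h : StripRapid n u) (hn : 0 ≤ n) : ContDiff ℝ (⊤ : ℕ∞) (invFT u) := by
  refine contDiff_of_differentiable_iteratedDeriv fun m _ => ?_
  rw [h.iteratedDeriv_invFT hn]
  exact fun t => ((h.mul_pow hn m).hasDerivAt_invFT hn t).differentiableAt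

theorem continuous_invFT (h : StripRapid n u) (hn : 0 ≤ n) : Continuous (invFT u) :=
  (h.contDiff_invFT hn).continuous

theorem exists_norm_invFT_le (h : StripRapid n u) (hn : 0 ≤ n) :
    ∃ C, 0 ≤ C ∧ ∀ t, ‖invFT u t‖ ≤ C * Real.exp (-n * |t|) :=
  ⟨_, add_nonneg (integral_nonneg fun _ => norm_nonneg _) (integral_nonneg fun _ => norm_nonneg _),
    h.norm_invFT_le hn⟩

end StripRapid

theorem integrable_exp_neg_mul_abs {c : ℝ} (hc : 0 < c) :
    Integrable fun t : ℝ => Real.exp (-c * |t|) := by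
  rw [← integrableOn_univ, ← Set.Iic_union_Ioi (a := (0 : ℝ)), integrableOn_union]
  exact ⟨(integrableOn_exp_mul_Iic hc 0).congr_fun
      (fun t ht => by simp [abs_of_nonpos (Set.mem_Iic.1 ht)]) measurableSet_Iic,
    (integrableOn_exp_mul_Ioi (neg_neg_of_pos hc) 0).congr_fun
      (fun t ht => by simp [abs_of_pos (Set.mem_Ioi.1 ht)]) measurableSet_Ioi⟩

namespace StripRapid

variable {n : ℝ} {u : ℂ → ℂ}

theorem integrable_invFT (h : StripRapid n u) (hn : 0 < n) : Integrable (invFT u) := by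
  obtain ⟨C, -, hC⟩ := h.exists_norm_invFT_le hn.le
  exact ((integrable_exp_neg_mul_abs hn).const_mul C).mono'
    (h.continuous_invFT hn.le).aestronglyMeasurable (Eventually.of_forall hC)

theorem integral_invFT_mul_exp (h : StripRapid n u) (hn : 0 < n) (x : ℝ) :
    ∫ s : ℝ, invFT u s * Complex.exp (-(x * s * Complex.I)) = u x := by
  set v : ℝ → ℂ := fun ξ => u ((2 * Real.pi * ξ : ℝ)) with hv
  have hpi : 0 < 2 * Real.pi := by positivity
  have hvc : Continuous v := (h.continuous_real hn.le).comp (by fun_prop)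
  have hvi : Integrable v := (h.integrable_real hn.le).comp_mul_left' hpi.ne'
  have hinv : 𝓕⁻ v = invFT u := by
    ext s
    rw [Real.fourierInv_eq', invFT]
    have := Measure.integral_comp_mul_left
      (fun x : ℝ => u x * Complex.exp (x * s * Complex.I)) (2 * Real.pi)
    rw [abs_of_pos (inv_pos.2 hpi)] at this
    rw [← Complex.real_smul, ← this]
    congr 1
    ext ξ
    simp only [hv, smul_eq_mul, RCLike.inner_apply, conj_trivial]
    rw [mul_comm]
    congr 2
    push_cast
    ring
  have hF : Integrable (𝓕 v) := by
    have : 𝓕 v = fun s => invFT u (-s) := by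
      ext s
      rw [← hinv, Real.fourierInv_eq_fourier_neg, neg_neg]
    rw [this]
    exact (h.integrable_invFT hn).comp_neg
  have key := congrFun (hvc.fourier_fourierInv_eq hvi hF) (x / (2 * Real.pi))
  rw [hinv, Real.fourier_eq'] at key
  have e : v (x / (2 * Real.pi)) = u x := by
    simp only [hv]; congr 2; field_simp
  rw [← e, ← key]
  congr 1
  ext s
  simp only [smul_eq_mul, RCLike.inner_apply, conj_trivial]
  rw [mul_comm]
  congr 2
  push_cast
  have : (Real.pi : ℂ) ≠ 0 := by exact_mod_cast Real.pi_ne_zero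
  field_simp

end StripRapid

/-- A nonnegative function of polynomial growth which varies slowly compared with its size and
dominates every multiple of the logarithm. -/
structure SlowGrowth (e : ℕ) (N : ℝ → ℝ) : Prop where
  exponent_pos : 0 < e
  meas : Measurable N
  nonneg : ∀ x, 0 ≤ N x
  poly : ∃ C, 0 ≤ C ∧ ∀ x, N x ≤ C * (1 + |x|) ^ e
  slow : ∀ δ : ℝ, 0 < δ → ∃ C, 0 ≤ C ∧ ∀ x s,
    |N (x - s) - N x| ≤ (δ * N x + C) * (1 + |s|) ^ e
  rapid : ∀ p : ℕ, ∃ C, 0 ≤ C ∧ ∀ x, (1 + |x|) ^ p ≤ C * Real.exp (N x)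

/-- The logarithm of the infinite product `∏ (1 + (x / μ j) ^ (2 * l))`. -/
def logProd (l : ℕ) (μ : ℕ → ℝ) (x : ℝ) : ℝ := ∑' j, Real.log (1 + (x / μ j) ^ (2 * l))

/-- Positive sequences for which the product defining `logProd` converges, with `l` nonzero. -/
structure ProdSeq (l : ℕ) (μ : ℕ → ℝ) : Prop where
  l_pos : 0 < l
  pos : ∀ j, 0 < μ j
  summable : Summable fun j => ((μ j)⁻¹) ^ (2 * l)

namespace ProdSeq

variable {l : ℕ} {μ : ℕ → ℝ}

theorem pow_nonneg' (l : ℕ) (x : ℝ) : 0 ≤ x ^ (2 * l) := (even_two_mul l).pow_nonneg x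

theorem log_nonneg (x : ℝ) : 0 ≤ Real.log (1 + x ^ (2 * l)) :=
  Real.log_nonneg (by linarith [pow_nonneg' l x])

theorem summable_log (h : ProdSeq l μ) (x : ℝ) :
    Summable fun j => Real.log (1 + (x / μ j) ^ (2 * l)) := by
  refine Summable.of_nonneg_of_le (fun j => log_nonneg _) (fun j => ?_)
    (h.summable.mul_left (x ^ (2 * l)))
  rw [← mul_pow, ← div_eq_mul_inv]
  have h1 := pow_nonneg' l (x / μ j)
  linarith [Real.log_le_sub_one_of_pos (show 0 < 1 + (x / μ j) ^ (2 * l) by linarith)]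

theorem logProd_nonneg (x : ℝ) : 0 ≤ logProd l μ x := tsum_nonneg fun _ => log_nonneg _

theorem logProd_abs (x : ℝ) : logProd l μ |x| = logProd l μ x := by
  unfold logProd
  congr 1
  ext j
  rw [div_pow, div_pow, (even_two_mul l).pow_abs]

theorem logProd_mono (h : ProdSeq l μ) {x y : ℝ} (hxy : |x| ≤ |y|) :
    logProd l μ x ≤ logProd l μ y := by
  refine (h.summable_log x).tsum_le_tsum (fun j => ?_) (h.summable_log y)
  have h1 := pow_nonneg' l (x / μ j)
  refine Real.log_le_log (by linarith) ?_
  have : (x / μ j) ^ (2 * l) ≤ (y / μ j) ^ (2 * l) := by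
    rw [← (even_two_mul l).pow_abs (x / μ j), ← (even_two_mul l).pow_abs (y / μ j)]
    refine pow_le_pow_left₀ (abs_nonneg _) ?_ _
    rw [abs_div, abs_div]
    gcongr
  linarith

theorem logProd_mul_le (h : ProdSeq l μ) {c : ℝ} (hc : 1 ≤ c) (x : ℝ) :
    logProd l μ (c * x) ≤ c ^ (2 * l) * logProd l μ x := by
  unfold logProd
  rw [← tsum_mul_left]
  refine (h.summable_log _).tsum_le_tsum (fun j => ?_) ((h.summable_log x).mul_left _)
  rw [mul_div_assoc, mul_pow]
  set a := c ^ (2 * l)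
  set b := (x / μ j) ^ (2 * l)
  have ha : 1 ≤ a := one_le_pow₀ hc
  have hb : 0 ≤ b := pow_nonneg' _ _
  rw [← Real.log_rpow (by linarith)]
  refine Real.log_le_log (by positivity) ?_
  linarith [one_add_mul_self_le_rpow_one_add (show -1 ≤ b by linarith) ha]

theorem measurable_logProd (h : ProdSeq l μ) : Measurable (logProd l μ) := by
  have h1 : Monotone fun x => logProd l μ (max x 0) := fun x y hxy => by
    refine h.logProd_mono ?_
    rw [abs_of_nonneg (le_max_right _ _), abs_of_nonneg (le_max_right _ _)]
    exact max_le_max_right _ hxy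
  have h2 : logProd l μ = (fun x => logProd l μ (max x 0)) ∘ fun x => |x| := by
    ext x
    simp [logProd_abs]
  rw [h2]
  exact h1.measurable.comp measurable_norm

theorem logProd_le_pow (h : ProdSeq l μ) (x : ℝ) :
    logProd l μ x ≤ logProd l μ 1 * (1 + |x|) ^ (2 * l) := by
  have h1 := h.logProd_mul_le (c := 1 + |x|) (by linarith [abs_nonneg x]) 1
  rw [mul_comm (logProd _ _ _)]
  refine le_trans (h.logProd_mono ?_) h1
  rw [mul_one, abs_of_nonneg (a := 1 + |x|) (by positivity)]
  linarith

theorem prod_le_exp_logProd (h : ProdSeq l μ) (s : Finset ℕ) (x : ℝ) :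
    ∏ j ∈ s, (1 + (x / μ j) ^ (2 * l)) ≤ Real.exp (logProd l μ x) := by
  have h0 : ∀ j, 0 < 1 + (x / μ j) ^ (2 * l) := fun j => by linarith [pow_nonneg' l (x / μ j)]
  rw [← Real.exp_log (Finset.prod_pos fun j _ => h0 j), Real.log_prod (fun j _ => (h0 j).ne')]
  exact Real.exp_le_exp.2 ((h.summable_log x).sum_le_tsum _ fun j _ => log_nonneg _)

theorem tendsto_prod (h : ProdSeq l μ) (x : ℝ) :
    Tendsto (fun K => ∏ j ∈ Finset.range K, (1 + (x / μ j) ^ (2 * l))) atTop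
      (𝓝 (Real.exp (logProd l μ x))) := by
  have h0 : ∀ j, 0 < 1 + (x / μ j) ^ (2 * l) := fun j => by linarith [pow_nonneg' l (x / μ j)]
  have h1 := (Real.continuous_exp.tendsto _).comp (h.summable_log x).hasSum.tendsto_sum_nat
  refine h1.congr fun K => ?_
  simp only [Function.comp]
  rw [← Real.log_prod (fun j _ => (h0 j).ne'), Real.exp_log (Finset.prod_pos fun j _ => h0 j)]

theorem slow_aux (h : ProdSeq l μ) {R : ℝ} (hR : 1 ≤ R) {a s b : ℝ} (ha : 0 ≤ a)
    (hs : 0 ≤ s) (hb : |b| ≤ a + s) :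
    logProd l μ b - logProd l μ a ≤
      ((2 * l : ℕ) / R * logProd l μ a + logProd l μ 1 * (1 + R) ^ (2 * l)) *
        (1 + s) ^ (2 * l + 1) := by
  have hNa := logProd_nonneg (l := l) (μ := μ) a
  have hN1 := logProd_nonneg (l := l) (μ := μ) 1
  have hb' : logProd l μ b ≤ logProd l μ (a + s) :=
    h.logProd_mono (by rwa [abs_of_nonneg (a := a + s) (by positivity)])
  rcases le_or_gt R a with hRa | hRa
  · have ha0 : 0 < a := by linarith
    set u := s / a
    have hu0 : 0 ≤ u := by positivity
    have hus : u ≤ s := div_le_self hs (hR.trans hRa)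
    have huR : u ≤ s / R := div_le_div_of_nonneg_left hs (by linarith) hRa
    have h1 := h.logProd_mul_le (c := 1 + u) (by linarith) a
    have h2 : (1 + u) * a = a + s := by simp only [u]; field_simp
    rw [h2] at h1
    have h3 : (1 + u) ^ (2 * l) - 1 ≤ (2 * l : ℕ) * u * (1 + u) ^ (2 * l) := by
      have := one_add_mul_le_pow (a := -(u / (1 + u))) (n := 2 * l) (by
        have : u / (1 + u) ≤ 1 := by rw [div_le_one (by linarith)]; linarith
        linarith)
      have e : 1 + -(u / (1 + u)) = (1 + u)⁻¹ := by field_simp; ring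
      rw [e, inv_pow] at this
      have hp : 0 < (1 + u) ^ (2 * l) := by positivity
      have h4 := mul_le_mul_of_nonneg_right this hp.le
      rw [inv_mul_cancel₀ hp.ne'] at h4
      have h5 : u / (1 + u) ≤ u := div_le_self hu0 (by linarith)
      have h6 : (2 * l : ℕ) * (u / (1 + u)) * (1 + u) ^ (2 * l)
        ≤ (2 * l : ℕ) * u * (1 + u) ^ (2 * l) := by gcongr
      nlinarith
    calc logProd l μ b - logProd l μ a ≤ ((1 + u) ^ (2 * l) - 1) * logProd l μ a := by linarith
      _ ≤ ((2 * l : ℕ) * (s / R) * (1 + s) ^ (2 * l)) * logProd l μ a := by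
        gcongr
        exact h3.trans (by gcongr)
      _ = ((2 * l : ℕ) / R * logProd l μ a) * (s * (1 + s) ^ (2 * l)) := by ring
      _ ≤ ((2 * l : ℕ) / R * logProd l μ a) * ((1 + s) ^ (2 * l + 1)) := by
        rw [pow_succ']
        gcongr
        linarith
      _ ≤ _ := by
        gcongr
        have : 0 ≤ logProd l μ 1 * (1 + R) ^ (2 * l) := by positivity
        linarith
  · calc logProd l μ b - logProd l μ a ≤ logProd l μ (a + s) := by linarith
      _ ≤ logProd l μ 1 * (1 + |a + s|) ^ (2 * l) := h.logProd_le_pow _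
      _ ≤ logProd l μ 1 * ((1 + R) * (1 + s)) ^ (2 * l) := by
        rw [abs_of_nonneg (a := a + s) (by positivity)]
        gcongr
        nlinarith
      _ = logProd l μ 1 * (1 + R) ^ (2 * l) * (1 + s) ^ (2 * l) := by
        rw [mul_pow, mul_assoc]
      _ ≤ logProd l μ 1 * (1 + R) ^ (2 * l) * (1 + s) ^ (2 * l + 1) := by
        gcongr
        · linarith
        · omega
      _ ≤ _ := by
        gcongr
        have : 0 ≤ (2 * l : ℕ) / R * logProd l μ a := by positivity
        linarith

theorem slowGrowth (h : ProdSeq l μ) : SlowGrowth (2 * l + 1) (logProd l μ) where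
  exponent_pos := Nat.succ_pos _
  meas := h.measurable_logProd
  nonneg := logProd_nonneg
  poly := by
    refine ⟨logProd l μ 1, logProd_nonneg 1, fun x => (h.logProd_le_pow x).trans ?_⟩
    have := logProd_nonneg (l := l) (μ := μ) 1
    gcongr
    · linarith [abs_nonneg x]
    · omega
  slow := by
    intro δ hδ
    set R : ℝ := max 1 ((2 * l : ℕ) / δ)
    have hR : 1 ≤ R := le_max_left _ _
    have hRδ : (2 * l : ℕ) / R ≤ δ := by
      rw [div_le_iff₀ (by linarith), ← div_le_iff₀' hδ]
      exact le_max_right _ _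
    have hC : 0 ≤ logProd l μ 1 * (1 + R) ^ (2 * l) :=
      mul_nonneg (logProd_nonneg _) (by positivity)
    refine ⟨_, hC, fun x s => ?_⟩
    have key : ∀ a b c : ℝ, |b| ≤ |a| + |s| → logProd l μ a ≤ logProd l μ c →
        logProd l μ b - logProd l μ a ≤
        (δ * logProd l μ c + logProd l μ 1 * (1 + R) ^ (2 * l)) * (1 + |s|) ^ (2 * l + 1) := by
      intro a b c hb hc
      have := h.slow_aux hR (abs_nonneg a) (abs_nonneg s) hb
      rw [logProd_abs] at this
      refine this.trans ?_
      have := logProd_nonneg (l := l) (μ := μ) a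
      gcongr
    have h1 : |x - s| ≤ |x| + |s| := abs_sub x s
    have h2 : |x| ≤ |x - s| + |s| := by simpa using abs_add_le (x - s) s
    rw [abs_le]
    constructor
    · rcases le_total |x - s| |x| with h3 | h3
      · linarith [key (x - s) x x h2 (h.logProd_mono h3)]
      · have h4 := h.logProd_mono h3
        have : 0 ≤ (δ * logProd l μ x + logProd l μ 1 * (1 + R) ^ (2 * l))
            * (1 + |s|) ^ (2 * l + 1) := by
          have := logProd_nonneg (l := l) (μ := μ) x
          positivity
        linarith
    · exact key x (x - s) x h1 le_rfl
  rapid := by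
    intro p
    have hpos : ∀ j, 0 < μ j := h.pos
    set s := Finset.range p
    have h1 : ∀ j x, (1 + |x|) ≤ (2 + μ j) * (1 + (x / μ j) ^ (2 * l)) := by
      intro j x
      have hj := hpos j
      have h2 : |x| / μ j ≤ 1 + (x / μ j) ^ (2 * l) := by
        have e : (x / μ j) ^ (2 * l) = (|x| / μ j) ^ (2 * l) := by
          rw [← (even_two_mul l).pow_abs, abs_div, abs_of_pos hj]
        rw [e]
        rcases le_total (|x| / μ j) 1 with h3 | h3
        · have : 0 ≤ (|x| / μ j) ^ (2 * l) := by positivity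
          linarith
        · have := le_self_pow₀ h3 (n := 2 * l) (by have := h.l_pos; omega)
          linarith
      rw [div_le_iff₀ hj] at h2
      have := pow_nonneg' l (x / μ j)
      nlinarith
    refine ⟨∏ j ∈ s, (2 + μ j), Finset.prod_nonneg fun j _ => by linarith [hpos j], fun x => ?_⟩
    calc (1 + |x|) ^ p = ∏ j ∈ s, (1 + |x|) := by simp [s]
      _ ≤ ∏ j ∈ s, ((2 + μ j) * (1 + (x / μ j) ^ (2 * l))) :=
        Finset.prod_le_prod (fun j _ => by positivity) fun j _ => h1 j x
      _ = (∏ j ∈ s, (2 + μ j)) * ∏ j ∈ s, (1 + (x / μ j) ^ (2 * l)) := Finset.prod_mul_distrib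
      _ ≤ _ := mul_le_mul_of_nonneg_left (h.prod_le_exp_logProd s x)
        (Finset.prod_nonneg fun j _ => by linarith [hpos j])

end ProdSeq

theorem exists_pow_mul_exp_neg_sq_le (k : ℕ) :
    ∃ C : ℝ, ∀ s : ℝ, (1 + |s|) ^ k * Real.exp (-s ^ 2 / 2) ≤ C := by
  refine ⟨k.factorial * Real.exp (3 / 2), fun s => ?_⟩
  have h1 := Real.pow_div_factorial_le_exp (1 + |s|) (by positivity) k
  rw [div_le_iff₀ (by positivity)] at h1
  calc (1 + |s|) ^ k * Real.exp (-s ^ 2 / 2)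
      ≤ Real.exp (1 + |s|) * k.factorial * Real.exp (-s ^ 2 / 2) := by gcongr
    _ = k.factorial * Real.exp (1 + |s| + -s ^ 2 / 2) := by
      rw [Real.exp_add (1 + |s|)]; ring
    _ ≤ _ := by
      gcongr
      nlinarith [sq_nonneg (|s| - 1), sq_abs s]

theorem integrable_pow_mul_exp_neg_sq (k : ℕ) :
    Integrable fun s : ℝ => (1 + |s|) ^ k * Real.exp (-s ^ 2 / 2) := by
  obtain ⟨C, hC⟩ := exists_pow_mul_exp_neg_sq_le (k + 2)
  have hc : Continuous fun s : ℝ => (1 + |s|) ^ k * Real.exp (-s ^ 2 / 2) := by fun_prop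
  have := integrable_of_norm_mul_le (f := fun s => ((1 + |s|) ^ k * Real.exp (-s ^ 2 / 2) : ℝ))
    (by fun_prop) (C := C) fun s => by
      rw [Complex.norm_real, Real.norm_of_nonneg (by positivity)]
      refine le_trans (le_of_eq ?_) (hC s)
      ring
  exact this.re

theorem norm_cexp_neg_sq (x y : ℝ) :
    ‖Complex.exp (-(x + y * Complex.I) ^ 2)‖ = Real.exp (y ^ 2 - x ^ 2) := by
  rw [Complex.norm_exp]
  congr 1
  simp [pow_two]

/-- Convolution of `N` with the normalized Gaussian, as a function on the complex plane. -/
def gaussConv (N : ℝ → ℝ) (z : ℂ) : ℂ :=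
  ((√Real.pi)⁻¹ : ℝ) * ∫ s : ℝ, N s * Complex.exp (-(z - s) ^ 2)

namespace SlowGrowth

variable {e : ℕ} {N : ℝ → ℝ}

theorem norm_cexp_neg_sub_sq_le {z : ℂ} {r n : ℝ} (h1 : |z.re| ≤ r) (h2 : |z.im| ≤ n) (s : ℝ) :
    ‖Complex.exp (-(z - s) ^ 2)‖ ≤ Real.exp (r ^ 2 + n ^ 2) * Real.exp (-s ^ 2 / 2) := by
  have e1 : (z - s : ℂ) = ((z.re - s : ℝ) : ℂ) + (z.im : ℝ) * Complex.I := by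
    apply Complex.ext <;> simp
  rw [e1, norm_cexp_neg_sq, ← Real.exp_add]
  refine Real.exp_le_exp.2 ?_
  have h3 : z.re ^ 2 ≤ r ^ 2 := sq_le_sq' (by linarith [neg_le_of_abs_le h1]) (le_of_abs_le h1)
  have h4 : z.im ^ 2 ≤ n ^ 2 := sq_le_sq' (by linarith [neg_le_of_abs_le h2]) (le_of_abs_le h2)
  nlinarith [sq_nonneg (2 * z.re - s)]

theorem differentiable_gaussConv (h : SlowGrowth e N) : Differentiable ℂ (gaussConv N) := by
  intro z0
  obtain ⟨C, hC0, hC⟩ := h.poly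
  have hmeas : ∀ g : ℝ → ℂ, Continuous g → AEStronglyMeasurable (fun s : ℝ => (N s : ℂ) * g s) :=
    fun g hg => ((Complex.measurable_ofReal.comp h.meas).mul hg.measurable).aestronglyMeasurable
  set r := |z0.re| + 1
  set n := |z0.im| + 1
  have hball : ∀ z ∈ Metric.ball z0 1, |z.re| ≤ r ∧ |z.im| ≤ n := by
    intro z hz
    rw [mem_ball_iff_norm] at hz
    have h1 := (Complex.abs_re_le_norm (z - z0)).trans hz.le
    have h2 := (Complex.abs_im_le_norm (z - z0)).trans hz.le
    rw [Complex.sub_re] at h1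
    rw [Complex.sub_im] at h2
    have h3 := abs_sub_abs_le_abs_sub z.re z0.re
    have h4 := abs_sub_abs_le_abs_sub z.im z0.im
    constructor <;> simp only [r, n] <;> linarith
  have key := hasDerivAt_integral_of_dominated_loc_of_deriv_le (𝕜 := ℂ) (μ := volume)
    (F := fun (z : ℂ) (s : ℝ) => (N s : ℂ) * Complex.exp (-(z - s) ^ 2))
    (F' := fun (z : ℂ) (s : ℝ) => (N s : ℂ) * (Complex.exp (-(z - s) ^ 2) * (-(2 * (z - s)))))
    (x₀ := z0) (s := Metric.ball z0 1)
    (bound := fun s : ℝ => (C * Real.exp (r ^ 2 + n ^ 2) * (2 * (r + n))) *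
      ((1 + |s|) ^ (e + 1) * Real.exp (-s ^ 2 / 2)))
    (Metric.ball_mem_nhds _ one_pos)
    (Eventually.of_forall fun z => hmeas _ (by fun_prop)) ?_ (hmeas _ (by fun_prop)) ?_ ?_ ?_
  · exact key.2.differentiableAt.const_mul _
  · refine ((integrable_pow_mul_exp_neg_sq e).const_mul (C * Real.exp (r ^ 2 + n ^ 2))).mono'
      (hmeas _ (by fun_prop)) (Eventually.of_forall fun s => ?_)
    obtain ⟨h1, h2⟩ := hball z0 (Metric.mem_ball_self one_pos)
    rw [norm_mul, Complex.norm_real, Real.norm_of_nonneg (h.nonneg s)]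
    calc _ ≤ (C * (1 + |s|) ^ e) * (Real.exp (r ^ 2 + n ^ 2) * Real.exp (-s ^ 2 / 2)) :=
          mul_le_mul (hC s) (norm_cexp_neg_sub_sq_le h1 h2 s) (norm_nonneg _) (by positivity)
      _ = _ := by ring
  · refine Eventually.of_forall fun s z hz => ?_
    obtain ⟨h1, h2⟩ := hball z hz
    have h3 : ‖-(2 * (z - s))‖ ≤ (2 * (r + n)) * (1 + |s|) := by
      rw [norm_neg, norm_mul, Complex.norm_ofNat]
      have h4 := norm_sub_le z (s : ℂ)
      rw [Complex.norm_real, Real.norm_eq_abs] at h4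
      have h5 := Complex.norm_le_abs_re_add_abs_im z
      have h6 : 1 ≤ r := by simp [r]
      have h7 : 1 ≤ n := by simp [n]
      nlinarith [abs_nonneg s]
    rw [norm_mul, norm_mul, Complex.norm_real, Real.norm_of_nonneg (h.nonneg s)]
    calc _ ≤ (C * (1 + |s|) ^ e) * ((Real.exp (r ^ 2 + n ^ 2) * Real.exp (-s ^ 2 / 2)) *
          ((2 * (r + n)) * (1 + |s|))) := by
          refine mul_le_mul (hC s) ?_ (by positivity) (by positivity)
          exact mul_le_mul (norm_cexp_neg_sub_sq_le h1 h2 s) h3 (norm_nonneg _) (by positivity)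
      _ = _ := by ring
  · exact (integrable_pow_mul_exp_neg_sq (e + 1)).const_mul _
  · refine Eventually.of_forall fun s z _ => ?_
    have e1 : HasDerivAt (fun z : ℂ => -(z - s) ^ 2) (-(2 * (z - s))) z := by
      have e2 := (((hasDerivAt_id z).sub_const (s : ℂ)).pow 2).neg
      simp only [id, Nat.cast_ofNat, Nat.add_one_sub_one, pow_one, mul_one] at e2
      exact e2
    exact e1.cexp.const_mul _

theorem norm_gaussConv_sub_le (h : SlowGrowth e N) (n : ℝ) :
    ∃ C, 0 ≤ C ∧ ∀ z : ℂ, |z.im| ≤ n → ‖gaussConv N z - N z.re‖ ≤ N z.re / 2 + C := by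
  set J : ℝ := ∫ s : ℝ, (1 + |s|) ^ e * Real.exp (-s ^ 2 / 2)
  have hJ : 0 ≤ J := integral_nonneg fun s => by positivity
  set c : ℝ := (√Real.pi)⁻¹ * Real.exp (n ^ 2)
  have hc : 0 < c := by positivity
  obtain ⟨C, hC0, hC⟩ := h.slow (1 / (2 * c * (J + 1))) (by positivity)
  refine ⟨c * C * J, by positivity, fun z hz => ?_⟩
  set x := z.re
  set y := z.im
  have hy : y ^ 2 ≤ n ^ 2 := sq_le_sq' (by linarith [neg_le_of_abs_le hz]) (le_of_abs_le hz)
  have hNx := h.nonneg x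
  have e1 : ∫ s : ℝ, (N s : ℂ) * Complex.exp (-(z - s) ^ 2) =
      ∫ s : ℝ, (N (x - s) : ℂ) * Complex.exp (-(s + y * Complex.I) ^ 2) := by
    rw [← integral_sub_left_eq_self _ volume x]
    congr 1
    ext s
    congr 4
    apply Complex.ext <;> simp [x, y]
  have e2 : ∫ s : ℝ, Complex.exp (-(s + y * Complex.I) ^ 2) = (√Real.pi : ℝ) := by
    have := GaussianFourier.integral_cexp_neg_mul_sq_add_real_mul_I (b := 1) (by simp) y
    simp only [neg_mul, one_mul, div_one] at this
    rw [this, Real.sqrt_eq_rpow, Complex.ofReal_cpow Real.pi_pos.le]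
    norm_num
  have hbound : ∀ s : ℝ, ‖Complex.exp (-(s + y * Complex.I) ^ 2)‖
      ≤ Real.exp (n ^ 2) * Real.exp (-s ^ 2 / 2) := by
    intro s
    rw [norm_cexp_neg_sq, ← Real.exp_add]
    exact Real.exp_le_exp.2 (by nlinarith [sq_nonneg s])
  have hmeas2 : Continuous fun s : ℝ => Complex.exp (-(s + y * Complex.I) ^ 2) := by fun_prop
  have hdiff : ∀ s, ‖((N (x - s) : ℂ) - N x) * Complex.exp (-(s + y * Complex.I) ^ 2)‖ ≤
      (Real.exp (n ^ 2) * (1 / (2 * c * (J + 1)) * N x + C)) *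
        ((1 + |s|) ^ e * Real.exp (-s ^ 2 / 2)) := by
    intro s
    rw [norm_mul, ← Complex.ofReal_sub, Complex.norm_real, Real.norm_eq_abs]
    calc _ ≤ ((1 / (2 * c * (J + 1)) * N x + C) * (1 + |s|) ^ e) *
          (Real.exp (n ^ 2) * Real.exp (-s ^ 2 / 2)) :=
          mul_le_mul (hC x s) (hbound s) (norm_nonneg _) (by positivity)
      _ = _ := by ring
  have hi1 : Integrable fun s : ℝ => (N x : ℂ) * Complex.exp (-(s + y * Complex.I) ^ 2) := by
    refine Integrable.const_mul ?_ _
    refine ((integrable_pow_mul_exp_neg_sq 0).const_mul (Real.exp (n ^ 2))).mono'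
      hmeas2.aestronglyMeasurable (Eventually.of_forall fun s => ?_)
    simpa using hbound s
  have hi2 : Integrable fun s : ℝ =>
      ((N (x - s) : ℂ) - N x) * Complex.exp (-(s + y * Complex.I) ^ 2) := by
    refine ((integrable_pow_mul_exp_neg_sq e).const_mul _).mono' ?_ (Eventually.of_forall hdiff)
    refine Measurable.aestronglyMeasurable (Measurable.mul (Measurable.sub_const ?_ _)
      hmeas2.measurable)
    exact Complex.measurable_ofReal.comp (h.meas.comp (measurable_const.sub measurable_id))
  have e3 : gaussConv N z - N x = ((√Real.pi)⁻¹ : ℝ) *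
      ∫ s : ℝ, ((N (x - s) : ℂ) - N x) * Complex.exp (-(s + y * Complex.I) ^ 2) := by
    have e4 : ∫ s : ℝ, (N (x - s) : ℂ) * Complex.exp (-(s + y * Complex.I) ^ 2) =
        (∫ s : ℝ, ((N (x - s) : ℂ) - N x) * Complex.exp (-(s + y * Complex.I) ^ 2)) +
        N x * (√Real.pi : ℝ) := by
      rw [← e2, ← integral_const_mul, ← integral_add hi2 hi1]
      congr 1
      ext s
      ring
    have hpi : ((√Real.pi : ℝ) : ℂ) ≠ 0 := by
      exact_mod_cast (Real.sqrt_pos.2 Real.pi_pos).ne'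
    rw [gaussConv, e1, e4]
    push_cast
    field_simp
    ring
  rw [e3, norm_mul, Complex.norm_real, Real.norm_of_nonneg (by positivity)]
  have h5 := norm_integral_le_of_norm_le ((integrable_pow_mul_exp_neg_sq e).const_mul _)
    (Eventually.of_forall hdiff)
  rw [integral_const_mul] at h5
  calc _ ≤ (√Real.pi)⁻¹ * (Real.exp (n ^ 2) * (1 / (2 * c * (J + 1)) * N x + C) * J) := by gcongr
    _ = (c / (2 * c * (J + 1)) * J) * N x + c * C * J := by simp only [c]; ring
    _ ≤ 1 / 2 * N x + c * C * J := by
      gcongr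
      have : c / (2 * c * (J + 1)) * J = (J / (J + 1)) / 2 := by field_simp
      rw [this]
      have : J / (J + 1) ≤ 1 := by rw [div_le_one (by positivity)]; linarith
      linarith
    _ = _ := by ring

end SlowGrowth

theorem exists_norm_one_add_pow_sub_one_le (k : ℕ) :
    ∃ δ : ℝ, 0 < δ ∧ ∀ ζ : ℂ, ‖ζ‖ ≤ δ → ‖(1 + ζ) ^ k - 1‖ ≤ 1 / 2 := by
  have hc : ContinuousAt (fun ζ : ℂ => (1 + ζ) ^ k - 1) 0 := by fun_prop
  rw [Metric.continuousAt_iff] at hc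
  obtain ⟨δ, hδ, h⟩ := hc (1 / 2) (by norm_num)
  refine ⟨δ / 2, by positivity, fun ζ hζ => ?_⟩
  have := h (x := ζ) (by rw [dist_zero_right]; linarith)
  simpa [dist_eq_norm] using this.le

theorem re_mul_ge {r : ℝ} (hr : 0 ≤ r) {a : ℂ} (ha : ‖a - 1‖ ≤ 1 / 2) : r / 2 ≤ (r * a : ℂ).re := by
  have h1 := (Complex.abs_re_le_norm (a - 1)).trans ha
  rw [Complex.sub_re, Complex.one_re, abs_le] at h1
  rw [Complex.re_ofReal_mul]
  nlinarith

/-- On horizontal strips, the real part of an even power is comparable to that of its real part. -/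
theorem exists_re_pow_ge (e : ℕ) (n : ℝ) :
    ∃ C, 0 ≤ C ∧ ∀ z : ℂ, |z.im| ≤ n → z.re ^ (2 * e) / 2 - C ≤ (z ^ (2 * e)).re := by
  rcases lt_or_ge n 0 with hn | hn
  · exact ⟨0, le_rfl, fun z hz => absurd hz (by have := abs_nonneg z.im; linarith)⟩
  obtain ⟨δ, hδ, h⟩ := exists_norm_one_add_pow_sub_one_le (2 * e)
  refine ⟨2 * (n / δ + n) ^ (2 * e), by positivity, fun z hz => ?_⟩
  have hev := even_two_mul e
  rcases le_or_gt (n / δ) |z.re| with h1 | h1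
  · rcases eq_or_ne z.re 0 with h0 | h0
    · have hn0 : n = 0 := by
        rw [h0, abs_zero] at h1
        by_contra hne
        have : 0 < n / δ := div_pos (lt_of_le_of_ne hn (Ne.symm hne)) hδ
        linarith
      have hz0 : z = 0 := by
        apply Complex.ext
        · simpa using h0
        · rw [hn0] at hz
          simpa using abs_nonpos_iff.1 hz
      have : (0 : ℝ) ≤ (n / δ + n) ^ (2 * e) := by positivity
      rcases Nat.eq_zero_or_pos e with he | he
      · subst he
        simp
        norm_num
      · simp [hz0, he.ne']
        exact hev.pow_nonneg _
    have e1 : z ^ (2 * e) = ((z.re ^ (2 * e) : ℝ) : ℂ) * (1 + z.im / z.re * Complex.I) ^ (2 * e) := by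
      have hc : (z.re : ℂ) ≠ 0 := by exact_mod_cast h0
      rw [Complex.ofReal_pow, ← mul_pow]
      congr 1
      conv_lhs => rw [← Complex.re_add_im z]
      field_simp
    rw [e1]
    have := re_mul_ge (hev.pow_nonneg z.re) (h (z.im / z.re * Complex.I) (by
      rw [norm_mul, Complex.norm_I, mul_one, norm_div, Complex.norm_real, Complex.norm_real,
        Real.norm_eq_abs, Real.norm_eq_abs, div_le_iff₀ (abs_pos.2 h0)]
      rw [div_le_iff₀ hδ] at h1
      linarith))
    have : (0 : ℝ) ≤ (n / δ + n) ^ (2 * e) := by positivity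
    linarith
  · have h2 : ‖z‖ ≤ n / δ + n := (Complex.norm_le_abs_re_add_abs_im z).trans (by linarith)
    have h3 : ‖z ^ (2 * e)‖ ≤ (n / δ + n) ^ (2 * e) := by
      rw [norm_pow]
      gcongr
    have h4 := neg_le_of_abs_le ((Complex.abs_re_le_norm _).trans h3)
    have h5 : z.re ^ (2 * e) ≤ (n / δ + n) ^ (2 * e) := by
      rw [← hev.pow_abs]
      gcongr
      linarith
    have : (0 : ℝ) ≤ (n / δ + n) ^ (2 * e) := by positivity
    linarith

/-- The symbol of the convolution factor. -/
def symInv (N : ℝ → ℝ) (z : ℂ) : ℂ := Complex.exp (-(4 * gaussConv N z))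

/-- The mollified symbol of the inverse convolution operator. -/
def symP (e : ℕ) (N : ℝ → ℝ) (m : ℕ) (z : ℂ) : ℂ :=
  Complex.exp (4 * gaussConv N z - (z / (m + 1)) ^ (2 * e))

/-- The symbol of the mollifier. -/
def symMol (e : ℕ) (z : ℂ) : ℂ := Complex.exp (-z ^ (2 * e))

theorem symInv_mul_symP (e : ℕ) (N : ℝ → ℝ) (m : ℕ) (z : ℂ) :
    symInv N z * symP e N m z = symMol e (z / (m + 1)) := by
  rw [symInv, symP, symMol, ← Complex.exp_add]
  congr 1
  ring

theorem div_natCast_add_one (z : ℂ) (m : ℕ) :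
    z / ((m : ℂ) + 1) = ((m + 1 : ℝ)⁻¹ : ℝ) * z := by
  push_cast
  rw [div_eq_inv_mul]

theorem strip_scale {n : ℝ} {z : ℂ} (hz : |z.im| ≤ n) (m : ℕ) :
    |(z / ((m : ℂ) + 1)).im| ≤ n ∧ (z / ((m : ℂ) + 1)).re = z.re / (m + 1) := by
  rw [div_natCast_add_one, Complex.im_ofReal_mul, Complex.re_ofReal_mul]
  refine ⟨?_, by rw [div_eq_inv_mul]⟩
  rw [abs_mul, abs_of_pos (by positivity)]
  refine le_trans ?_ hz
  exact mul_le_of_le_one_left (abs_nonneg _) (inv_le_one_of_one_le₀ (by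
    have : (0 : ℝ) ≤ m := by positivity
    linarith))

theorem exists_exp_sub_sq_le (a c : ℝ) (hc : 0 < c) (e p : ℕ) (he : 0 < e) :
    ∃ C, ∀ x : ℝ, Real.exp (a * (1 + |x|) ^ e - c * x ^ (2 * e)) * (1 + |x|) ^ p ≤ C := by
  set c' := c / 2 ^ (2 * e)
  have hc' : 0 < c' := by positivity
  refine ⟨p.factorial * Real.exp ((a + 1) ^ 2 / c' + c), fun x => ?_⟩
  set X := (1 + |x|) ^ e
  have h1 := Real.pow_div_factorial_le_exp (1 + |x|) (by positivity) p
  rw [div_le_iff₀ (by positivity)] at h1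
  have h2 : 1 + |x| ≤ X := le_self_pow₀ (by linarith [abs_nonneg x]) he.ne'
  have h3 : X ^ 2 ≤ 2 ^ (2 * e) * (1 + x ^ (2 * e)) := by
    have e1 : X ^ 2 = (1 + |x|) ^ (2 * e) := by simp only [X]; ring
    rw [e1, ← (even_two_mul e).pow_abs x]
    refine (add_pow_le zero_le_one (abs_nonneg x) (2 * e)).trans ?_
    rw [one_pow]
    gcongr
    · norm_num
    · omega
  have h4 : c' * X ^ 2 ≤ c * (1 + x ^ (2 * e)) := by
    calc c' * X ^ 2 ≤ c' * (2 ^ (2 * e) * (1 + x ^ (2 * e))) := by gcongr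
      _ = _ := by simp only [c']; field_simp
  have h5 : (a + 1) * X ≤ c' * X ^ 2 + (a + 1) ^ 2 / c' := by
    have : 0 ≤ (c' * X - (a + 1)) ^ 2 := sq_nonneg _
    have h6 : (a + 1) * X * c' ≤ (c' * X ^ 2 + (a + 1) ^ 2 / c') * c' := by
      rw [add_mul (c' * X ^ 2), div_mul_cancel₀ _ hc'.ne']
      nlinarith [sq_nonneg (c' * X), sq_nonneg (a + 1)]
    exact le_of_mul_le_mul_right h6 hc'
  calc _ ≤ Real.exp (a * X - c * x ^ (2 * e)) * (Real.exp (1 + |x|) * p.factorial) := by gcongr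
    _ = p.factorial * Real.exp (a * X - c * x ^ (2 * e) + (1 + |x|)) := by
      rw [Real.exp_add (a * X - c * x ^ (2 * e))]; ring
    _ ≤ _ := mul_le_mul_of_nonneg_left (Real.exp_le_exp.2 (by linarith)) (by positivity)

theorem exists_norm_symMol_le (e : ℕ) (n : ℝ) :
    ∃ C, 0 ≤ C ∧ ∀ z : ℂ, |z.im| ≤ n → ‖symMol e z‖ ≤ C * Real.exp (-(z.re ^ (2 * e) / 2)) := by
  obtain ⟨C, -, hC⟩ := exists_re_pow_ge e n
  refine ⟨Real.exp C, by positivity, fun z hz => ?_⟩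
  rw [symMol, Complex.norm_exp, ← Real.exp_add, Complex.neg_re]
  exact Real.exp_le_exp.2 (by linarith [hC z hz])

theorem stripRapid_symMol {e : ℕ} (he : 0 < e) (n : ℝ) : StripRapid n (symMol e) := by
  refine ⟨fun z _ => by unfold symMol; fun_prop, fun p => ?_⟩
  obtain ⟨C, hC0, hC⟩ := exists_norm_symMol_le e n
  obtain ⟨C', hC'⟩ := exists_exp_sub_sq_le 0 (1 / 2) (by norm_num) e p he
  refine ⟨C * C', fun z hz => ?_⟩
  calc _ ≤ C * Real.exp (-(z.re ^ (2 * e) / 2)) * (1 + |z.re|) ^ p := by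
        gcongr; exact hC z hz
    _ = C * (Real.exp (0 * (1 + |z.re|) ^ e - 1 / 2 * z.re ^ (2 * e)) * (1 + |z.re|) ^ p) := by
        rw [mul_assoc]; congr 3; ring
    _ ≤ _ := by gcongr; exact hC' _

namespace SlowGrowth

variable {e : ℕ} {N : ℝ → ℝ}

theorem abs_re_gaussConv_sub_le (h : SlowGrowth e N) (n : ℝ) :
    ∃ C, 0 ≤ C ∧ ∀ z : ℂ, |z.im| ≤ n → N z.re / 2 - C ≤ (gaussConv N z).re ∧
      (gaussConv N z).re ≤ 3 / 2 * N z.re + C := by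
  obtain ⟨C, hC0, hC⟩ := h.norm_gaussConv_sub_le n
  refine ⟨C, hC0, fun z hz => ?_⟩
  have h1 := (Complex.abs_re_le_norm _).trans (hC z hz)
  rw [Complex.sub_re, Complex.ofReal_re, abs_le] at h1
  constructor <;> linarith

theorem exists_norm_symInv_le (h : SlowGrowth e N) (n : ℝ) :
    ∃ C, 0 ≤ C ∧ ∀ z : ℂ, |z.im| ≤ n → ‖symInv N z‖ ≤ C * Real.exp (-(2 * N z.re)) := by
  obtain ⟨C, -, hC⟩ := h.abs_re_gaussConv_sub_le n
  refine ⟨Real.exp (4 * C), by positivity, fun z hz => ?_⟩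
  rw [symInv, Complex.norm_exp, ← Real.exp_add]
  refine Real.exp_le_exp.2 ?_
  have : (-(4 * gaussConv N z)).re = -(4 * (gaussConv N z).re) := by simp
  rw [this]
  linarith [(hC z hz).1]

theorem exists_norm_cexp_gaussConv_le (h : SlowGrowth e N) (n : ℝ) :
    ∃ C, 0 ≤ C ∧ ∀ z : ℂ, |z.im| ≤ n →
      ‖Complex.exp (4 * gaussConv N z)‖ ≤ C * Real.exp (6 * N z.re) := by
  obtain ⟨C, -, hC⟩ := h.abs_re_gaussConv_sub_le n
  refine ⟨Real.exp (4 * C), by positivity, fun z hz => ?_⟩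
  rw [Complex.norm_exp, ← Real.exp_add]
  refine Real.exp_le_exp.2 ?_
  have : (4 * gaussConv N z).re = 4 * (gaussConv N z).re := by simp
  rw [this]
  linarith [(hC z hz).2]

theorem _root_.symP_eq (m : ℕ) (z : ℂ) :
    symP e N m z = Complex.exp (4 * gaussConv N z) * symMol e (z / (m + 1)) := by
  rw [symP, symMol, ← Complex.exp_add]
  congr 1

theorem exists_norm_symP_le (h : SlowGrowth e N) (n : ℝ) :
    ∃ C, 0 ≤ C ∧ ∀ m, ∀ z : ℂ, |z.im| ≤ n → ‖symP e N m z‖ ≤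
      C * Real.exp (6 * N z.re) * Real.exp (-((z.re / (m + 1)) ^ (2 * e) / 2)) := by
  obtain ⟨C, hC0, hC⟩ := h.exists_norm_cexp_gaussConv_le n
  obtain ⟨C', hC0', hC'⟩ := exists_norm_symMol_le e n
  refine ⟨C * C', by positivity, fun m z hz => ?_⟩
  obtain ⟨h1, h2⟩ := strip_scale hz m
  rw [symP_eq, norm_mul]
  have h3 := hC' _ h1
  rw [h2] at h3
  calc _ ≤ (C * Real.exp (6 * N z.re)) *
        (C' * Real.exp (-((z.re / (m + 1)) ^ (2 * e) / 2))) :=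
      mul_le_mul (hC z hz) h3 (norm_nonneg _) (by positivity)
    _ = _ := by ring

theorem stripRapid_symInv (h : SlowGrowth e N) (n : ℝ) : StripRapid n (symInv N) := by
  refine ⟨fun z _ => ?_, fun p => ?_⟩
  · exact ((h.differentiable_gaussConv z).const_mul 4).neg.cexp
  · obtain ⟨C, hC0, hC⟩ := h.exists_norm_symInv_le n
    obtain ⟨C', hC0', hC'⟩ := h.rapid p
    refine ⟨C * C', fun z hz => ?_⟩
    calc _ ≤ C * Real.exp (-(2 * N z.re)) * (C' * Real.exp (N z.re)) :=
          mul_le_mul (hC z hz) (hC' _) (by positivity) (by positivity)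
      _ = C * C' * Real.exp (-N z.re) := by
          rw [show -N z.re = -(2 * N z.re) + N z.re by ring, Real.exp_add]; ring
      _ ≤ C * C' * 1 := by
          gcongr
          exact Real.exp_le_one_iff.2 (by linarith [h.nonneg z.re])
      _ = _ := mul_one _

theorem stripRapid_symP (h : SlowGrowth e N) (n : ℝ) (m : ℕ) : StripRapid n (symP e N m) := by
  refine ⟨fun z _ => ?_, fun p => ?_⟩
  · have := (h.differentiable_gaussConv z).const_mul 4
    exact (this.sub (by fun_prop)).cexp
  · obtain ⟨C, hC0, hC⟩ := h.exists_norm_symP_le n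
    obtain ⟨D, hD0, hD⟩ := h.poly
    obtain ⟨C', hC'⟩ := exists_exp_sub_sq_le (6 * D) (1 / (2 * (m + 1) ^ (2 * e)))
      (by positivity) e p h.exponent_pos
    refine ⟨C * C', fun z hz => ?_⟩
    calc _ ≤ (C * Real.exp (6 * N z.re) * Real.exp (-((z.re / (m + 1)) ^ (2 * e) / 2))) *
          (1 + |z.re|) ^ p := by gcongr; exact hC m z hz
      _ = C * (Real.exp (6 * N z.re - 1 / (2 * (m + 1) ^ (2 * e)) * z.re ^ (2 * e)) *
          (1 + |z.re|) ^ p) := by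
          rw [sub_eq_add_neg, Real.exp_add, div_pow]
          have : (z.re ^ (2 * e) / ((m : ℝ) + 1) ^ (2 * e) / 2) =
            1 / (2 * (m + 1) ^ (2 * e)) * z.re ^ (2 * e) := by field_simp
          rw [this]
          ring
      _ ≤ C * (Real.exp (6 * D * (1 + |z.re|) ^ e - 1 / (2 * (m + 1) ^ (2 * e)) * z.re ^ (2 * e)) *
          (1 + |z.re|) ^ p) := by
          refine mul_le_mul_of_nonneg_left (mul_le_mul_of_nonneg_right
            (Real.exp_le_exp.2 ?_) (by positivity)) hC0
          linarith [hD z.re]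
      _ ≤ _ := by gcongr; exact hC' _

theorem tendsto_symP (h : SlowGrowth e N) (z : ℂ) :
    Tendsto (fun m => symP e N m z) atTop (𝓝 (Complex.exp (4 * gaussConv N z))) := by
  have h1 : Tendsto (fun k : ℕ => z / ((k : ℂ) + 1)) atTop (𝓝 0) := by
    have := (tendsto_one_div_add_atTop_nhds_zero_nat (𝕜 := ℂ)).const_mul z
    simpa [div_eq_mul_inv] using this
  have h2 : Continuous fun y : ℂ => Complex.exp (4 * gaussConv N z - y ^ (2 * e)) := by fun_prop
  have h3 := (h2.tendsto 0).comp h1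
  simp only [zero_pow (mul_ne_zero two_ne_zero h.exponent_pos.ne'), sub_zero] at h3
  exact h3

end SlowGrowth

theorem StripRapid.hasDerivAt_invFT' {n : ℝ} {u : ℂ → ℂ} (h : StripRapid n u) (hn : 0 ≤ n)
    (k : ℕ) (t : ℝ) :
    HasDerivAt (invFT fun z => (Complex.I * z) ^ k * u z)
      (invFT (fun z => (Complex.I * z) ^ (k + 1) * u z) t) t := by
  have := (h.mul_pow hn k).hasDerivAt_invFT hn t
  convert this using 3
  ring

theorem integrable_mul_neg_of_exp_bound {g f : ℝ → ℂ} (hg : Continuous g) (hf : Continuous f)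
    {n κ C D : ℝ} (hn : κ < n) (hgC : ∀ t, ‖g t‖ ≤ C * Real.exp (-n * |t|))
    (hfD : ∀ t, ‖f t‖ ≤ D * Real.exp (κ * |t|)) : Integrable fun t => g t * f (-t) := by
  refine ((integrable_exp_neg_mul_abs (sub_pos.2 hn)).const_mul (C * D)).mono'
    (hg.mul (hf.comp continuous_neg)).aestronglyMeasurable (Eventually.of_forall fun t => ?_)
  have h1 := hfD (-t)
  rw [abs_neg] at h1
  rw [norm_mul]
  calc _ ≤ (C * Real.exp (-n * |t|)) * (D * Real.exp (κ * |t|)) :=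
        mul_le_mul (hgC t) h1 (norm_nonneg _) ((norm_nonneg _).trans (hgC t))
    _ = C * D * (Real.exp (-n * |t|) * Real.exp (κ * |t|)) := by ring
    _ = _ := by rw [← Real.exp_add]; congr 2; ring

theorem StripRapid.integral_mul_neg_eq {n κ : ℝ} {v : ℂ → ℂ} (hv : StripRapid n v) (hn : 0 ≤ n)
    (hκ : κ < n) (k : ℕ) {f : ℝ → ℂ} (hf : ContDiff ℝ (⊤ : ℕ∞) f)
    (hb : ∀ k, ∃ C, ∀ t, ‖iteratedDeriv k f t‖ ≤ C * Real.exp (κ * |t|)) :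
    ∫ t, invFT (fun z => (Complex.I * z) ^ k * v z) t * f (-t) =
      ∫ t, invFT v t * iteratedDeriv k f (-t) := by
  induction k generalizing f with
  | zero => simp
  | succ k ih =>
    have hf' : ContDiff ℝ (⊤ : ℕ∞) (deriv f) := hf.iterate_deriv 1
    rw [iteratedDeriv_succ', ← ih hf' fun k => by
      rw [← iteratedDeriv_succ']; exact hb (k + 1)]
    have hd : ∀ t, HasDerivAt (fun t => f (-t)) (-deriv f (-t)) t := by
      intro t
      have h1 : HasDerivAt f (deriv f (-t)) (-t) :=
        (hf.differentiable (by simp) _).hasDerivAt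
      have h2 := h1.scomp t (hasDerivAt_neg t)
      rw [neg_one_smul] at h2
      exact h2
    obtain ⟨C0, -, h0⟩ := (hv.mul_pow hn k).exists_norm_invFT_le hn
    obtain ⟨C1, -, h1⟩ := (hv.mul_pow hn (k + 1)).exists_norm_invFT_le hn
    obtain ⟨D0, hD0⟩ := hb 0
    obtain ⟨D1, hD1⟩ := hb 1
    simp only [iteratedDeriv_zero, iteratedDeriv_one] at hD0 hD1
    have hc0 := (hv.mul_pow hn k).continuous_invFT hn
    have hc1 := (hv.mul_pow hn (k + 1)).continuous_invFT hn
    have key := integral_mul_deriv_eq_deriv_mul_of_integrable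
      (u := fun t => f (-t)) (v := invFT fun z => (Complex.I * z) ^ k * v z)
      (u' := fun t => -deriv f (-t)) (v' := invFT fun z => (Complex.I * z) ^ (k + 1) * v z)
      (fun t _ => hd t) (fun t _ => hv.hasDerivAt_invFT' hn k t)
      ((integrable_mul_neg_of_exp_bound hc1 hf.continuous hκ h1 hD0).congr
        (Eventually.of_forall fun t => mul_comm _ _))
      ((integrable_mul_neg_of_exp_bound hc0 hf'.continuous hκ h0 hD1).neg.congr
        (Eventually.of_forall fun t => by simp; ring))
      ((integrable_mul_neg_of_exp_bound hc0 hf.continuous hκ h0 hD0).congr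
        (Eventually.of_forall fun t => mul_comm _ _))
    calc _ = ∫ t, f (-t) * invFT (fun z => (Complex.I * z) ^ (k + 1) * v z) t := by
          simp only [mul_comm]
      _ = _ := by
          rw [key, ← integral_neg]
          congr 1
          ext t
          ring

theorem StripRapid.invFT_eval_mul {n : ℝ} {v : ℂ → ℂ} (hv : StripRapid n v) (hn : 0 ≤ n)
    (r : Polynomial ℂ) (t : ℝ) :
    invFT (fun z => r.eval (Complex.I * z) * v z) t =
      ∑ k ∈ Finset.range (r.natDegree + 1),
        r.coeff k * invFT (fun z => (Complex.I * z) ^ k * v z) t := by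
  simp only [invFT]
  have h1 : ∀ k, Integrable fun x : ℝ =>
      r.coeff k * ((Complex.I * x) ^ k * v x * Complex.exp (x * t * Complex.I)) := by
    intro k
    refine Integrable.const_mul ?_ _
    have hi := (hv.mul_pow hn k).integrable_real hn
    refine hi.norm.mono' (hi.aestronglyMeasurable.mul (by fun_prop))
      (Eventually.of_forall fun x => ?_)
    rw [norm_mul (_ * _), Complex.norm_exp]
    simp
  have h2 : ∀ x : ℝ, r.eval (Complex.I * x) * v x * Complex.exp (x * t * Complex.I) =
      ∑ k ∈ Finset.range (r.natDegree + 1),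
        r.coeff k * ((Complex.I * x) ^ k * v x * Complex.exp (x * t * Complex.I)) := by
    intro x
    rw [Polynomial.eval_eq_sum_range, Finset.sum_mul, Finset.sum_mul]
    exact Finset.sum_congr rfl fun k _ => by ring
  simp_rw [h2]
  rw [integral_finsetSum _ fun k _ => h1 k, Finset.mul_sum]
  refine Finset.sum_congr rfl fun k _ => ?_
  rw [integral_const_mul]
  ring

theorem integral_exp_neg_abs : ∫ t : ℝ, Real.exp (-|t|) = 2 := by
  rw [integral_comp_abs (f := fun t => Real.exp (-t)), integral_exp_neg_Ioi_zero, mul_one]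

theorem StripRapid.norm_integral_eval_mul_le {κ : ℝ} {v : ℂ → ℂ} (hκ : 0 ≤ κ)
    (hv : StripRapid (κ + 1) v) (r : Polynomial ℂ) {f : ℝ → ℂ} (hf : ContDiff ℝ (⊤ : ℕ∞) f)
    {B : ℝ} (hB : 0 ≤ B) {a : ℕ → ℝ}
    (hb : ∀ k t, ‖iteratedDeriv k f t‖ ≤ B * a k * Real.exp (κ * |t|))
    (ha : ∑ k ∈ Finset.range (r.natDegree + 1), ‖r.coeff k‖ * a k ≤ 1) :
    ‖∫ t, invFT (fun z => r.eval (Complex.I * z) * v z) t * f (-t)‖ ≤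
      2 * B * ((∫ x : ℝ, ‖v (x + (κ + 1 : ℝ) * Complex.I)‖) +
        ∫ x : ℝ, ‖v (x - (κ + 1 : ℝ) * Complex.I)‖) := by
  set J := (∫ x : ℝ, ‖v (x + (κ + 1 : ℝ) * Complex.I)‖) +
        ∫ x : ℝ, ‖v (x - (κ + 1 : ℝ) * Complex.I)‖
  have hn : 0 ≤ κ + 1 := by linarith
  have hJ : 0 ≤ J := by positivity
  have hlt : κ < κ + 1 := by linarith
  have hb' : ∀ k, ∃ C, ∀ t, ‖iteratedDeriv k f t‖ ≤ C * Real.exp (κ * |t|) :=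
    fun k => ⟨_, hb k⟩
  have hcont : ∀ k, Continuous (iteratedDeriv k f) := fun k => by
    exact hf.continuous_iteratedDeriv k (by exact_mod_cast le_top)
  have hi : ∀ k, Integrable fun t => invFT (fun z => (Complex.I * z) ^ k * v z) t * f (-t) := by
    intro k
    obtain ⟨C0, -, h0⟩ := (hv.mul_pow hn k).exists_norm_invFT_le hn
    exact integrable_mul_neg_of_exp_bound ((hv.mul_pow hn k).continuous_invFT hn) (hcont 0)
      hlt h0 (by simpa using hb 0)
  have hterm : ∀ k, ‖∫ t, invFT v t * iteratedDeriv k f (-t)‖ ≤ J * (B * a k) * 2 := by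
    intro k
    have h1 : ∀ t, ‖invFT v t * iteratedDeriv k f (-t)‖ ≤ J * (B * a k) * Real.exp (-|t|) := by
      intro t
      have h2 := hb k (-t)
      rw [abs_neg] at h2
      rw [norm_mul]
      calc _ ≤ (J * Real.exp (-(κ + 1) * |t|)) * (B * a k * Real.exp (κ * |t|)) :=
            mul_le_mul (hv.norm_invFT_le hn t) h2 (norm_nonneg _) (by positivity)
        _ = J * (B * a k) * (Real.exp (-(κ + 1) * |t|) * Real.exp (κ * |t|)) := by ring
        _ = _ := by rw [← Real.exp_add]; congr 2; ring
    have h3 : Integrable fun t : ℝ => Real.exp (-|t|) := by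
      simpa using integrable_exp_neg_mul_abs one_pos
    have h4 := norm_integral_le_of_norm_le (h3.const_mul (J * (B * a k)))
      (Eventually.of_forall h1)
    rwa [integral_const_mul, integral_exp_neg_abs] at h4
  have e1 : ∫ t, invFT (fun z => r.eval (Complex.I * z) * v z) t * f (-t) =
      ∑ k ∈ Finset.range (r.natDegree + 1),
        r.coeff k * ∫ t, invFT v t * iteratedDeriv k f (-t) := by
    simp_rw [hv.invFT_eval_mul hn r, Finset.sum_mul, mul_assoc]
    rw [integral_finsetSum _ fun k _ => (hi k).const_mul _]
    refine Finset.sum_congr rfl fun k _ => ?_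
    rw [integral_const_mul, hv.integral_mul_neg_eq hn hlt k hf hb']
  rw [e1]
  calc _ ≤ ∑ k ∈ Finset.range (r.natDegree + 1), ‖r.coeff k‖ * (J * (B * a k) * 2) := by
        refine (norm_sum_le _ _).trans (Finset.sum_le_sum fun k _ => ?_)
        rw [norm_mul]
        gcongr
        exact hterm k
    _ = 2 * B * J * ∑ k ∈ Finset.range (r.natDegree + 1), ‖r.coeff k‖ * a k := by
        rw [Finset.mul_sum]
        exact Finset.sum_congr rfl fun k _ => by ring
    _ ≤ 2 * B * J * 1 := by gcongr
    _ = _ := by ring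

/-- The polynomial whose value at `I * z` is `1 + 2 (A ^ 2 + z ^ 2) ^ l / c ^ (2 * l)`. -/
def polyFactor (A : ℝ) (l : ℕ) (c : ℝ) : Polynomial ℂ :=
  1 + Polynomial.C ((2 / c ^ (2 * l) : ℝ) : ℂ) *
    (Polynomial.C ((A ^ 2 : ℝ) : ℂ) - Polynomial.X ^ 2) ^ l

/-- The polynomials used to divide symbols growing like powers of the exponential of `logProd`. -/
def polyProd (A : ℝ) (l : ℕ) (μ : ℕ → ℝ) (K : ℕ) : Polynomial ℂ :=
  (∏ j ∈ Finset.range K, polyFactor A l (μ j)) ^ 7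

theorem eval_polyFactor (A : ℝ) (l : ℕ) (c : ℝ) (z : ℂ) :
    (polyFactor A l c).eval (Complex.I * z) =
      1 + ((2 / c ^ (2 * l) : ℝ) : ℂ) * ((A ^ 2 : ℝ) + z ^ 2) ^ l := by
  have : (Complex.I * z) ^ 2 = -z ^ 2 := by rw [mul_pow, Complex.I_sq]; ring
  simp [polyFactor, this]

theorem exists_norm_eval_polyFactor_ge (l : ℕ) (n : ℝ) (hn : 0 ≤ n) :
    ∃ A : ℝ, 0 ≤ A ∧ ∀ c : ℝ, 0 < c → ∀ z : ℂ, |z.im| ≤ n →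
      1 + (z.re / c) ^ (2 * l) ≤ ‖(polyFactor A l c).eval (Complex.I * z)‖ := by
  obtain ⟨δ, hδ, h⟩ := exists_norm_one_add_pow_sub_one_le l
  set b := n / δ
  have hb : 0 ≤ b := by positivity
  refine ⟨n + b + 1, by positivity, fun c hc z hz => ?_⟩
  set A := n + b + 1
  set x := z.re
  set y := z.im
  have hy : y ^ 2 ≤ n ^ 2 := sq_le_sq' (by linarith [neg_le_of_abs_le hz]) (le_of_abs_le hz)
  have hA : n ^ 2 + b ^ 2 + 1 ≤ A ^ 2 := by
    have := mul_nonneg hn hb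
    simp only [A]
    nlinarith
  set r := A ^ 2 + x ^ 2 - y ^ 2
  have hr : x ^ 2 + b ^ 2 + 1 ≤ r := by simp only [r]; linarith
  have hr0 : 0 < r := by nlinarith [sq_nonneg x, sq_nonneg b]
  have e1 : ((A ^ 2 : ℝ) + z ^ 2 : ℂ) = (r : ℂ) * (1 + (2 * x * y / r : ℝ) * Complex.I) := by
    have hrc : (r : ℂ) ≠ 0 := by exact_mod_cast hr0.ne'
    have e2 : z ^ 2 = (x ^ 2 - y ^ 2 : ℝ) + (2 * x * y : ℝ) * Complex.I := by
      conv_lhs => rw [← Complex.re_add_im z]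
      push_cast
      ring_nf
      rw [Complex.I_sq]
      ring
    rw [e2, Complex.ofReal_div]
    field_simp
    simp only [r]
    push_cast
    ring
  have hζ : ‖((2 * x * y / r : ℝ) : ℂ) * Complex.I‖ ≤ δ := by
    rw [norm_mul, Complex.norm_I, mul_one, Complex.norm_real, Real.norm_eq_abs, abs_div,
      abs_of_pos hr0, div_le_iff₀ hr0, abs_mul, abs_mul, abs_two]
    have h1 : n = b * δ := by simp only [b]; field_simp
    calc 2 * |x| * |y| ≤ 2 * |x| * n := by gcongr
      _ = δ * (2 * |x| * b) := by rw [h1]; ring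
      _ ≤ δ * r := by
        gcongr
        nlinarith [sq_nonneg (|x| - b), sq_abs x]
  have h2 := re_mul_ge (pow_nonneg hr0.le l) (h _ hζ)
  rw [eval_polyFactor, e1, mul_pow]
  refine le_trans ?_ (Complex.re_le_norm _)
  rw [Complex.add_re, Complex.one_re, Complex.re_ofReal_mul]
  have h3 : x ^ (2 * l) ≤ r ^ l := by
    rw [pow_mul]
    gcongr
    nlinarith [sq_nonneg b]
  have hcp : 0 < c ^ (2 * l) := by positivity
  rw [div_pow]
  push_cast at h2 ⊢
  calc _ ≤ 1 + 2 / c ^ (2 * l) * (r ^ l / 2) := by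
        gcongr
        rw [div_mul_div_comm, mul_comm (c ^ (2 * l)) 2, mul_div_mul_left _ _ two_ne_zero]
        gcongr
    _ ≤ _ := by gcongr

theorem norm_eval_polyProd_ge {l : ℕ} {n A : ℝ}
    (hA : ∀ c : ℝ, 0 < c → ∀ z : ℂ, |z.im| ≤ n →
      1 + (z.re / c) ^ (2 * l) ≤ ‖(polyFactor A l c).eval (Complex.I * z)‖)
    {μ : ℕ → ℝ} (hμ : ∀ j, 0 < μ j) (K : ℕ) {z : ℂ} (hz : |z.im| ≤ n) :
    (∏ j ∈ Finset.range K, (1 + (z.re / μ j) ^ (2 * l))) ^ 7 ≤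
      ‖(polyProd A l μ K).eval (Complex.I * z)‖ := by
  have h0 : ∀ j, 0 ≤ 1 + (z.re / μ j) ^ (2 * l) := fun j => by
    have := (even_two_mul l).pow_nonneg (z.re / μ j)
    linarith
  rw [polyProd, Polynomial.eval_pow, norm_pow, Polynomial.eval_prod, norm_prod]
  refine pow_le_pow_left₀ (Finset.prod_nonneg fun j _ => h0 j) ?_ _
  exact Finset.prod_le_prod (fun j _ => h0 j) fun j _ => hA _ (hμ j) _ hz

/-- The coefficients of `p` are bounded by those of `q`. -/
def Majorized (p : Polynomial ℂ) (q : Polynomial ℝ) : Prop := ∀ k, ‖p.coeff k‖ ≤ q.coeff k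

namespace Majorized

variable {p p' : Polynomial ℂ} {q q' : Polynomial ℝ}

theorem coeff_nonneg (h : Majorized p q) (k : ℕ) : 0 ≤ q.coeff k := (norm_nonneg _).trans (h k)

theorem mul (h : Majorized p q) (h' : Majorized p' q') : Majorized (p * p') (q * q') := by
  intro k
  rw [Polynomial.coeff_mul, Polynomial.coeff_mul]
  refine (norm_sum_le _ _).trans (Finset.sum_le_sum fun i _ => ?_)
  rw [norm_mul]
  exact mul_le_mul (h _) (h' _) (norm_nonneg _) (h.coeff_nonneg _)

theorem add (h : Majorized p q) (h' : Majorized p' q') : Majorized (p + p') (q + q') := by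
  intro k
  rw [Polynomial.coeff_add, Polynomial.coeff_add]
  exact (norm_add_le _ _).trans (add_le_add (h k) (h' k))

theorem sub (h : Majorized p q) (h' : Majorized p' q') : Majorized (p - p') (q + q') := by
  intro k
  rw [Polynomial.coeff_add, Polynomial.coeff_sub]
  exact (norm_sub_le _ _).trans (add_le_add (h k) (h' k))

theorem one : Majorized 1 1 := by
  intro k
  rw [Polynomial.coeff_one, Polynomial.coeff_one]
  split_ifs <;> simp

theorem X : Majorized Polynomial.X Polynomial.X := by
  intro k
  rw [Polynomial.coeff_X, Polynomial.coeff_X]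
  split_ifs <;> simp

theorem C {a : ℝ} (ha : 0 ≤ a) : Majorized (Polynomial.C (a : ℂ)) (Polynomial.C a) := by
  intro k
  rw [Polynomial.coeff_C, Polynomial.coeff_C]
  split_ifs <;> simp [abs_of_nonneg ha]

theorem pow (h : Majorized p q) (k : ℕ) : Majorized (p ^ k) (q ^ k) := by
  induction k with
  | zero => simpa using one
  | succ k ih => rw [pow_succ, pow_succ]; exact ih.mul h

theorem prod {P : ℕ → Polynomial ℂ} {Q : ℕ → Polynomial ℝ} (h : ∀ j, Majorized (P j) (Q j))
    (K : ℕ) : Majorized (∏ j ∈ Finset.range K, P j) (∏ j ∈ Finset.range K, Q j) := by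
  induction K with
  | zero => simpa using one
  | succ k ih => rw [Finset.prod_range_succ, Finset.prod_range_succ]; exact ih.mul (h k)

theorem norm_coeff_mul_pow_le (h : Majorized p q) {s : ℝ} (hs : 0 ≤ s) (k : ℕ) :
    ‖p.coeff k‖ * s ^ k ≤ q.eval s := by
  have h1 : q.coeff k * s ^ k ≤ q.eval s := by
    rw [Polynomial.eval_eq_sum_range]
    by_cases hk : k ∈ Finset.range (q.natDegree + 1)
    · exact Finset.single_le_sum (f := fun i => q.coeff i * s ^ i)
        (fun i _ => mul_nonneg (h.coeff_nonneg i) (by positivity)) hk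
    · rw [Polynomial.coeff_eq_zero_of_natDegree_lt (by simpa using hk), zero_mul]
      exact Finset.sum_nonneg fun i _ => mul_nonneg (h.coeff_nonneg i) (by positivity)
  exact (mul_le_mul_of_nonneg_right (h k) (by positivity)).trans h1

end Majorized

theorem ProdSeq.norm_coeff_polyProd_le {l : ℕ} {μ : ℕ → ℝ} (h : ProdSeq l μ) {A : ℝ} (hA : 0 ≤ A)
    (K k : ℕ) {s : ℝ} (hs : 0 ≤ s) :
    ‖(polyProd A l μ K).coeff k‖ * s ^ k ≤ Real.exp (7 * logProd l μ (2 * (A + s))) := by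
  have h1 : ∀ j, Majorized (polyFactor A l (μ j)) (1 + Polynomial.C (2 / μ j ^ (2 * l)) *
      (Polynomial.C (A ^ 2) + Polynomial.X ^ 2) ^ l) := fun j => by
    have hj := h.pos j
    exact Majorized.one.add ((Majorized.C (by positivity)).mul
      (((Majorized.C (by positivity)).sub (Majorized.X.pow 2)).pow l))
  refine (((Majorized.prod h1 K).pow 7).norm_coeff_mul_pow_le hs k).trans ?_
  rw [Polynomial.eval_pow, Polynomial.eval_prod]
  have h2 : ∀ j, 0 ≤ (1 + Polynomial.C (2 / μ j ^ (2 * l)) *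
      (Polynomial.C (A ^ 2) + Polynomial.X ^ 2) ^ l).eval s := fun j => by
    have hj := h.pos j
    simp only [Polynomial.eval_add, Polynomial.eval_one, Polynomial.eval_mul, Polynomial.eval_C,
      Polynomial.eval_pow, Polynomial.eval_X]
    positivity
  have h3 : ∀ j, (1 + Polynomial.C (2 / μ j ^ (2 * l)) *
      (Polynomial.C (A ^ 2) + Polynomial.X ^ 2) ^ l).eval s ≤
        1 + (2 * (A + s) / μ j) ^ (2 * l) := fun j => by
    have hj := h.pos j
    simp only [Polynomial.eval_add, Polynomial.eval_one, Polynomial.eval_mul, Polynomial.eval_C,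
      Polynomial.eval_pow, Polynomial.eval_X]
    rw [div_pow, mul_pow, div_mul_eq_mul_div]
    have h4 : (A ^ 2 + s ^ 2) ^ l ≤ (A + s) ^ (2 * l) := by
      rw [pow_mul]
      gcongr
      nlinarith [mul_nonneg hA hs]
    have h5 : (2 : ℝ) ≤ 2 ^ (2 * l) :=
      le_self_pow₀ (by norm_num) (by have := h.l_pos; omega)
    gcongr
  calc _ ≤ (∏ j ∈ Finset.range K, (1 + (2 * (A + s) / μ j) ^ (2 * l))) ^ 7 :=
        pow_le_pow_left₀ (Finset.prod_nonneg fun j _ => h2 j)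
          (Finset.prod_le_prod (fun j _ => h2 j) fun j _ => h3 j) _
    _ ≤ (Real.exp (logProd l μ (2 * (A + s)))) ^ 7 := by
        refine pow_le_pow_left₀ (Finset.prod_nonneg fun j _ => (h2 j).trans (h3 j)) ?_ _
        exact h.prod_le_exp_logProd _ _
    _ = _ := by rw [← Real.exp_nat_mul]; norm_num

/-- Integration by parts against a division of the symbol by the polynomials `polyProd`. -/
theorem ProdSeq.norm_integral_invFT_mul_le {l : ℕ} {μ : ℕ → ℝ} (h : ProdSeq l μ) {κ A : ℝ}
    (hκ : 0 ≤ κ)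
    (hA : ∀ c : ℝ, 0 < c → ∀ z : ℂ, |z.im| ≤ κ + 1 →
      1 + (z.re / c) ^ (2 * l) ≤ ‖(polyFactor A l c).eval (Complex.I * z)‖)
    {u : ℂ → ℂ} (hu : StripRapid (κ + 1) u) {f : ℝ → ℂ} (hf : ContDiff ℝ (⊤ : ℕ∞) f)
    {B : ℝ} (hB : 0 ≤ B) {a : ℕ → ℝ}
    (hb : ∀ k t, ‖iteratedDeriv k f t‖ ≤ B * a k * Real.exp (κ * |t|))
    (ha : ∀ K, ∑ k ∈ Finset.range ((polyProd A l μ K).natDegree + 1),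
      ‖(polyProd A l μ K).coeff k‖ * a k ≤ 1) :
    ‖∫ t, invFT u t * f (-t)‖ ≤
      2 * B * ((∫ x : ℝ, ‖u (x + (κ + 1 : ℝ) * Complex.I)‖ * Real.exp (-(7 * logProd l μ x))) +
        ∫ x : ℝ, ‖u (x - (κ + 1 : ℝ) * Complex.I)‖ * Real.exp (-(7 * logProd l μ x))) := by
  have hE1 : ∀ (K : ℕ) (x : ℝ), 1 ≤ (∏ j ∈ Finset.range K, (1 + (x / μ j) ^ (2 * l))) ^ 7 := by
    intro K x
    refine one_le_pow₀ (Finset.prod_induction _ (fun y : ℝ => 1 ≤ y)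
      (fun _ _ => one_le_mul_of_one_le_of_one_le) le_rfl fun j _ => ?_)
    have := (even_two_mul l).pow_nonneg (x / μ j)
    linarith
  have hR1 : ∀ (K : ℕ) (z : ℂ), |z.im| ≤ κ + 1 →
      1 ≤ ‖(polyProd A l μ K).eval (Complex.I * z)‖ :=
    fun K z hz => (hE1 K z.re).trans (norm_eval_polyProd_ge hA h.pos K hz)
  set v : ℕ → ℂ → ℂ := fun K z => u z / (polyProd A l μ K).eval (Complex.I * z) with hvdef
  have hv : ∀ K, StripRapid (κ + 1) (v K) := by
    refine fun K => ⟨fun z hz => (hu.diff z hz).div ?_ ?_, fun p => ?_⟩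
    · exact ((polyProd A l μ K).differentiable _).comp z
        (differentiableAt_id.const_mul Complex.I)
    · exact norm_pos_iff.1 (one_pos.trans_le (hR1 K z hz))
    · obtain ⟨C, hC⟩ := hu.decay p
      refine ⟨C, fun z hz => le_trans ?_ (hC z hz)⟩
      gcongr
      rw [hvdef, norm_div]
      exact div_le_self (norm_nonneg _) (hR1 K z hz)
  have huv : ∀ K (t : ℝ), invFT (fun z => (polyProd A l μ K).eval (Complex.I * z) * v K z) t =
      invFT u t := by
    intro K t
    simp only [invFT]
    congr 2
    ext x
    have : (polyProd A l μ K).eval (Complex.I * x) ≠ 0 :=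
      norm_pos_iff.1 (one_pos.trans_le (hR1 K x (by simp; linarith)))
    simp only [hvdef]
    rw [mul_div_cancel₀ _ this]
  have hbound : ∀ K, ‖∫ t, invFT u t * f (-t)‖ ≤ 2 * B *
      ((∫ x : ℝ, ‖v K (x + (κ + 1 : ℝ) * Complex.I)‖) +
        ∫ x : ℝ, ‖v K (x - (κ + 1 : ℝ) * Complex.I)‖) := by
    intro K
    have := (hv K).norm_integral_eval_mul_le hκ (polyProd A l μ K) hf hB hb (ha K)
    simpa only [huv] using this
  have hlim : ∀ y : ℝ, |y| ≤ κ + 1 → ∃ I : ℕ → ℝ,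
      (∀ K, (∫ x : ℝ, ‖v K (x + y * Complex.I)‖) ≤ I K) ∧
      Tendsto I atTop (𝓝 (∫ x : ℝ, ‖u (x + y * Complex.I)‖ *
        Real.exp (-(7 * logProd l μ x)))) := by
    intro y hy
    have hui := hu.integrable_line hy
    set E : ℕ → ℝ → ℝ := fun K x => (∏ j ∈ Finset.range K, (1 + (x / μ j) ^ (2 * l))) ^ 7
    have hEc : ∀ K, Continuous (E K) := fun K => by simp only [E]; fun_prop
    have hEpos : ∀ K x, 0 < E K x := fun K x => one_pos.trans_le (hE1 K x)
    have hle : ∀ K (x : ℝ), ‖u (x + y * Complex.I)‖ * (E K x)⁻¹ ≤ ‖u (x + y * Complex.I)‖ :=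
      fun K x => mul_le_of_le_one_right (norm_nonneg _) (inv_le_one_of_one_le₀ (hE1 K x))
    have hmeas : ∀ K, AEStronglyMeasurable
        (fun x : ℝ => ‖u (x + y * Complex.I)‖ * (E K x)⁻¹) :=
      fun K => hui.norm.aestronglyMeasurable.mul
        ((hEc K).inv₀ fun x => (hEpos K x).ne').aestronglyMeasurable
    have hnn : ∀ K (x : ℝ), 0 ≤ ‖u (x + y * Complex.I)‖ * (E K x)⁻¹ := fun K x =>
      mul_nonneg (norm_nonneg _) (inv_nonneg.2 (hEpos K x).le)
    refine ⟨fun K => ∫ x : ℝ, ‖u (x + y * Complex.I)‖ * (E K x)⁻¹, fun K => ?_, ?_⟩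
    · refine integral_mono_of_nonneg (Eventually.of_forall fun x => norm_nonneg _) ?_
        (Eventually.of_forall fun x => ?_)
      · exact hui.norm.mono' (hmeas K) (Eventually.of_forall fun x => by
          rw [Real.norm_of_nonneg (hnn K x)]
          exact hle K x)
      · simp only [hvdef]
        rw [norm_div, div_eq_mul_inv]
        gcongr
        · exact hEpos K x
        · simpa using norm_eval_polyProd_ge hA h.pos K (z := x + y * Complex.I) (by simpa using hy)
    · refine tendsto_integral_of_dominated_convergence (fun x => ‖u (x + y * Complex.I)‖)
        hmeas hui.norm (fun K => Eventually.of_forall fun x => ?_)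
        (Eventually.of_forall fun x => ?_)
      · rw [Real.norm_of_nonneg (hnn K x)]
        exact hle K x
      · refine Tendsto.const_mul _ ?_
        have h1 := ((h.tendsto_prod x).pow 7).inv₀ (by positivity)
        rw [← Real.exp_nat_mul, ← Real.exp_neg] at h1
        exact_mod_cast h1
  have habs : |κ + 1| ≤ κ + 1 := (abs_of_nonneg (by linarith)).le
  obtain ⟨I1, hI1, hT1⟩ := hlim (κ + 1) habs
  obtain ⟨I2, hI2, hT2⟩ := hlim (-(κ + 1)) (by rwa [abs_neg])
  have e2 : ∀ w : ℂ → ℂ, ∀ x : ℝ, w (x + (-(κ + 1) : ℝ) * Complex.I) =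
      w (x - (κ + 1 : ℝ) * Complex.I) := by
    intro w x
    congr 1
    push_cast
    ring
  simp only [e2] at hI2 hT2
  refine ge_of_tendsto' ((hT1.add hT2).const_mul (2 * B)) fun K => (hbound K).trans ?_
  have := hI1 K
  have := hI2 K
  gcongr

/-- Sequences for which the coefficients of `polyProd` are controlled by the products
`∏ j < k, (μ j)⁻¹`. -/
structure GrowthSeq (l : ℕ) (μ : ℕ → ℝ) (C₁ C₂ : ℝ) : Prop extends ProdSeq l μ where
  logProd_le : ∀ k : ℕ, logProd l μ (μ k) ≤ C₁ * (k + 1)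
  le_mul : ∀ j k, j ≤ k → μ j ≤ C₂ * μ k

/-- The geometric rate lost in the coefficient bounds for `polyProd`. -/
def lossRate (l : ℕ) (C₁ C₂ : ℝ) : ℝ := C₂ * Real.exp (7 * 4 ^ (2 * l) * C₁)

/-- The convolution factor on the line. -/
def factorKernel (l : ℕ) (μ : ℕ → ℝ) : ℝ → ℂ := invFT (symInv (logProd l μ))

/-- The mollified kernels of the inverse convolution operator on the line. -/
def inverseKernel (l : ℕ) (μ : ℕ → ℝ) (m : ℕ) : ℝ → ℂ :=
  invFT (symP (2 * l + 1) (logProd l μ) m)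

theorem StripRapid.invFT_sub {n : ℝ} {u v : ℂ → ℂ} (hu : StripRapid n u) (hv : StripRapid n v)
    (hn : 0 ≤ n) (t : ℝ) : invFT (fun z => u z - v z) t = invFT u t - invFT v t := by
  have hi : ∀ {w : ℂ → ℂ}, StripRapid n w →
      Integrable fun x : ℝ => w x * Complex.exp (x * t * Complex.I) := by
    intro w hw
    have hi := hw.integrable_real hn
    refine hi.norm.mono' (hi.aestronglyMeasurable.mul (by fun_prop))
      (Eventually.of_forall fun x => ?_)
    rw [norm_mul, Complex.norm_exp]
    simp
  simp only [invFT, sub_mul]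
  rw [integral_sub (hi hu) (hi hv), mul_sub]

theorem SlowGrowth.integrable_exp_neg {e : ℕ} {N : ℝ → ℝ} (h : SlowGrowth e N) :
    Integrable fun x => Real.exp (-N x) := by
  obtain ⟨C, hC0, hC⟩ := h.rapid 2
  refine (integrable_inv_one_add_sq.const_mul C).mono'
    (Real.measurable_exp.comp h.meas.neg).aestronglyMeasurable (Eventually.of_forall fun x => ?_)
  have h1 : (1 + x ^ 2) ≤ (1 + |x|) ^ 2 := by nlinarith [abs_nonneg x, sq_abs x]
  have h2 : 0 < 1 + x ^ 2 := by positivity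
  rw [Real.norm_of_nonneg (Real.exp_pos _).le, ← div_eq_mul_inv, le_div_iff₀ h2, Real.exp_neg,
    inv_mul_le_iff₀ (Real.exp_pos _), mul_comm]
  exact h1.trans (hC x)

namespace GrowthSeq

variable {l : ℕ} {μ : ℕ → ℝ} {C₁ C₂ : ℝ}

theorem C₂_ge (h : GrowthSeq l μ C₁ C₂) : 1 ≤ C₂ := by
  have := h.le_mul 0 0 le_rfl
  have h0 := h.pos 0
  by_contra hc
  nlinarith

theorem C₁_nonneg (h : GrowthSeq l μ C₁ C₂) : 0 ≤ C₁ := by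
  have := (ProdSeq.logProd_nonneg _).trans (h.logProd_le 0)
  simpa using this

theorem one_le_lossRate (h : GrowthSeq l μ C₁ C₂) : 1 ≤ lossRate l C₁ C₂ := by
  have h1 := h.C₂_ge
  have h2 : 1 ≤ Real.exp (7 * 4 ^ (2 * l) * C₁) :=
    Real.one_le_exp (by have := h.C₁_nonneg; positivity)
  exact one_le_mul_of_one_le_of_one_le h1 h2

theorem tendsto_atTop (h : GrowthSeq l μ C₁ C₂) (A : ℝ) : ∃ k₀, ∀ k ≥ k₀, A ≤ μ k := by
  have h1 := h.summable.tendsto_atTop_zero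
  have h2 : (0 : ℝ) < ((|A| + 1)⁻¹) ^ (2 * l) := by positivity
  obtain ⟨k₀, hk⟩ := eventually_atTop.1 (h1.eventually (gt_mem_nhds h2))
  refine ⟨k₀, fun k hk0 => ?_⟩
  have h3 := lt_of_pow_lt_pow_left₀ _ (by positivity) (hk k hk0)
  have h4 := (inv_lt_inv₀ (h.pos k) (by positivity)).1 h3
  linarith [le_abs_self A]

theorem exists_coeff_le (h : GrowthSeq l μ C₁ C₂) {A : ℝ} (hA : 0 ≤ A) :
    ∃ D, 0 ≤ D ∧ ∀ K k, ‖(polyProd A l μ K).coeff k‖ * ∏ j ∈ Finset.range k, μ j ≤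
      D * lossRate l C₁ C₂ ^ k := by
  obtain ⟨k₀, hk₀⟩ := h.tendsto_atTop A
  have hC₁ := h.C₁_nonneg
  have hC₂ := h.C₂_ge
  have hP : ∀ k, 0 ≤ ∏ j ∈ Finset.range k, μ j := fun k =>
    Finset.prod_nonneg fun j _ => (h.pos j).le
  set E := Real.exp (7 * 4 ^ (2 * l) * C₁) with hE
  set D₁ := Real.exp (7 * logProd l μ (2 * (A + 1)))
  set D₂ := ∑ i ∈ Finset.range k₀, ∏ j ∈ Finset.range i, μ j
  have hD₂ : 0 ≤ D₂ := Finset.sum_nonneg fun i _ => hP i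
  refine ⟨E + D₁ * D₂, by positivity, fun K k => ?_⟩
  rcases le_or_gt k₀ k with hk | hk
  · have hs := h.pos k
    have hAs := hk₀ k hk
    have h1 := h.toProdSeq.norm_coeff_polyProd_le hA K k hs.le
    have h2 : logProd l μ (2 * (A + μ k)) ≤ 4 ^ (2 * l) * (C₁ * (k + 1)) := by
      calc _ ≤ logProd l μ (4 * μ k) := h.logProd_mono (by
            rw [abs_of_nonneg (by linarith), abs_of_nonneg (by linarith)]; linarith)
        _ ≤ 4 ^ (2 * l) * logProd l μ (μ k) := h.logProd_mul_le (by norm_num) _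
        _ ≤ _ := by gcongr; exact h.logProd_le k
    have h3 : ∏ j ∈ Finset.range k, μ j ≤ (C₂ * μ k) ^ k := by
      have := Finset.prod_le_prod (s := Finset.range k) (f := μ) (g := fun _ => C₂ * μ k)
        (fun j _ => (h.pos j).le) fun j hj => h.le_mul j k (Finset.mem_range.1 hj).le
      simpa using this
    calc _ ≤ ‖(polyProd A l μ K).coeff k‖ * (C₂ * μ k) ^ k := by gcongr
      _ = (‖(polyProd A l μ K).coeff k‖ * μ k ^ k) * C₂ ^ k := by rw [mul_pow]; ring
      _ ≤ Real.exp (7 * logProd l μ (2 * (A + μ k))) * C₂ ^ k := by gcongr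
      _ ≤ Real.exp (7 * (4 ^ (2 * l) * (C₁ * (k + 1)))) * C₂ ^ k := by gcongr
      _ = E * lossRate l C₁ C₂ ^ k := by
        rw [lossRate, mul_pow, ← hE, mul_comm (C₂ ^ k), ← mul_assoc E, ← pow_succ', hE,
          ← Real.exp_nat_mul]
        congr 2
        push_cast
        ring
      _ ≤ _ := by
        have := h.one_le_lossRate
        gcongr
        have : 0 ≤ D₁ * D₂ := by positivity
        linarith
  · have h1 := h.toProdSeq.norm_coeff_polyProd_le hA K k zero_le_one
    rw [one_pow, mul_one] at h1
    have h2 : ∏ j ∈ Finset.range k, μ j ≤ D₂ :=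
      Finset.single_le_sum (f := fun i => ∏ j ∈ Finset.range i, μ j) (fun i _ => hP i)
        (Finset.mem_range.2 hk)
    calc _ ≤ D₁ * D₂ := mul_le_mul h1 h2 (hP k) (by positivity)
      _ ≤ (E + D₁ * D₂) * 1 := by
        have : 0 ≤ E := by positivity
        linarith
      _ ≤ _ := by
        gcongr
        exact one_le_pow₀ h.one_le_lossRate

/-- The inverse kernels act boundedly, and converge, on functions in a fixed ultradifferentiable
class of exponential growth. -/
theorem exists_inverseKernel_bound (h : GrowthSeq l μ C₁ C₂) {κ : ℝ} (hκ : 0 ≤ κ) :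
    ∃ C, 0 ≤ C ∧ ∃ δ : ℕ → ℝ, Tendsto δ atTop (𝓝 0) ∧ ∀ f : ℝ → ℂ, ContDiff ℝ (⊤ : ℕ∞) f →
      ∀ B, 0 ≤ B → (∀ k t, ‖iteratedDeriv k f t‖ ≤
        B * ((∏ j ∈ Finset.range k, μ j) / (2 * lossRate l C₁ C₂) ^ k) * Real.exp (κ * |t|)) →
      (∀ m, ‖∫ t, inverseKernel l μ m t * f (-t)‖ ≤ C * B) ∧
      ∀ m m', ‖(∫ t, inverseKernel l μ m t * f (-t)) - ∫ t, inverseKernel l μ m' t * f (-t)‖ ≤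
        (δ m + δ m') * B := by
  have hn : 0 ≤ κ + 1 := by linarith
  have hs := h.slowGrowth
  obtain ⟨A, hA0, hA⟩ := exists_norm_eval_polyFactor_ge l (κ + 1) hn
  obtain ⟨D, hD0, hD⟩ := h.exists_coeff_le hA0
  obtain ⟨C₀, hC₀, hP⟩ := hs.exists_norm_symP_le (κ + 1)
  obtain ⟨C₃, hC₃, hQ⟩ := hs.exists_norm_cexp_gaussConv_le (κ + 1)
  have hL := h.one_le_lossRate
  set L := lossRate l C₁ C₂
  set N := logProd l μ
  set p : ℕ → ℂ → ℂ := symP (2 * l + 1) N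
  have hp : ∀ m, StripRapid (κ + 1) (p m) := hs.stripRapid_symP (κ + 1)
  set Q : ℂ → ℂ := fun z => Complex.exp (4 * gaussConv N z)
  have hQc : Continuous Q := Complex.continuous_exp.comp
    (continuous_const.mul hs.differentiable_gaussConv.continuous)
  have hP' : ∀ m, ∀ y : ℝ, |y| ≤ κ + 1 → ∀ x : ℝ,
      ‖p m (x + y * Complex.I)‖ ≤ C₀ * Real.exp (6 * N x) := by
    intro m y hy x
    have := hP m (x + y * Complex.I) (by simpa using hy)
    simp only [Complex.add_re, Complex.ofReal_re, Complex.mul_re, Complex.I_re, mul_zero,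
      Complex.ofReal_im, Complex.I_im, mul_one, sub_self, add_zero] at this
    refine this.trans (mul_le_of_le_one_right (by positivity) (Real.exp_le_one_iff.2 ?_))
    have := (even_two_mul (2 * l + 1)).pow_nonneg (x / ((m : ℝ) + 1))
    linarith
  have hQ' : ∀ y : ℝ, |y| ≤ κ + 1 → ∀ x : ℝ,
      ‖Q (x + y * Complex.I)‖ ≤ C₃ * Real.exp (6 * N x) := by
    intro y hy x
    simpa using hQ (x + y * Complex.I) (by simpa using hy)
  have hint := hs.integrable_exp_neg
  have hNm : Measurable N := hs.meas
  have hexp : ∀ c x, c * Real.exp (6 * N x) * Real.exp (-(7 * N x)) = c * Real.exp (-N x) := by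
    intro c x
    rw [mul_assoc, ← Real.exp_add]
    congr 2
    ring
  have hem : Measurable fun x => Real.exp (-(7 * N x)) :=
    Real.measurable_exp.comp (hNm.const_mul 7).neg
  -- differences with the limit symbol
  set G : ℝ → ℕ → ℝ := fun y m =>
    ∫ x : ℝ, ‖p m (x + y * Complex.I) - Q (x + y * Complex.I)‖ * Real.exp (-(7 * N x))
  have hline : ∀ m, ∀ y : ℝ, |y| ≤ κ + 1 → Continuous fun x : ℝ => p m (x + y * Complex.I) :=
    fun m y hy => (hp m).continuous_line hy
  have hQline : ∀ y : ℝ, Continuous fun x : ℝ => Q (x + y * Complex.I) :=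
    fun y => hQc.comp (by fun_prop)
  have hdmeas : ∀ m, ∀ y : ℝ, |y| ≤ κ + 1 → AEStronglyMeasurable fun x : ℝ =>
      ‖p m (x + y * Complex.I) - Q (x + y * Complex.I)‖ * Real.exp (-(7 * N x)) :=
    fun m y hy => ((((hline m y hy).sub (hQline y)).norm.measurable).mul hem).aestronglyMeasurable
  have hdbound : ∀ m, ∀ y : ℝ, |y| ≤ κ + 1 → ∀ x : ℝ,
      ‖‖p m (x + y * Complex.I) - Q (x + y * Complex.I)‖ * Real.exp (-(7 * N x))‖ ≤
        (C₀ + C₃) * Real.exp (-N x) := by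
    intro m y hy x
    rw [Real.norm_of_nonneg (by positivity), ← hexp]
    gcongr
    refine (norm_sub_le _ _).trans ?_
    rw [add_mul]
    exact add_le_add (hP' m y hy x) (hQ' y hy x)
  have hdint : ∀ m, ∀ y : ℝ, |y| ≤ κ + 1 → Integrable fun x : ℝ =>
      ‖p m (x + y * Complex.I) - Q (x + y * Complex.I)‖ * Real.exp (-(7 * N x)) :=
    fun m y hy => (hint.const_mul (C₀ + C₃)).mono' (hdmeas m y hy)
      (Eventually.of_forall (hdbound m y hy))
  have hG : ∀ y : ℝ, |y| ≤ κ + 1 → Tendsto (G y) atTop (𝓝 0) := by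
    intro y hy
    have := tendsto_integral_of_dominated_convergence (fun x => (C₀ + C₃) * Real.exp (-N x))
      (fun m => hdmeas m y hy) (hint.const_mul _)
      (fun m => Eventually.of_forall (hdbound m y hy)) (f := fun _ => (0 : ℝ))
      (Eventually.of_forall fun x => by
        have h1 := (hs.tendsto_symP (x + y * Complex.I)).sub_const (Q (x + y * Complex.I))
        rw [sub_self] at h1
        simpa using h1.norm.mul_const (Real.exp (-(7 * N x))))
    simpa using this
  have habs : |κ + 1| ≤ κ + 1 := (abs_of_nonneg hn).le
  have habs' : |-(κ + 1)| ≤ κ + 1 := by rwa [abs_neg]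
  have e2 : ∀ w : ℂ → ℂ, ∀ x : ℝ, w (x - (κ + 1 : ℝ) * Complex.I) =
      w (x + (-(κ + 1) : ℝ) * Complex.I) := by
    intro w x
    congr 1
    push_cast
    ring
  set T := ∫ x, Real.exp (-N x)
  have hT : 0 ≤ T := integral_nonneg fun x => (Real.exp_pos _).le
  -- the coefficient sums
  set a : ℕ → ℝ := fun k => (∏ j ∈ Finset.range k, μ j) / (2 * L) ^ k / (2 * (D + 1))
  have ha : ∀ K, ∑ k ∈ Finset.range ((polyProd A l μ K).natDegree + 1),
      ‖(polyProd A l μ K).coeff k‖ * a k ≤ 1 := by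
    intro K
    calc _ ≤ ∑ k ∈ Finset.range ((polyProd A l μ K).natDegree + 1), (1 / 2) * (1 / 2 : ℝ) ^ k := by
          refine Finset.sum_le_sum fun k _ => ?_
          have h1 := hD K k
          simp only [a]
          rw [div_div, ← mul_div_assoc, div_le_iff₀ (by positivity), mul_pow, one_div, inv_pow]
          have h2 : (2 : ℝ)⁻¹ * (2 ^ k)⁻¹ * (2 ^ k * L ^ k * (2 * (D + 1))) = (D + 1) * L ^ k := by
            field_simp
          rw [h2]
          refine h1.trans ?_
          gcongr
          linarith
      _ ≤ (1 / 2) * 2 := by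
          rw [← Finset.mul_sum]
          gcongr
          exact (summable_geometric_two.sum_le_tsum _ fun _ _ => by positivity).trans
            tsum_geometric_two.le
      _ = 1 := by norm_num
  have main : ∀ u : ℂ → ℂ, StripRapid (κ + 1) u → ∀ f : ℝ → ℂ, ContDiff ℝ (⊤ : ℕ∞) f →
      ∀ B, 0 ≤ B → (∀ k t, ‖iteratedDeriv k f t‖ ≤
        B * ((∏ j ∈ Finset.range k, μ j) / (2 * L) ^ k) * Real.exp (κ * |t|)) →
      ‖∫ t, invFT u t * f (-t)‖ ≤ 2 * (B * (2 * (D + 1))) *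
        ((∫ x : ℝ, ‖u (x + (κ + 1 : ℝ) * Complex.I)‖ * Real.exp (-(7 * N x))) +
        ∫ x : ℝ, ‖u (x + (-(κ + 1) : ℝ) * Complex.I)‖ * Real.exp (-(7 * N x))) := by
    intro u hu f hf B hB hb
    have := h.toProdSeq.norm_integral_invFT_mul_le hκ hA hu hf (B := B * (2 * (D + 1)))
      (by positivity) (a := a) (fun k t => by
        refine (hb k t).trans (le_of_eq ?_)
        simp only [a]
        field_simp) ha
    simpa only [e2 u] using this
  refine ⟨4 * (D + 1) * (C₀ * T + C₀ * T), by positivity,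
    fun m => 4 * (D + 1) * (G (κ + 1) m + G (-(κ + 1)) m), ?_, fun f hf B hB hb => ⟨?_, ?_⟩⟩
  · simpa using ((hG _ habs).add (hG _ habs')).const_mul (4 * (D + 1))
  · intro m
    have hI : ∀ y : ℝ, |y| ≤ κ + 1 →
        ∫ x : ℝ, ‖p m (x + y * Complex.I)‖ * Real.exp (-(7 * N x)) ≤ C₀ * T := by
      intro y hy
      rw [← integral_const_mul]
      refine integral_mono_of_nonneg (Eventually.of_forall fun x => by positivity)
        (hint.const_mul _) (Eventually.of_forall fun x => ?_)
      simp only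
      rw [← hexp]
      gcongr
      exact hP' m y hy x
    refine (main (p m) (hp m) f hf B hB hb).trans ?_
    calc _ ≤ 2 * (B * (2 * (D + 1))) * (C₀ * T + C₀ * T) := by
          gcongr
          · exact hI _ habs
          · exact hI _ habs'
      _ = _ := by ring
  · intro m m'
    have hu : StripRapid (κ + 1) fun z => p m z - p m' z := (hp m).sub (hp m')
    have hI : ∀ y : ℝ, |y| ≤ κ + 1 →
        ∫ x : ℝ, ‖p m (x + y * Complex.I) - p m' (x + y * Complex.I)‖ * Real.exp (-(7 * N x)) ≤
          G y m + G y m' := by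
      intro y hy
      rw [← integral_add (hdint m y hy) (hdint m' y hy)]
      refine integral_mono_of_nonneg (Eventually.of_forall fun x => by positivity)
        ((hdint m y hy).add (hdint m' y hy)) (Eventually.of_forall fun x => ?_)
      simp only
      rw [← add_mul]
      gcongr
      have h3 := norm_sub_le (p m (x + y * Complex.I) - Q (x + y * Complex.I))
        (p m' (x + y * Complex.I) - Q (x + y * Complex.I))
      rwa [sub_sub_sub_cancel_right] at h3
    have hfi : ∀ m, Integrable fun t => inverseKernel l μ m t * f (-t) := by
      intro m
      obtain ⟨E, -, hE⟩ := (hp m).exists_norm_invFT_le hn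
      refine integrable_mul_neg_of_exp_bound (n := κ + 1) (κ := κ)
        (D := B * ((∏ j ∈ Finset.range 0, μ j) / (2 * L) ^ 0))
        ((hp m).continuous_invFT hn) hf.continuous (by linarith) hE (fun t => ?_)
      simpa using hb 0 t
    have e3 : (∫ t, inverseKernel l μ m t * f (-t)) - ∫ t, inverseKernel l μ m' t * f (-t) =
        ∫ t, invFT (fun z => p m z - p m' z) t * f (-t) := by
      rw [← integral_sub (hfi m) (hfi m')]
      congr 1
      ext t
      rw [(hp m).invFT_sub (hp m') hn, sub_mul]
      rfl
    rw [e3]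
    refine (main _ hu f hf B hB hb).trans ?_
    calc _ ≤ 2 * (B * (2 * (D + 1))) *
          ((G (κ + 1) m + G (κ + 1) m') + (G (-(κ + 1)) m + G (-(κ + 1)) m')) := by
          gcongr
          · exact hI _ habs
          · exact hI _ habs'
      _ = _ := by ring

end GrowthSeq

/-- The convolution theorem for `invFT`. -/
theorem StripRapid.integral_invFT_mul_invFT {n : ℝ} {u v : ℂ → ℂ} (hu : StripRapid n u)
    (hv : StripRapid n v) (hn : 0 < n) (t : ℝ) :
    ∫ s, invFT u s * invFT v (t - s) = invFT (fun z => u z * v z) t := by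
  have hI := (hu.integrable_invFT hn).mul_prod (hv.integrable_real hn.le)
  have hF : Integrable (fun q : ℝ × ℝ => invFT u q.1 *
      (v q.2 * Complex.exp (q.2 * (t - q.1) * Complex.I))) (volume.prod volume) := by
    refine hI.norm.mono' ?_ (Eventually.of_forall fun q => ?_)
    · have h1 := hu.continuous_invFT hn.le
      have h2 := hv.continuous_real hn.le
      refine Continuous.aestronglyMeasurable ?_
      exact (h1.comp continuous_fst).mul ((h2.comp continuous_snd).mul (by fun_prop))
    · have : ‖Complex.exp (q.2 * (t - q.1) * Complex.I)‖ = 1 := by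
        rw [Complex.norm_exp]
        simp
      rw [norm_mul, norm_mul, this, mul_one, norm_mul]
  have e1 : ∀ s, invFT u s * invFT v (t - s) = ((2 * Real.pi)⁻¹ : ℝ) *
      ∫ x : ℝ, invFT u s * (v x * Complex.exp (x * (t - s) * Complex.I)) := by
    intro s
    rw [integral_const_mul, invFT, invFT]
    push_cast
    ring
  simp only [e1]
  rw [integral_const_mul, integral_integral_swap hF, invFT]
  congr 2
  ext x
  rw [← hu.integral_invFT_mul_exp hn x, mul_assoc, ← integral_mul_const]
  congr 1
  ext s
  have e2 : (x * (t - s) * Complex.I : ℂ) = -(x * s * Complex.I) + x * t * Complex.I := by ring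
  rw [e2, Complex.exp_add]
  ring

theorem invFT_comp_div (u : ℂ → ℂ) {c : ℝ} (hc : 0 < c) (t : ℝ) :
    invFT (fun z => u (z / c)) t = c * invFT u (c * t) := by
  have := Measure.integral_comp_div (fun x : ℝ => u x * Complex.exp (x * (c * t : ℝ) * Complex.I)) c
  rw [invFT, invFT, mul_left_comm]
  rw [abs_of_pos hc, Complex.real_smul] at this
  rw [← this]
  congr 2
  ext x
  have : (c : ℂ) ≠ 0 := by exact_mod_cast hc.ne'
  push_cast
  congr 2
  field_simp

namespace GrowthSeq

variable {l : ℕ} {μ : ℕ → ℝ} {C₁ C₂ : ℝ}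

theorem stripRapid_symInv (h : GrowthSeq l μ C₁ C₂) (n : ℝ) :
    StripRapid n (symInv (logProd l μ)) := h.slowGrowth.stripRapid_symInv n

theorem contDiff_factorKernel (h : GrowthSeq l μ C₁ C₂) :
    ContDiff ℝ (⊤ : ℕ∞) (factorKernel l μ) :=
  (h.stripRapid_symInv 0).contDiff_invFT le_rfl

theorem continuous_inverseKernel (h : GrowthSeq l μ C₁ C₂) (m : ℕ) :
    Continuous (inverseKernel l μ m) :=
  (h.slowGrowth.stripRapid_symP 0 m).continuous_invFT le_rfl

theorem exists_norm_inverseKernel_le (h : GrowthSeq l μ C₁ C₂) (m : ℕ) {n : ℝ} (hn : 0 ≤ n) :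
    ∃ C, 0 ≤ C ∧ ∀ t, ‖inverseKernel l μ m t‖ ≤ C * Real.exp (-n * |t|) :=
  (h.slowGrowth.stripRapid_symP n m).exists_norm_invFT_le hn

theorem exists_norm_iteratedDeriv_factorKernel_le (h : GrowthSeq l μ C₁ C₂) {n : ℝ}
    (hn : 0 ≤ n) : ∃ C, 0 ≤ C ∧ ∀ p : ℕ, ∀ S : ℝ,
      (∀ x, (|x| + n) ^ p ≤ S * Real.exp (logProd l μ x)) →
      ∀ t, ‖iteratedDeriv p (factorKernel l μ) t‖ ≤ C * S * Real.exp (-n * |t|) := by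
  obtain ⟨C, hC0, hC⟩ := h.slowGrowth.exists_norm_symInv_le n
  have hint := h.slowGrowth.integrable_exp_neg
  set T := ∫ x, Real.exp (-logProd l μ x)
  have hT : 0 ≤ T := integral_nonneg fun x => (Real.exp_pos _).le
  refine ⟨2 * C * T, by positivity, fun p S hS t => ?_⟩
  have hu := (h.stripRapid_symInv n).mul_pow hn p
  have key : ∀ y : ℝ, |y| ≤ n → ∫ x : ℝ, ‖(Complex.I * (x + y * Complex.I)) ^ p *
      symInv (logProd l μ) (x + y * Complex.I)‖ ≤ C * S * T := by
    intro y hy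
    rw [← integral_const_mul]
    refine integral_mono_of_nonneg (Eventually.of_forall fun x => norm_nonneg _)
      (hint.const_mul _) (Eventually.of_forall fun x => ?_)
    have h1 := hC (x + y * Complex.I) (by simpa using hy)
    have h2 : ‖(x + y * Complex.I : ℂ)‖ ≤ |x| + n := by
      refine (norm_add_le _ _).trans ?_
      simpa using hy
    simp only [norm_mul, norm_pow, Complex.norm_I, one_mul]
    simp only [Complex.add_re, Complex.ofReal_re, Complex.mul_re, Complex.I_re, mul_zero,
      Complex.ofReal_im, Complex.I_im, mul_one, sub_self, add_zero] at h1
    have h3 : ‖(x + y * Complex.I : ℂ)‖ ^ p ≤ S * Real.exp (logProd l μ x) :=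
      (pow_le_pow_left₀ (norm_nonneg _) h2 p).trans (hS x)
    calc _ ≤ (S * Real.exp (logProd l μ x)) * (C * Real.exp (-(2 * logProd l μ x))) :=
          mul_le_mul h3 h1 (norm_nonneg _) ((by positivity : (0 : ℝ) ≤ _).trans h3)
      _ = C * S * (Real.exp (logProd l μ x) * Real.exp (-(2 * logProd l μ x))) := by ring
      _ = _ := by
        rw [← Real.exp_add]
        congr 2
        ring
  have h4 := hu.norm_invFT_le hn t
  rw [factorKernel, (h.stripRapid_symInv n).iteratedDeriv_invFT hn]
  refine h4.trans ?_
  gcongr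
  have e2 : ∀ x : ℝ, (x - (n : ℝ) * Complex.I : ℂ) = x + (-n : ℝ) * Complex.I := by
    intro x
    push_cast
    ring
  simp only [e2]
  have := key n (abs_of_nonneg hn).le
  have := key (-n) (by rw [abs_neg, abs_of_nonneg hn])
  linarith

/-- The inverse kernels undo the convolution with the factor in the limit. -/
theorem tendsto_factorKernel_inverseKernel (h : GrowthSeq l μ C₁ C₂) {κ : ℝ} (hκ : 0 ≤ κ)
    {f : ℝ → ℂ} (hf : Continuous f) {D : ℝ} (hD : ∀ t, ‖f t‖ ≤ D * Real.exp (κ * |t|)) :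
    Tendsto (fun m => ∫ s, factorKernel l μ s * ∫ t, inverseKernel l μ m t * f (-s - t)) atTop
      (𝓝 (f 0)) := by
  set e := 2 * l + 1
  have he : 0 < e := by positivity
  set N := logProd l μ
  set n := 2 * (κ + 1) with hn_def
  have hn : 0 < n := by positivity
  have hu := h.stripRapid_symInv n
  have hv := h.slowGrowth.stripRapid_symP n
  have hD0 : 0 ≤ D := by
    have := (norm_nonneg _).trans (hD 0)
    simpa using this
  obtain ⟨Cu, hCu0, hCu⟩ := hu.exists_norm_invFT_le hn.le
  set Θ := invFT (symMol e)
  have hΘ := stripRapid_symMol he (κ + 1)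
  obtain ⟨Ct, hCt0, hCt⟩ := hΘ.exists_norm_invFT_le (by linarith)
  have step : ∀ m, ∫ s, factorKernel l μ s * ∫ t, inverseKernel l μ m t * f (-s - t) =
      ∫ t, Θ t * f (-(t / (m + 1))) := by
    intro m
    obtain ⟨Cv, hCv0, hCv⟩ := (hv m).exists_norm_invFT_le hn.le
    have e1 : ∀ s, ∫ t, inverseKernel l μ m t * f (-s - t) =
        ∫ t, inverseKernel l μ m (t - s) * f (-t) := by
      intro s
      rw [← integral_sub_right_eq_self _ s]
      congr 1
      ext t
      congr 2
      ring
    have hF : Integrable (fun q : ℝ × ℝ => factorKernel l μ q.1 *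
        (inverseKernel l μ m (q.2 - q.1) * f (-q.2))) (volume.prod volume) := by
      have h1 := integrable_exp_neg_mul_abs (c := 1) one_pos
      refine ((h1.mul_prod h1).const_mul (Cu * Cv * D)).mono' ?_ (Eventually.of_forall fun q => ?_)
      · refine Continuous.aestronglyMeasurable ?_
        have h2 := h.contDiff_factorKernel.continuous
        have h3 := h.continuous_inverseKernel m
        exact (h2.comp continuous_fst).mul ((h3.comp (by fun_prop)).mul (hf.comp (by fun_prop)))
      · obtain ⟨s, t⟩ := q
        have h2 := hD (-t)
        rw [abs_neg] at h2
        have h3 : |t| ≤ |t - s| + |s| := by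
          have := abs_add_le (t - s) s
          simpa using this
        rw [norm_mul, norm_mul]
        calc _ ≤ (Cu * Real.exp (-n * |s|)) * ((Cv * Real.exp (-n * |t - s|)) *
              (D * Real.exp (κ * |t|))) := by
              gcongr
              · exact hCu s
              · exact hCv _
          _ = Cu * Cv * D * Real.exp (-n * |s| + -n * |t - s| + κ * |t|) := by
              rw [Real.exp_add, Real.exp_add]
              ring
          _ ≤ Cu * Cv * D * Real.exp (-1 * |s| + -1 * |t|) := by
              refine mul_le_mul_of_nonneg_left (Real.exp_le_exp.2 ?_) (by positivity)
              rw [hn_def]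
              nlinarith [abs_nonneg s, abs_nonneg (t - s)]
          _ = _ := by rw [Real.exp_add]
    simp only [e1, ← integral_const_mul]
    rw [integral_integral_swap hF]
    have e2 : ∀ t, ∫ s, factorKernel l μ s * (inverseKernel l μ m (t - s) * f (-t)) =
        ((m + 1 : ℝ) : ℂ) * Θ ((m + 1 : ℝ) * t) * f (-t) := by
      intro t
      simp only [← mul_assoc]
      rw [integral_mul_const, factorKernel, inverseKernel, hu.integral_invFT_mul_invFT (hv m) hn,
        ← invFT_comp_div _ (by positivity)]
      congr 2
      ext z
      rw [symInv_mul_symP]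
      push_cast
      rfl
    simp only [e2]
    have h5 := Measure.integral_comp_div
      (fun t => ((m + 1 : ℝ) : ℂ) * Θ ((m + 1 : ℝ) * t) * f (-t)) (m + 1 : ℝ)
    have hm : (0 : ℝ) < m + 1 := by positivity
    rw [abs_of_pos hm, Complex.real_smul] at h5
    have hm' : ((m + 1 : ℝ) : ℂ) ≠ 0 := by exact_mod_cast hm.ne'
    refine mul_left_cancel₀ hm' (h5.symm.trans ?_)
    rw [← integral_const_mul]
    congr 1
    ext t
    rw [mul_div_cancel₀ _ hm.ne', mul_assoc]
  simp only [step]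
  have hone : ∫ t, Θ t = 1 := by
    have := hΘ.integral_invFT_mul_exp (by linarith) 0
    simpa [symMol, he.ne'] using this
  have hlim : f 0 = ∫ t, Θ t * f 0 := by rw [integral_mul_const, hone, one_mul]
  rw [hlim]
  refine tendsto_integral_of_dominated_convergence (fun t => Ct * D * Real.exp (-1 * |t|))
    (fun m => ?_) ((integrable_exp_neg_mul_abs one_pos).const_mul _)
    (fun m => Eventually.of_forall fun t => ?_) (Eventually.of_forall fun t => ?_)
  · exact ((hΘ.continuous_invFT (by linarith)).mul
      (hf.comp (by fun_prop))).aestronglyMeasurable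
  · have h1 := hD (-(t / (m + 1)))
    have h2 : |-(t / ((m : ℝ) + 1))| ≤ |t| := by
      rw [abs_neg, abs_div]
      refine div_le_self (abs_nonneg _) ?_
      rw [abs_of_nonneg (by positivity)]
      linarith [(Nat.cast_nonneg m : (0 : ℝ) ≤ m)]
    rw [norm_mul]
    calc _ ≤ (Ct * Real.exp (-(κ + 1) * |t|)) * (D * Real.exp (κ * |t|)) := by
          gcongr
          · exact hCt t
          · refine h1.trans ?_
            gcongr
      _ = Ct * D * (Real.exp (-(κ + 1) * |t|) * Real.exp (κ * |t|)) := by ring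
      _ = _ := by
        rw [← Real.exp_add]
        congr 2
        ring
  · have h1 : Tendsto (fun m : ℕ => -(t / ((m : ℝ) + 1))) atTop (𝓝 0) := by
      have := (tendsto_one_div_add_atTop_nhds_zero_nat (𝕜 := ℝ)).const_mul (-t)
      rw [mul_zero] at this
      refine this.congr fun m => ?_
      ring
    exact ((hf.tendsto 0).comp h1).const_mul _

end GrowthSeq

/-- Iterated partial derivative along a word of coordinate directions. -/
def wD {d : ℕ} {E : Type*} [NormedAddCommGroup E] [NormedSpace ℝ E]
    (L : List (Fin d)) (f : Rd d → E) : Rd d → E := L.foldr (fun j g => dop j g) f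

section Words

variable {d : ℕ}

theorem wD_cons (j : Fin d) (L : List (Fin d)) (f : Rd d → ℂ) : wD (j :: L) f = dop j (wD L f) :=
  rfl

theorem wD_append (L L' : List (Fin d)) (f : Rd d → ℂ) : wD (L ++ L') f = wD L (wD L' f) := by
  simp [wD]

theorem contDiff_dop {f : Rd d → ℂ} (hf : ContDiff ℝ (⊤ : ℕ∞) f) (j : Fin d) :
    ContDiff ℝ (⊤ : ℕ∞) (dop j f) :=
  (hf.fderiv_right (by simp)).clm_apply contDiff_const

theorem contDiff_wD {f : Rd d → ℂ} (hf : ContDiff ℝ (⊤ : ℕ∞) f) (L : List (Fin d)) :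
    ContDiff ℝ (⊤ : ℕ∞) (wD L f) := by
  induction L with
  | nil => exact hf
  | cons j L ih => exact contDiff_dop ih j

theorem dop_comm {f : Rd d → ℂ} (hf : ContDiff ℝ (⊤ : ℕ∞) f) (i j : Fin d) :
    dop i (dop j f) = dop j (dop i f) := by
  have h1 : Differentiable ℝ (fderiv ℝ f) :=
    (hf.fderiv_right (m := (⊤ : ℕ∞)) (by simp)).differentiable (by simp)
  have key : ∀ a b : Fin d, ∀ x, dop a (dop b f) x =
      fderiv ℝ (fderiv ℝ f) x (EuclideanSpace.single a 1) (EuclideanSpace.single b 1) := by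
    intro a b x
    have : fderiv ℝ (fun y => fderiv ℝ f y (EuclideanSpace.single b (1 : ℝ))) x =
        (fderiv ℝ (fderiv ℝ f) x).flip (EuclideanSpace.single b 1) := by
      rw [fderiv_clm_apply (h1 x) (differentiableAt_const _)]
      ext
      simp
    change fderiv ℝ (fun y => fderiv ℝ f y (EuclideanSpace.single b (1 : ℝ))) x _ = _
    rw [this]
    rfl
  ext x
  rw [key, key]
  have hs : IsSymmSndFDerivAt ℝ f x := hf.contDiffAt.isSymmSndFDerivAt
    (by simpa using WithTop.coe_le_coe.2 (le_top (a := (2 : ℕ∞))))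
  exact hs _ _

theorem wD_perm {f : Rd d → ℂ} (hf : ContDiff ℝ (⊤ : ℕ∞) f) {L L' : List (Fin d)}
    (h : L.Perm L') : wD L f = wD L' f := by
  induction h with
  | nil => rfl
  | cons j _ ih => rw [wD_cons, wD_cons, ih]
  | swap i j L => exact dop_comm (contDiff_wD hf L) _ _
  | trans _ _ h1 h2 => rw [h1, h2]

/-- The word spelling out a multi-index. -/
def multiWord (α : Fin d → ℕ) : List (Fin d) :=
  (List.finRange d).flatMap fun j => List.replicate (α j) j

theorem wD_replicate (k : ℕ) (j : Fin d) (f : Rd d → ℂ) :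
    wD (List.replicate k j) f = (dop j)^[k] f := by
  induction k with
  | zero => rfl
  | succ k ih => rw [List.replicate_succ, wD_cons, ih, Function.iterate_succ_apply']

theorem pD_eq_wD (α : Fin d → ℕ) (f : Rd d → ℂ) : pD α f = wD (multiWord α) f := by
  rw [pD, multiWord]
  induction List.finRange d with
  | nil => rfl
  | cons j L ih => rw [List.foldr_cons, ih, List.flatMap_cons, wD_append, wD_replicate]

theorem length_multiWord (α : Fin d → ℕ) : (multiWord α).length = msize α := by
  rw [multiWord, List.length_flatMap, msize, ← List.sum_ofFn, List.ofFn_eq_map]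
  simp

theorem count_multiWord (α : Fin d → ℕ) (i : Fin d) : (multiWord α).count i = α i := by
  rw [multiWord, List.count_flatMap]
  have : ((List.finRange d).map (List.count i ∘ fun j => List.replicate (α j) j)).sum =
      ∑ j, if j = i then α j else 0 := by
    rw [← List.sum_ofFn, List.ofFn_eq_map]
    congr 2
    ext j
    simp [List.count_replicate]
  rw [this]
  simp

theorem wD_eq_pD {f : Rd d → ℂ} (hf : ContDiff ℝ (⊤ : ℕ∞) f) (L : List (Fin d)) :
    wD L f = pD (fun j => L.count j) f := by
  rw [pD_eq_wD]
  refine wD_perm hf (List.perm_iff_count.2 fun i => ?_)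
  rw [count_multiWord]

theorem msize_count (L : List (Fin d)) : msize (fun j => L.count j) = L.length := by
  rw [← length_multiWord]
  refine List.Perm.length_eq (List.perm_iff_count.2 fun i => ?_)
  rw [count_multiWord]

/-- Bounds on all `pD α f` are the same as bounds on all `wD L f`. -/
theorem forall_pD_iff_forall_wD {f : Rd d → ℂ} (hf : ContDiff ℝ (⊤ : ℕ∞) f)
    (P : ℕ → (Rd d → ℂ) → Prop) :
    (∀ α, P (msize α) (pD α f)) ↔ ∀ L : List (Fin d), P L.length (wD L f) := by
  refine ⟨fun h L => ?_, fun h α => ?_⟩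
  · rw [wD_eq_pD hf, ← msize_count]
    exact h _
  · rw [pD_eq_wD, ← length_multiWord]
    exact h _

theorem fderiv_eq_sum_dop {f : Rd d → ℂ} (x y : Rd d) :
    fderiv ℝ f x y = ∑ j, (y j : ℂ) * dop j f x := by
  conv_lhs => rw [← (EuclideanSpace.basisFun (Fin d) ℝ).sum_repr y]
  rw [map_sum]
  refine Finset.sum_congr rfl fun j _ => ?_
  rw [map_smul]
  simp [dop]

theorem norm_fderiv_le_sum_dop {f : Rd d → ℂ} (x : Rd d) :
    ‖fderiv ℝ f x‖ ≤ ∑ j, ‖dop j f x‖ := by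
  refine ContinuousLinearMap.opNorm_le_bound _ (Finset.sum_nonneg fun _ _ => norm_nonneg _)
    fun y => ?_
  rw [fderiv_eq_sum_dop, Finset.sum_mul]
  refine (norm_sum_le _ _).trans (Finset.sum_le_sum fun j _ => ?_)
  rw [norm_mul, mul_comm]
  gcongr
  simpa using PiLp.norm_apply_le y j

/-- The linear map with prescribed values on the coordinate vectors. -/
def coordMap (v : Fin d → ℂ) : Rd d →L[ℝ] ℂ :=
  ∑ j, (EuclideanSpace.proj j : Rd d →L[ℝ] ℝ).smulRight (v j)

theorem coordMap_single (v : Fin d → ℂ) (j : Fin d) :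
    coordMap v (EuclideanSpace.single j 1) = v j := by
  simp [coordMap]

theorem fderiv_eq_coordMap {f : Rd d → ℂ} (x : Rd d) :
    fderiv ℝ f x = coordMap fun j => dop j f x := by
  ext y
  rw [fderiv_eq_sum_dop]
  simp [coordMap]

/-- An operator which commutes with the partial derivatives on a class of functions stable under
differentiation preserves smoothness. -/
theorem contDiff_of_commute (S : (Rd d → ℂ) → Rd d → ℂ) (V : Set (Rd d → ℂ))
    (hV : ∀ f ∈ V, ∀ j, dop j f ∈ V) (hd : ∀ f ∈ V, Differentiable ℝ (S f))
    (hS : ∀ f ∈ V, ∀ j, dop j (S f) = S (dop j f)) {f : Rd d → ℂ} (hf : f ∈ V) :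
    ContDiff ℝ (⊤ : ℕ∞) (S f) ∧ ∀ L, wD L (S f) = S (wD L f) := by
  constructor
  · rw [contDiff_infty]
    intro n
    induction n generalizing f with
    | zero => exact contDiff_zero.2 (hd f hf).continuous
    | succ n ih =>
      rw [Nat.cast_succ]
      refine contDiff_succ_iff_fderiv.2 ⟨hd f hf, by simp, ?_⟩
      have : fderiv ℝ (S f) = fun x => coordMap fun j => S (dop j f) x := by
        ext1 x
        rw [fderiv_eq_coordMap]
        simp only [hS f hf]
      rw [this]
      unfold coordMap
      exact ContDiff.sum fun j _ => contDiff_const.smulRight (ih (hV f hf j))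
  · have : ∀ L, wD L (S f) = S (wD L f) ∧ wD L f ∈ V := by
      intro L
      induction L with
      | nil => exact ⟨rfl, hf⟩
      | cons j L ih =>
        rw [wD_cons, wD_cons, ih.1]
        exact ⟨hS _ ih.2 j, hV _ ih.2 j⟩
    exact fun L => (this L).1

end Words

/-- Smooth functions all of whose derivatives are bounded by multiples of `exp (κ ‖x‖)`. -/
def expGrowth (d : ℕ) (κ : ℝ) : Set (Rd d → ℂ) :=
  {f | ContDiff ℝ (⊤ : ℕ∞) f ∧ ∀ L : List (Fin d), ∃ C, ∀ x, ‖wD L f x‖ ≤ C * Real.exp (κ * ‖x‖)}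

/-- Convolution along a map `ℓ` into `ℝ^d`. -/
def convAlong {d : ℕ} {Y : Type*} [MeasurableSpace Y] (ν : Measure Y) (p : Y → ℂ) (ℓ : Y → Rd d)
    (f : Rd d → ℂ) (x : Rd d) : ℂ := ∫ y, p y * f (x - ℓ y) ∂ν

theorem dop_mem_expGrowth {d : ℕ} {κ : ℝ} {f : Rd d → ℂ} (hf : f ∈ expGrowth d κ) (j : Fin d) :
    dop j f ∈ expGrowth d κ :=
  ⟨contDiff_dop hf.1 j, fun L => by simpa [wD_append, wD] using hf.2 (L ++ [j])⟩

section ConvAlong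

variable {d : ℕ} {Y : Type*} [MeasurableSpace Y] {ν : Measure Y} {p : Y → ℂ} {ℓ : Y → Rd d}
  {κ : ℝ}

theorem norm_comp_sub_le (hκ : 0 ≤ κ) {F : Type*} [NormedAddCommGroup F] {g : Rd d → F} {C : ℝ}
    (hg : ∀ x, ‖g x‖ ≤ C * Real.exp (κ * ‖x‖)) (x y : Rd d) :
    ‖g (x - y)‖ ≤ C * Real.exp (κ * ‖x‖) * Real.exp (κ * ‖y‖) := by
  have hC : 0 ≤ C := by
    have := (norm_nonneg _).trans (hg 0)
    simpa using this
  refine (hg _).trans ?_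
  rw [mul_assoc, ← Real.exp_add, ← mul_add]
  gcongr
  exact norm_sub_le x y

theorem integrable_convAlong (hκ : 0 ≤ κ) (hp : AEStronglyMeasurable p ν)
    (hℓ : AEStronglyMeasurable ℓ ν) (hint : Integrable (fun y => ‖p y‖ * Real.exp (κ * ‖ℓ y‖)) ν)
    {F : Type*} [NormedAddCommGroup F] [NormedSpace ℂ F] {g : Rd d → F} (hgc : Continuous g) {C : ℝ}
    (hg : ∀ x, ‖g x‖ ≤ C * Real.exp (κ * ‖x‖)) (x : Rd d) :
    Integrable (fun y => p y • g (x - ℓ y)) ν := by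
  refine (hint.const_mul (C * Real.exp (κ * ‖x‖))).mono'
    (hp.smul (hgc.comp_aestronglyMeasurable (aestronglyMeasurable_const.sub hℓ))) (Eventually.of_forall fun y => ?_)
  rw [norm_smul]
  calc _ ≤ ‖p y‖ * (C * Real.exp (κ * ‖x‖) * Real.exp (κ * ‖ℓ y‖)) := by
        gcongr
        exact norm_comp_sub_le hκ hg x _
    _ = _ := by ring

theorem exists_norm_fderiv_le {f : Rd d → ℂ} (hf : f ∈ expGrowth d κ) :
    ∃ C, ∀ x, ‖fderiv ℝ f x‖ ≤ C * Real.exp (κ * ‖x‖) := by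
  choose C hC using fun j => hf.2 [j]
  refine ⟨∑ j, C j, fun x => (norm_fderiv_le_sum_dop x).trans ?_⟩
  rw [Finset.sum_mul]
  exact Finset.sum_le_sum fun j _ => hC j x

theorem hasFDerivAt_convAlong (hκ : 0 ≤ κ) (hp : AEStronglyMeasurable p ν)
    (hℓ : AEStronglyMeasurable ℓ ν) (hint : Integrable (fun y => ‖p y‖ * Real.exp (κ * ‖ℓ y‖)) ν)
    {f : Rd d → ℂ} (hf : f ∈ expGrowth d κ) (x : Rd d) :
    HasFDerivAt (convAlong ν p ℓ f) (coordMap fun j => convAlong ν p ℓ (dop j f) x) x := by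
  obtain ⟨C, hC⟩ := exists_norm_fderiv_le hf
  obtain ⟨C0, hC0⟩ := hf.2 []
  have hfd : Continuous (fderiv ℝ f) := hf.1.continuous_fderiv (by simp)
  have hC' : 0 ≤ C := by
    have := (norm_nonneg _).trans (hC 0)
    simpa using this
  have key := hasFDerivAt_integral_of_dominated_of_fderiv_le (𝕜 := ℝ) (μ := ν) (x₀ := x)
    (s := Metric.ball x 1)
    (F := fun x y => p y * f (x - ℓ y)) (F' := fun x y => p y • fderiv ℝ f (x - ℓ y))
    (bound := fun y => C * Real.exp (κ * (‖x‖ + 1)) * (‖p y‖ * Real.exp (κ * ‖ℓ y‖)))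
    (Metric.ball_mem_nhds x one_pos)
    (Eventually.of_forall fun x' =>
      (integrable_convAlong hκ hp hℓ hint hf.1.continuous hC0 x').aestronglyMeasurable)
    (integrable_convAlong hκ hp hℓ hint hf.1.continuous hC0 x)
    (integrable_convAlong hκ hp hℓ hint hfd hC x).aestronglyMeasurable
    (Eventually.of_forall fun y x' hx' => ?_) (hint.const_mul _)
    (Eventually.of_forall fun y x' _ => ?_)
  · refine key.congr_fderiv ?_
    have e1 : coordMap (fun j => convAlong ν p ℓ (dop j f) x) =
        coordMap fun j => (∫ y, p y • fderiv ℝ f (x - ℓ y) ∂ν) (EuclideanSpace.single j 1) := by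
      congr 1
      ext j
      rw [ContinuousLinearMap.integral_apply (integrable_convAlong hκ hp hℓ hint hfd hC x)]
      rfl
    rw [e1]
    ext y
    set Λ := ∫ y, p y • fderiv ℝ f (x - ℓ y) ∂ν
    conv_lhs => rw [← (EuclideanSpace.basisFun (Fin d) ℝ).sum_repr y]
    rw [map_sum]
    simp [coordMap]
  · have h1 : ‖x'‖ ≤ ‖x‖ + 1 := by
      have := norm_le_norm_add_norm_sub' x' x
      rw [Metric.mem_ball, dist_eq_norm] at hx'
      linarith
    rw [norm_smul]
    calc _ ≤ ‖p y‖ * (C * Real.exp (κ * ‖x'‖) * Real.exp (κ * ‖ℓ y‖)) := by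
          gcongr
          exact norm_comp_sub_le hκ hC x' _
      _ ≤ ‖p y‖ * (C * Real.exp (κ * (‖x‖ + 1)) * Real.exp (κ * ‖ℓ y‖)) := by gcongr
      _ = _ := by ring
  · have h1 : HasFDerivAt f (fderiv ℝ f (x' - ℓ y)) (x' - ℓ y) :=
      (hf.1.differentiable (by simp) _).hasFDerivAt
    have h2 := h1.comp x' ((hasFDerivAt_id x').sub_const (ℓ y))
    exact (h2.const_smul (p y)).congr_fderiv (by ext; simp)

theorem dop_convAlong (hκ : 0 ≤ κ) (hp : AEStronglyMeasurable p ν)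
    (hℓ : AEStronglyMeasurable ℓ ν) (hint : Integrable (fun y => ‖p y‖ * Real.exp (κ * ‖ℓ y‖)) ν)
    {f : Rd d → ℂ} (hf : f ∈ expGrowth d κ) (j : Fin d) :
    dop j (convAlong ν p ℓ f) = convAlong ν p ℓ (dop j f) := by
  ext x
  rw [dop, (hasFDerivAt_convAlong hκ hp hℓ hint hf x).fderiv, coordMap_single]

theorem contDiff_convAlong (hκ : 0 ≤ κ) (hp : AEStronglyMeasurable p ν)
    (hℓ : AEStronglyMeasurable ℓ ν) (hint : Integrable (fun y => ‖p y‖ * Real.exp (κ * ‖ℓ y‖)) ν)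
    {f : Rd d → ℂ} (hf : f ∈ expGrowth d κ) :
    ContDiff ℝ (⊤ : ℕ∞) (convAlong ν p ℓ f) ∧
      ∀ L, wD L (convAlong ν p ℓ f) = convAlong ν p ℓ (wD L f) :=
  contDiff_of_commute (convAlong ν p ℓ) (expGrowth d κ) (fun _ hf j => dop_mem_expGrowth hf j)
    (fun _ hf x => (hasFDerivAt_convAlong hκ hp hℓ hint hf x).differentiableAt)
    (fun _ hf j => dop_convAlong hκ hp hℓ hint hf j) hf

end ConvAlong

/-- The coordinate line in direction `i`. -/
def lineMap {d : ℕ} (i : Fin d) (t : ℝ) : Rd d := t • EuclideanSpace.single i (1 : ℝ)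

/-- The mollified inverse of the convolution with `factorKernel` in direction `i`. -/
def invApprox {d : ℕ} (i : Fin d) (l : ℕ) (μ : ℕ → ℝ) (m : ℕ) : (Rd d → ℂ) → Rd d → ℂ :=
  convAlong volume (inverseKernel l μ m) (lineMap i)

/-- The inverse of the convolution with `factorKernel` in direction `i`. -/
def invOp {d : ℕ} (i : Fin d) (l : ℕ) (μ : ℕ → ℝ) (f : Rd d → ℂ) (x : Rd d) : ℂ :=
  limUnder atTop fun m => invApprox i l μ m f x

/-- The weights controlling iterated derivatives in the direction of inversion. -/
def lineWeight (l : ℕ) (μ : ℕ → ℝ) (C₁ C₂ : ℝ) (k : ℕ) : ℝ :=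
  (∏ j ∈ Finset.range k, μ j) / (2 * lossRate l C₁ C₂) ^ k

/-- Smooth functions of exponential growth on which `invOp` acts. -/
def lineClass {d : ℕ} (i : Fin d) (l : ℕ) (μ : ℕ → ℝ) (C₁ C₂ κ : ℝ) : Set (Rd d → ℂ) :=
  {f | ContDiff ℝ (⊤ : ℕ∞) f ∧ ∀ L : List (Fin d), ∃ B, 0 ≤ B ∧ ∀ k x,
    ‖wD (List.replicate k i) (wD L f) x‖ ≤ B * lineWeight l μ C₁ C₂ k * Real.exp (κ * ‖x‖)}

section Line

variable {d : ℕ} {i : Fin d} {l : ℕ} {μ : ℕ → ℝ} {C₁ C₂ κ : ℝ}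

theorem norm_lineMap (t : ℝ) : ‖lineMap i t‖ = |t| := by simp [lineMap, norm_smul]

theorem continuous_lineMap : Continuous (lineMap i) := by unfold lineMap; fun_prop

theorem lineMap_neg (t : ℝ) : lineMap i (-t) = -lineMap i t := by simp [lineMap]

theorem lineMap_add (s t : ℝ) : lineMap i (s + t) = lineMap i s + lineMap i t := by
  simp [lineMap, add_smul]

theorem contDiff_line {g : Rd d → ℂ} (hg : ContDiff ℝ (⊤ : ℕ∞) g) (x : Rd d) :
    ContDiff ℝ (⊤ : ℕ∞) fun t => g (x + lineMap i t) := by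
  unfold lineMap
  fun_prop

theorem iteratedDeriv_line {g : Rd d → ℂ} (hg : ContDiff ℝ (⊤ : ℕ∞) g) (x : Rd d) (k : ℕ) :
    iteratedDeriv k (fun t => g (x + lineMap i t)) =
      fun t => wD (List.replicate k i) g (x + lineMap i t) := by
  induction k with
  | zero => rfl
  | succ k ih =>
    rw [iteratedDeriv_succ, ih]
    ext t
    have h1 := ((contDiff_wD hg (List.replicate k i)).differentiable (by simp)
      (x + lineMap i t)).hasFDerivAt
    have h2 : HasDerivAt (fun t => x + lineMap i t) (EuclideanSpace.single i (1 : ℝ)) t := by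
      have := ((hasDerivAt_id t).smul_const (EuclideanSpace.single i (1 : ℝ))).const_add x
      simpa [lineMap] using this
    exact (h1.comp_hasDerivAt t h2).deriv

theorem dop_mem_lineClass {f : Rd d → ℂ} (hf : f ∈ lineClass i l μ C₁ C₂ κ) (j : Fin d) :
    dop j f ∈ lineClass i l μ C₁ C₂ κ :=
  ⟨contDiff_dop hf.1 j, fun L => by simpa [wD_append, wD] using hf.2 (L ++ [j])⟩

theorem lineClass_subset : lineClass i l μ C₁ C₂ κ ⊆ expGrowth d κ := by
  refine fun f hf => ⟨hf.1, fun L => ?_⟩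
  obtain ⟨B, -, hB⟩ := hf.2 L
  exact ⟨_, hB 0⟩

theorem norm_coordMap_le (v : Fin d → ℂ) : ‖coordMap v‖ ≤ ∑ j, ‖v j‖ := by
  refine ContinuousLinearMap.opNorm_le_bound _ (Finset.sum_nonneg fun _ _ => norm_nonneg _)
    fun y => ?_
  rw [Finset.sum_mul]
  simp only [coordMap, sum_apply]
  refine (norm_sum_le _ _).trans (Finset.sum_le_sum fun j _ => ?_)
  simp only [ContinuousLinearMap.smulRight_apply, norm_smul]
  rw [mul_comm]
  gcongr
  simpa using PiLp.norm_apply_le y j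

namespace GrowthSeq

theorem invApprox_eq (x : Rd d) (g : Rd d → ℂ) (m : ℕ) :
    invApprox i l μ m g x = ∫ t, inverseKernel l μ m t * g (x + lineMap i (-t)) := by
  simp only [lineMap_neg, ← sub_eq_add_neg]
  rfl

theorem lineWeight_nonneg (h : GrowthSeq l μ C₁ C₂) (k : ℕ) : 0 ≤ lineWeight l μ C₁ C₂ k := by
  have := h.one_le_lossRate
  have := Finset.prod_nonneg fun j (_ : j ∈ Finset.range k) => (h.pos j).le
  unfold lineWeight
  positivity

theorem exists_invOp_bound (h : GrowthSeq l μ C₁ C₂) (i : Fin d) (hκ : 0 ≤ κ) :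
    ∃ C, 0 ≤ C ∧ ∃ δ : ℕ → ℝ, Tendsto δ atTop (𝓝 0) ∧ ∀ g : Rd d → ℂ, ContDiff ℝ (⊤ : ℕ∞) g →
      ∀ x B, 0 ≤ B → (∀ k t, ‖wD (List.replicate k i) g (x + lineMap i t)‖ ≤
        B * lineWeight l μ C₁ C₂ k * Real.exp (κ * |t|)) →
      (∀ m, ‖invApprox i l μ m g x‖ ≤ C * B) ∧ ‖invOp i l μ g x‖ ≤ C * B ∧
      (∀ m, ‖invApprox i l μ m g x - invOp i l μ g x‖ ≤ δ m * B) ∧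
      Tendsto (fun m => invApprox i l μ m g x) atTop (𝓝 (invOp i l μ g x)) := by
  obtain ⟨C, hC0, δ, hδ, hmain⟩ := h.exists_inverseKernel_bound hκ
  refine ⟨C, hC0, δ, hδ, fun g hg x B hB hb => ?_⟩
  obtain ⟨h1, h2⟩ := hmain _ (contDiff_line hg x) B hB (fun k t => by
    rw [iteratedDeriv_line hg]
    exact hb k t)
  simp only [← invApprox_eq] at h1 h2
  have hlim : Tendsto (fun m => invApprox i l μ m g x) atTop (𝓝 (invOp i l μ g x)) := by
    refine CauchySeq.tendsto_limUnder (cauchySeq_iff_tendsto_dist_atTop_0.2 ?_)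
    have h3 : Tendsto (fun q : ℕ × ℕ => (δ q.1 + δ q.2) * B) atTop (𝓝 0) := by
      rw [← prod_atTop_atTop_eq]
      simpa using ((hδ.comp tendsto_fst).add (hδ.comp tendsto_snd)).mul_const B
    refine squeeze_zero (fun _ => dist_nonneg) (fun q => ?_) h3
    rw [dist_eq_norm]
    exact h2 _ _
  refine ⟨h1, le_of_tendsto hlim.norm (Eventually.of_forall h1), fun m => ?_, hlim⟩
  have h4 : Tendsto (fun m' => (δ m + δ m') * B) atTop (𝓝 (δ m * B)) := by
    simpa using (hδ.const_add (δ m)).mul_const B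
  exact le_of_tendsto_of_tendsto (hlim.const_sub _).norm h4 (Eventually.of_forall fun m' => h2 m m')

theorem line_bound_of_mem (h : GrowthSeq l μ C₁ C₂) (hκ : 0 ≤ κ) {g : Rd d → ℂ} {B : ℝ}
    (hB : 0 ≤ B) (hb : ∀ k x, ‖wD (List.replicate k i) g x‖ ≤
      B * lineWeight l μ C₁ C₂ k * Real.exp (κ * ‖x‖)) (x : Rd d) (k : ℕ) (t : ℝ) :
    ‖wD (List.replicate k i) g (x + lineMap i t)‖ ≤
      B * Real.exp (κ * ‖x‖) * lineWeight l μ C₁ C₂ k * Real.exp (κ * |t|) := by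
  have hk := h.lineWeight_nonneg k
  refine (hb k _).trans ?_
  calc _ ≤ B * lineWeight l μ C₁ C₂ k * Real.exp (κ * ‖x‖ + κ * |t|) := by
        refine mul_le_mul_of_nonneg_left (Real.exp_le_exp.2 ?_) (by positivity)
        have := norm_add_le x (lineMap i t)
        rw [norm_lineMap] at this
        rw [← mul_add]
        gcongr
    _ = _ := by
      rw [Real.exp_add]
      ring

theorem integrable_inverseKernel_mul_exp (h : GrowthSeq l μ C₁ C₂) (hκ : 0 ≤ κ) (m : ℕ) :
    Integrable fun t => ‖inverseKernel l μ m t‖ * Real.exp (κ * ‖lineMap i t‖) := by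
  obtain ⟨C, -, hC⟩ := h.exists_norm_inverseKernel_le m (n := κ + 1) (by linarith)
  refine ((integrable_exp_neg_mul_abs one_pos).const_mul C).mono' ?_
    (Eventually.of_forall fun t => ?_)
  · exact ((h.continuous_inverseKernel m).norm.mul (Real.continuous_exp.comp
      (continuous_const.mul continuous_lineMap.norm))).aestronglyMeasurable
  · rw [Real.norm_of_nonneg (by positivity), norm_lineMap]
    calc _ ≤ C * Real.exp (-(κ + 1) * |t|) * Real.exp (κ * |t|) := by
          gcongr
          exact hC t
      _ = _ := by
        rw [mul_assoc, ← Real.exp_add]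
        congr 2
        ring

theorem hasFDerivAt_invOp (h : GrowthSeq l μ C₁ C₂) (hκ : 0 ≤ κ) {f : Rd d → ℂ}
    (hf : f ∈ lineClass i l μ C₁ C₂ κ) (x : Rd d) :
    HasFDerivAt (invOp i l μ f) (coordMap fun j => invOp i l μ (dop j f) x) x := by
  obtain ⟨C, hC0, δ, hδ, hmain⟩ := h.exists_invOp_bound i hκ
  have hbd : ∀ g ∈ lineClass i l μ C₁ C₂ κ, ∃ B, 0 ≤ B ∧ ∀ x,
      (∀ m, ‖invApprox i l μ m g x - invOp i l μ g x‖ ≤ δ m * (B * Real.exp (κ * ‖x‖))) ∧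
      Tendsto (fun m => invApprox i l μ m g x) atTop (𝓝 (invOp i l μ g x)) := by
    intro g hg
    obtain ⟨B, hB0, hB⟩ := hg.2 []
    refine ⟨B, hB0, fun x => ?_⟩
    exact (hmain g hg.1 x (B * Real.exp (κ * ‖x‖)) (by positivity)
      (h.line_bound_of_mem hκ hB0 hB x)).2.2
  obtain ⟨_, _, hf0⟩ := hbd f hf
  choose B hB0 hB using fun j => hbd _ (dop_mem_lineClass hf j)
  refine hasFDerivAt_of_tendstoUniformlyOn (l := atTop) (s := Metric.ball x 1)
    (f := fun m => invApprox i l μ m f)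
    (f' := fun m x => coordMap fun j => invApprox i l μ m (dop j f) x)
    (g' := fun x => coordMap fun j => invOp i l μ (dop j f) x) Metric.isOpen_ball ?_
    (fun m x _ => ?_) (fun x _ => (hf0 x).2) (Metric.mem_ball_self one_pos)
  · rw [Metric.tendstoUniformlyOn_iff]
    intro ε hε
    set S := ∑ j, B j * Real.exp (κ * (‖x‖ + 1)) with hS
    have hlim : Tendsto (fun m => |δ m| * S) atTop (𝓝 0) := by
      simpa using hδ.abs.mul_const S
    filter_upwards [hlim.eventually (gt_mem_nhds hε)] with m hm y hy
    have hy' : ‖y‖ ≤ ‖x‖ + 1 := by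
      have := norm_le_norm_add_norm_sub' y x
      rw [Metric.mem_ball, dist_eq_norm] at hy
      linarith
    refine lt_of_le_of_lt ?_ hm
    have e1 : coordMap (fun j => invApprox i l μ m (dop j f) y) -
        coordMap (fun j => invOp i l μ (dop j f) y) =
        coordMap fun j => invApprox i l μ m (dop j f) y - invOp i l μ (dop j f) y := by
      ext z
      simp [coordMap, mul_sub]
    rw [dist_comm, dist_eq_norm, e1]
    refine (norm_coordMap_le _).trans ?_
    rw [hS, Finset.mul_sum]
    refine Finset.sum_le_sum fun j _ => ((hB j y).1 m).trans ?_
    have := hB0 j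
    gcongr
    exact le_abs_self _
  · exact hasFDerivAt_convAlong hκ (h.continuous_inverseKernel m).aestronglyMeasurable
      continuous_lineMap.aestronglyMeasurable (h.integrable_inverseKernel_mul_exp hκ m)
      (lineClass_subset hf) x

theorem contDiff_invOp (h : GrowthSeq l μ C₁ C₂) (hκ : 0 ≤ κ) {f : Rd d → ℂ}
    (hf : f ∈ lineClass i l μ C₁ C₂ κ) :
    ContDiff ℝ (⊤ : ℕ∞) (invOp i l μ f) ∧ ∀ L, wD L (invOp i l μ f) = invOp i l μ (wD L f) :=
  contDiff_of_commute (invOp i l μ) (lineClass i l μ C₁ C₂ κ)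
    (fun _ hf j => dop_mem_lineClass hf j)
    (fun _ hf x => (h.hasFDerivAt_invOp hκ hf x).differentiableAt)
    (fun _ hf j => by
      ext x
      rw [dop, (h.hasFDerivAt_invOp hκ hf x).fderiv, coordMap_single]) hf

theorem convAlong_invOp (h : GrowthSeq l μ C₁ C₂) (hκ : 0 ≤ κ) {f : Rd d → ℂ}
    (hf : f ∈ lineClass i l μ C₁ C₂ κ) :
    convAlong volume (factorKernel l μ) (lineMap i) (invOp i l μ f) = f := by
  ext x
  obtain ⟨C, hC0, δ, hδ, hmain⟩ := h.exists_invOp_bound i hκ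
  obtain ⟨B, hB0, hB⟩ := hf.2 []
  have hf0 := fun x => hmain f hf.1 x (B * Real.exp (κ * ‖x‖)) (by positivity)
      (h.line_bound_of_mem hκ hB0 hB x)
  have h1 := h.tendsto_factorKernel_inverseKernel hκ (f := fun t => f (x + lineMap i t))
    (contDiff_line hf.1 x).continuous (D := B * Real.exp (κ * ‖x‖) * lineWeight l μ C₁ C₂ 0)
    (h.line_bound_of_mem hκ hB0 hB x 0)
  have e1 : ∀ m s, ∫ t, inverseKernel l μ m t * f (x + lineMap i (-s - t)) =
      invApprox i l μ m f (x - lineMap i s) := by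
    intro m s
    rw [invApprox_eq]
    congr 1
    ext t
    rw [sub_eq_add_neg (-s), lineMap_add, lineMap_neg s, sub_eq_add_neg x, add_assoc]
  simp only [e1] at h1
  have e2 : lineMap i 0 = 0 := by simp [lineMap]
  rw [e2, add_zero] at h1
  refine tendsto_nhds_unique ?_ h1
  obtain ⟨E, hE0, hE⟩ := (h.stripRapid_symInv (κ + 1)).exists_norm_invFT_le (by linarith)
  refine tendsto_integral_of_dominated_convergence
    (fun s => E * (C * (B * Real.exp (κ * ‖x‖))) * Real.exp (-1 * |s|)) (fun m => ?_)
    ((integrable_exp_neg_mul_abs one_pos).const_mul _) (fun m => Eventually.of_forall fun s => ?_)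
    (Eventually.of_forall fun s => ?_)
  · have hc : Continuous (invApprox i l μ m f) :=
      continuous_iff_continuousAt.2 fun y => (hasFDerivAt_convAlong hκ
        (h.continuous_inverseKernel m).aestronglyMeasurable
        continuous_lineMap.aestronglyMeasurable (h.integrable_inverseKernel_mul_exp hκ m)
        (lineClass_subset hf) y).continuousAt
    exact (h.contDiff_factorKernel.continuous.mul
      (hc.comp (continuous_const.sub continuous_lineMap))).aestronglyMeasurable
  · have h2 := (hf0 (x - lineMap i s)).1 m
    have h3 : ‖x - lineMap i s‖ ≤ ‖x‖ + |s| := by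
      rw [← norm_lineMap (i := i) s]
      exact norm_sub_le _ _
    rw [norm_mul]
    calc _ ≤ (E * Real.exp (-(κ + 1) * |s|)) * (C * (B * Real.exp (κ * (‖x‖ + |s|)))) := by
          gcongr
          · exact hE s
          · refine h2.trans ?_
            gcongr
      _ = E * (C * (B * Real.exp (κ * ‖x‖))) * Real.exp (-(κ + 1) * |s| + κ * |s|) := by
          rw [mul_add, Real.exp_add, Real.exp_add]
          ring
      _ = _ := by
        congr 2
        ring
  · exact ((hf0 _).2.2.2).const_mul _

end GrowthSeq

end Line

namespace IncWS

variable {d : ℕ} {w : ℕ → Rd d → ℝ}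

theorem exists_sub_le (hw : IncWS d w) (n : ℕ) : ∃ m, ∃ κ C : ℝ, 0 ≤ κ ∧ 0 ≤ C ∧
    ∀ x y, w n x ≤ C * w m (x - y) * Real.exp (κ * ‖y‖) := by
  obtain ⟨m, -, κ, C, hκ, hC, h⟩ := hw.2.2.2.2 n
  exact ⟨m, κ, C, hκ.le, hC.le, fun x y => by simpa using h (x - y) y⟩

theorem exists_one_le (hw : IncWS d w) : ∃ m, ∃ κ C : ℝ, 0 ≤ κ ∧ 0 ≤ C ∧
    ∀ x, 1 ≤ C * w m x * Real.exp (κ * ‖x‖) := by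
  obtain ⟨m, κ, C, hκ, hC, h⟩ := hw.exists_sub_le 0
  have h0 := hw.1 0 0
  refine ⟨m, κ, C / w 0 0, hκ, by positivity, fun x => ?_⟩
  have := h 0 (-x)
  rw [norm_neg, zero_sub, neg_neg] at this
  rw [div_mul_eq_mul_div, div_mul_eq_mul_div, le_div_iff₀ h0, one_mul]
  exact this

end IncWS

/-- The inverse operator in one direction, with weighted bounds. -/
theorem GrowthSeq.exists_invOp_weighted {d : ℕ} {w : ℕ → Rd d → ℝ} (hw : IncWS d w) {l : ℕ}
    {μ : ℕ → ℝ} {C₁ C₂ : ℝ} (h : GrowthSeq l μ C₁ C₂) (i : Fin d) {B : Set (Rd d → ℂ)}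
    (hB : ∀ f ∈ B, ContDiff ℝ (⊤ : ℕ∞) f) {c : ℕ → ℕ → ℝ} (hc : ∀ n q, 0 ≤ c n q)
    (hb : ∀ n, ∀ f ∈ B, ∀ (L : List (Fin d)) k x,
      ‖wD (List.replicate k i ++ L) f x‖ * w n x ≤ c n L.length * lineWeight l μ C₁ C₂ k) :
    (∀ f ∈ B, ContDiff ℝ (⊤ : ℕ∞) (invOp i l μ f) ∧
      convAlong volume (factorKernel l μ) (lineMap i) (invOp i l μ f) = f) ∧
    ∀ n, ∃ m, ∃ C : ℝ, 0 ≤ C ∧ ∀ f ∈ B, ∀ L x,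
      ‖wD L (invOp i l μ f) x‖ * w n x ≤ C * c m L.length := by
  obtain ⟨m₀, κ₀, D₀, hκ₀, hD₀, hw₀⟩ := hw.exists_one_le
  have hmem : ∀ f ∈ B, f ∈ lineClass i l μ C₁ C₂ κ₀ := by
    refine fun f hf => ⟨hB f hf, fun L => ⟨D₀ * c m₀ L.length, mul_nonneg hD₀ (hc _ _), ?_⟩⟩
    intro k x
    rw [← wD_append]
    calc _ ≤ ‖wD (List.replicate k i ++ L) f x‖ * (D₀ * w m₀ x * Real.exp (κ₀ * ‖x‖)) :=
          le_mul_of_one_le_right (norm_nonneg _) (hw₀ x)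
      _ = D₀ * (‖wD (List.replicate k i ++ L) f x‖ * w m₀ x) * Real.exp (κ₀ * ‖x‖) := by ring
      _ ≤ D₀ * (c m₀ L.length * lineWeight l μ C₁ C₂ k) * Real.exp (κ₀ * ‖x‖) := by
          exact mul_le_mul_of_nonneg_right (mul_le_mul_of_nonneg_left (hb m₀ f hf L k x) hD₀)
            (Real.exp_nonneg _)
      _ = _ := by ring
  refine ⟨fun f hf => ⟨(h.contDiff_invOp hκ₀ (hmem f hf)).1, h.convAlong_invOp hκ₀ (hmem f hf)⟩,
    fun n => ?_⟩
  obtain ⟨m, κ, D, hκ, hD, hwn⟩ := hw.exists_sub_le n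
  obtain ⟨C, δ, hC0, hδ, hmain⟩ := h.exists_invOp_bound i hκ
  refine ⟨m, C * D, by positivity, fun f hf L x => ?_⟩
  have hwx := hw.1 n x
  have hcm := hc m L.length
  rw [(h.contDiff_invOp hκ₀ (hmem f hf)).2]
  have := (hmain (wD L f) (contDiff_wD (hB f hf) L) x (D * c m L.length / w n x) (by positivity)
    fun k t => ?_).2.1
  · calc _ ≤ C * (D * c m L.length / w n x) * w n x := by gcongr
      _ = _ := by field_simp
  · rw [← wD_append]
    have h1 := hwn x (-lineMap i t)
    rw [norm_neg, norm_lineMap, sub_neg_eq_add] at h1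
    have h2 : D * c m L.length / w n x * lineWeight l μ C₁ C₂ k * Real.exp (κ * |t|) =
        D * c m L.length * lineWeight l μ C₁ C₂ k * Real.exp (κ * |t|) / w n x := by ring
    rw [h2, le_div_iff₀ hwx]
    calc _ ≤ ‖wD (List.replicate k i ++ L) f (x + lineMap i t)‖ *
          (D * w m (x + lineMap i t) * Real.exp (κ * |t|)) := by gcongr
      _ = D * (‖wD (List.replicate k i ++ L) f (x + lineMap i t)‖ * w m (x + lineMap i t)) *
          Real.exp (κ * |t|) := by ring
      _ ≤ D * (c m L.length * lineWeight l μ C₁ C₂ k) * Real.exp (κ * |t|) := by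
          exact mul_le_mul_of_nonneg_right (mul_le_mul_of_nonneg_left (hb m f hf L k _) hD)
            (Real.exp_nonneg _)
      _ = _ := by ring

/-- The quotients `M (j + 1) / M j`. -/
def quot (M : ℕ → ℝ) (j : ℕ) : ℝ := M (j + 1) / M j

namespace IsWeightSeq

variable {M : ℕ → ℝ}

theorem quot_pos (hM : IsWeightSeq M) (j : ℕ) : 0 < quot M j := div_pos (hM.1 _) (hM.1 _)

theorem monotone_quot (hM : IsWeightSeq M) : Monotone (quot M) := by
  refine monotone_nat_of_le_succ fun j => ?_
  have h := hM.2.2.2.2 (j + 1) (by omega)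
  rw [quot, quot, div_le_div_iff₀ (hM.1 _) (hM.1 _)]
  simp only [Nat.add_sub_cancel] at h
  linarith [h]

theorem quot_zero (hM : IsWeightSeq M) : quot M 0 = 1 := by simp [quot, hM.2.1, hM.2.2.1]

theorem one_le_quot (hM : IsWeightSeq M) (j : ℕ) : 1 ≤ quot M j :=
  hM.quot_zero ▸ hM.monotone_quot (Nat.zero_le j)

theorem succ_eq (hM : IsWeightSeq M) (j : ℕ) : M (j + 1) = M j * quot M j := by
  have := (hM.1 j).ne'
  rw [quot]; field_simp

theorem prod_quot (hM : IsWeightSeq M) (k : ℕ) : ∏ j ∈ Finset.range k, quot M j = M k := by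
  induction k with
  | zero => simp [hM.2.1]
  | succ k ih => rw [Finset.prod_range_succ, ih, ← hM.succ_eq]

theorem monotone (hM : IsWeightSeq M) : Monotone M :=
  monotone_nat_of_le_succ fun j => by
    rw [hM.succ_eq]
    exact le_mul_of_one_le_right (hM.1 j).le (hM.one_le_quot j)

theorem mul_quot_pow_le (hM : IsWeightSeq M) (p q : ℕ) : M p * quot M p ^ q ≤ M (p + q) := by
  induction q with
  | zero => simp
  | succ q ih =>
    have h1 := hM.monotone_quot (Nat.le_add_right p q)
    have h2 := (hM.quot_pos p).le
    have h3 := (hM.1 (p + q)).le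
    rw [← add_assoc, hM.succ_eq, pow_succ, ← mul_assoc]
    exact mul_le_mul ih h1 h2 h3

theorem mul_le (hM : IsWeightSeq M) (p q : ℕ) : M p * M q ≤ M (p + q) := by
  induction q with
  | zero => simp [hM.2.1]
  | succ q ih =>
    have h1 := hM.monotone_quot (Nat.le_add_left q p)
    have h2 := (hM.quot_pos q).le
    have h3 := (hM.1 (p + q)).le
    rw [← add_assoc, hM.succ_eq, hM.succ_eq, ← mul_assoc]
    exact mul_le_mul ih h1 h2 h3

theorem pow_le (hM : IsWeightSeq M) (k q : ℕ) : M k ^ q ≤ M (q * k) := by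
  induction q with
  | zero => simp [hM.2.1]
  | succ q ih =>
    rw [pow_succ, Nat.succ_mul]
    exact (mul_le_mul_of_nonneg_right ih (hM.1 k).le).trans (hM.mul_le _ _)

theorem prod_le {ι : Type*} (hM : IsWeightSeq M) (s : Finset ι) (α : ι → ℕ) :
    ∏ i ∈ s, M (α i) ≤ M (∑ i ∈ s, α i) := by
  classical
  induction s using Finset.induction_on with
  | empty => simp [hM.2.1]
  | insert i s hi ih =>
    rw [Finset.prod_insert hi, Finset.sum_insert hi]
    exact (mul_le_mul_of_nonneg_left ih (hM.1 _).le).trans (hM.mul_le _ _)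

theorem exists_pow_le (hM : IsWeightSeq M) (t : ℝ) : ∃ C, 0 ≤ C ∧ ∀ p, t ^ p ≤ C * M p := by
  have h := (hM.2.2.2.1.eventually_ge_atTop |t|).and (eventually_gt_atTop 0)
  have hb : IsBoundedUnder (· ≤ ·) atTop fun p => |t| ^ p / M p := by
    refine ⟨1, eventually_map.2 (h.mono fun p hp => ?_)⟩
    have := hM.1 p
    refine (div_le_one this).2 ?_
    calc |t| ^ p ≤ (M p ^ ((p : ℝ)⁻¹)) ^ p := pow_le_pow_left₀ (abs_nonneg t) hp.1 p
      _ = M p := Real.rpow_inv_natCast_pow this.le hp.2.ne'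
  obtain ⟨C, hC⟩ := hb.bddAbove_range
  have h2 : ∀ p, |t| ^ p / M p ≤ C := fun p => hC ⟨p, rfl⟩
  refine ⟨C, le_trans (by have := hM.1 0; positivity) (h2 0), fun p => ?_⟩
  have := h2 p
  rw [div_le_iff₀ (hM.1 p)] at this
  exact (le_abs_self _).trans (by rwa [abs_pow])

theorem quot_pow_le (hM : IsWeightSeq M) {C₀ H : ℝ} (h2 : HasM2 M C₀ H) (k : ℕ) :
    quot M k ^ k ≤ C₀ * H ^ (2 * k) * M k := by
  have h1 := (hM.mul_quot_pow_le k k).trans (h2.2.2 k k)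
  rw [← two_mul, mul_comm (M k)] at h1
  exact le_of_mul_le_mul_right h1 (hM.1 k)

theorem exists_quot_growth (hM : IsWeightSeq M) (h : M2star M) : ∃ r : ℕ, 0 < r ∧ ∃ D : ℝ, 1 ≤ D ∧
    ∀ k j : ℕ, k ≤ j → quot M k ^ r * (j + 1) ≤ D * (k + 1) * quot M j ^ r := by
  obtain ⟨p₀, N, hp₀, hN, hs⟩ := h
  have hq : ∀ p, p₀ ≤ p → 2 * quot M (p - 1) ≤ quot M (N * p - 1) := by
    intro p hp
    have h1 : p - 1 + 1 = p := by omega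
    have h2 : N * p - 1 + 1 = N * p := by
      have : 0 < N * p := Nat.mul_pos hN (by omega)
      omega
    rw [quot, quot, h1, h2]
    exact hs p hp
  have hN2 : 2 ≤ N := by
    by_contra hlt
    have : N = 1 := by omega
    have h1 := hq p₀ le_rfl
    rw [this, one_mul] at h1
    linarith [hM.quot_pos (p₀ - 1)]
  have hit : ∀ s p, p₀ ≤ p → 2 ^ s * quot M (p - 1) ≤ quot M (N ^ s * p - 1) := by
    intro s
    induction s with
    | zero => simp
    | succ s ih =>
      intro p hp
      have h1 : p₀ ≤ N ^ s * p := hp.trans (Nat.le_mul_of_pos_left _ (by positivity))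
      have := hq _ h1
      rw [← mul_assoc, ← pow_succ'] at this
      refine le_trans ?_ this
      rw [pow_succ', mul_assoc]
      exact mul_le_mul_of_nonneg_left (ih p hp) zero_le_two
  have hmain : ∀ k j, p₀ ≤ k → k ≤ j →
      quot M (k - 1) ^ N * j ≤ N * k * quot M (j - 1) ^ N := by
    intro k j hk hkj
    have hk0 : 0 < k := by omega
    set s := Nat.log N (j / k)
    have h1 : N ^ s ≤ j / k := Nat.pow_log_le_self N (Nat.div_pos hkj hk0).ne'
    have h2 : j / k < N ^ (s + 1) := Nat.lt_pow_succ_log_self (by omega) _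
    have h3 : N ^ s * k ≤ j := (Nat.le_div_iff_mul_le hk0).1 h1
    have h4 : j < N ^ (s + 1) * k := (Nat.div_lt_iff_lt_mul hk0).1 h2
    have h5 : 2 ^ s * quot M (k - 1) ≤ quot M (j - 1) :=
      (hit s k hk).trans (hM.monotone_quot (by omega))
    have h6 : (N : ℝ) ^ s ≤ (2 ^ s) ^ N := by
      rw [← pow_mul, mul_comm, pow_mul]
      exact pow_le_pow_left₀ (by positivity) (by exact_mod_cast (Nat.lt_two_pow_self).le) s
    have h7 : (j : ℝ) ≤ N ^ (s + 1) * k := by exact_mod_cast h4.le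
    have hqk := hM.quot_pos (k - 1)
    calc quot M (k - 1) ^ N * j ≤ quot M (k - 1) ^ N * (N ^ (s + 1) * k) := by gcongr
      _ = N * k * (N ^ s * quot M (k - 1) ^ N) := by ring
      _ ≤ N * k * ((2 ^ s) ^ N * quot M (k - 1) ^ N) := by gcongr
      _ = N * k * (2 ^ s * quot M (k - 1)) ^ N := by rw [mul_pow]
      _ ≤ _ := by gcongr
  refine ⟨N, hN, p₀ * N, by exact_mod_cast Nat.mul_pos hp₀ hN, fun k j hkj => ?_⟩
  have hk := hM.quot_pos k
  have hj := hM.quot_pos j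
  have hp1 : (1 : ℝ) ≤ p₀ := by exact_mod_cast hp₀
  have hN1 : (1 : ℝ) ≤ N := by exact_mod_cast hN
  rcases le_or_gt p₀ (k + 1) with h1 | h1
  · have := hmain (k + 1) (j + 1) h1 (by omega)
    simp only [Nat.add_sub_cancel] at this
    push_cast at this
    refine this.trans ?_
    have : (N : ℝ) ≤ p₀ * N := le_mul_of_one_le_left (by positivity) hp1
    gcongr
  · rcases le_or_gt p₀ (j + 1) with h2 | h2
    · have := hmain p₀ (j + 1) le_rfl h2
      simp only [Nat.add_sub_cancel] at this
      push_cast at this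
      have h3 : quot M k ≤ quot M (p₀ - 1) := hM.monotone_quot (by omega)
      calc quot M k ^ N * (j + 1 : ℝ) ≤ quot M (p₀ - 1) ^ N * (j + 1) := by gcongr
        _ ≤ N * p₀ * quot M j ^ N := this
        _ = p₀ * N * 1 * quot M j ^ N := by ring
        _ ≤ _ := by gcongr; linarith [(Nat.cast_nonneg k : (0 : ℝ) ≤ k)]
    · have h3 : quot M k ≤ quot M j := hM.monotone_quot hkj
      have h4 : (j + 1 : ℝ) ≤ p₀ := by exact_mod_cast h2.le
      calc quot M k ^ N * (j + 1 : ℝ) ≤ quot M j ^ N * p₀ := by gcongr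
        _ = p₀ * 1 * 1 * quot M j ^ N := by ring
        _ ≤ _ := by gcongr; linarith [(Nat.cast_nonneg k : (0 : ℝ) ≤ k)]

end IsWeightSeq

/-- Positive nondecreasing sequences of slow growth. -/
structure SlowSeq (r : ℕ) (h : ℕ → ℝ) : Prop where
  pos : ∀ j, 0 < h j
  mono : Monotone h
  slow : ∀ k j, k ≤ j → h j ^ (2 * r) * (k + 1) ≤ h k ^ (2 * r) * (j + 1)

theorem SlowSeq.const (r : ℕ) {c : ℝ} (hc : 0 < c) : SlowSeq r fun _ => c where
  pos _ := hc
  mono := monotone_const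
  slow k j hkj := by
    have : (k : ℝ) ≤ j := by exact_mod_cast hkj
    gcongr

theorem sum_range_inv_sq_le (k n : ℕ) :
    ∑ j ∈ Finset.range n, ((j + (k + 1) : ℝ) + 1)⁻¹ ^ 2 ≤ ((k : ℝ) + 1)⁻¹ - ((k : ℝ) + n + 1)⁻¹ := by
  induction n with
  | zero => simp
  | succ n ih =>
    rw [Finset.sum_range_succ]
    have h1 : (0 : ℝ) < k + n + 1 := by positivity
    have h2 : (0 : ℝ) < k + n + 2 := by positivity
    have h3 : ((n + (k + 1) : ℝ) + 1)⁻¹ ^ 2 ≤ ((k : ℝ) + n + 1)⁻¹ - ((k : ℝ) + n + 2)⁻¹ := by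
      rw [show (n + (k + 1) : ℝ) + 1 = k + n + 2 by ring, inv_sub_inv h1.ne' h2.ne', inv_pow,
        ← one_div]
      exact div_le_div₀ (by linarith) (by linarith) (by positivity) (by nlinarith)
    have h4 : (k : ℝ) + ((n + 1 : ℕ) : ℝ) + 1 = k + n + 2 := by push_cast; ring
    rw [h4]
    linarith

namespace IsWeightSeq

variable {M : ℕ → ℝ} {r : ℕ} {D : ℝ} {h : ℕ → ℝ}

theorem quot_div_le_mul (hM : IsWeightSeq M) (hr : 0 < r) (hD : 1 ≤ D)
    (hg : ∀ k j : ℕ, k ≤ j → quot M k ^ r * (j + 1) ≤ D * (k + 1) * quot M j ^ r)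
    (hh : SlowSeq r h) {j k : ℕ} (hjk : j ≤ k) : quot M j / h j ≤ D * (quot M k / h k) := by
  have hj := hM.quot_pos j
  have hk := hM.quot_pos k
  have hhj := hh.pos j
  have hhk := hh.pos k
  rw [mul_div_assoc', div_le_div_iff₀ hhj hhk]
  refine le_of_pow_le_pow_left₀ hr.ne' (by positivity) ?_
  have hjk' : (j : ℝ) ≤ k := by exact_mod_cast hjk
  have h1 := hg j k hjk
  have h2 : h k ^ r * (j + 1) ≤ h j ^ r * (k + 1) := by
    refine le_of_pow_le_pow_left₀ two_ne_zero (by positivity) ?_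
    have := hh.slow j k hjk
    calc (h k ^ r * (j + 1 : ℝ)) ^ 2 = h k ^ (2 * r) * (j + 1) * (j + 1) := by ring
      _ ≤ h j ^ (2 * r) * (k + 1) * (k + 1) := by gcongr
      _ = _ := by ring
  have h3 : D ≤ D ^ r := le_self_pow₀ hD hr.ne'
  have h4 : (0 : ℝ) < (j + 1) * (k + 1) := by positivity
  refine le_of_mul_le_mul_right ?_ h4
  calc (quot M j * h k) ^ r * ((j + 1 : ℝ) * (k + 1))
      = (quot M j ^ r * (k + 1)) * (h k ^ r * (j + 1)) := by ring
    _ ≤ (D * (j + 1) * quot M k ^ r) * (h j ^ r * (k + 1)) := by gcongr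
    _ ≤ (D ^ r * (j + 1) * quot M k ^ r) * (h j ^ r * (k + 1)) := by gcongr
    _ = _ := by ring

theorem quot_div_ratio_le (hM : IsWeightSeq M)
    (hg : ∀ k j : ℕ, k ≤ j → quot M k ^ r * (j + 1) ≤ D * (k + 1) * quot M j ^ r)
    (hh : SlowSeq r h) {k j : ℕ} (hkj : k ≤ j) :
    ((quot M k / h k) / (quot M j / h j)) ^ (2 * (2 * r)) ≤
      D ^ 4 * (k + 1) ^ 2 * ((j + 1 : ℝ)⁻¹) ^ 2 := by
  have hj := hM.quot_pos j
  have hk := hM.quot_pos k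
  have hhj := hh.pos j
  have hhk := hh.pos k
  have h1 := hg k j hkj
  have h2 := hh.slow k j hkj
  have h3 : quot M k ^ r / quot M j ^ r ≤ D * (k + 1) / (j + 1) := by
    rw [div_le_div_iff₀ (by positivity) (by positivity)]; exact h1
  have h4 : h j ^ (2 * r) / h k ^ (2 * r) ≤ (j + 1) / (k + 1) := by
    rw [div_le_div_iff₀ (by positivity) (by positivity)]; linarith
  calc _ = (quot M k ^ r / quot M j ^ r) ^ 4 * (h j ^ (2 * r) / h k ^ (2 * r)) ^ 2 := by
        rw [show (quot M k / h k) / (quot M j / h j) = quot M k / quot M j * (h j / h k) by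
          field_simp, mul_pow, ← div_pow, ← div_pow, ← pow_mul, ← pow_mul]
        congr 2 <;> ring
    _ ≤ (D * (k + 1) / (j + 1)) ^ 4 * ((j + 1) / (k + 1)) ^ 2 := by gcongr
    _ = _ := by field_simp

theorem prod_quot_div_ratio_le (hM : IsWeightSeq M) {C₀ H : ℝ} (h2 : HasM2 M C₀ H)
    (hh : SlowSeq r h) (k : ℕ) :
    ∏ j ∈ Finset.range (k + 1), (quot M k / h k) / (quot M j / h j) ≤ C₀ * H ^ (2 * k) := by
  have hk := hM.quot_pos k
  have hhk := hh.pos k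
  rw [Finset.prod_range_succ, div_self (by positivity), mul_one]
  calc _ ≤ ∏ j ∈ Finset.range k, quot M k / quot M j := by
        refine Finset.prod_le_prod (fun j _ => ?_) fun j hj => ?_
        · have := hM.quot_pos j
          have := hh.pos j
          positivity
        · have h1 := hM.quot_pos j
          have h3 := hh.pos j
          have h4 : h j / h k ≤ 1 := (div_le_one hhk).2 (hh.mono (Finset.mem_range.1 hj).le)
          calc _ = quot M k / quot M j * (h j / h k) := by field_simp
            _ ≤ _ := mul_le_of_le_one_right (by positivity) h4
    _ = quot M k ^ k / M k := by
        rw [Finset.prod_div_distrib, hM.prod_quot, Finset.prod_const, Finset.card_range]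
    _ ≤ _ := by
        rw [div_le_iff₀ (hM.1 k)]
        exact hM.quot_pow_le h2 k

theorem exists_growthSeq (hM : IsWeightSeq M) (hM2 : M2 M) (hr : 0 < r) (hD : 1 ≤ D)
    (hg : ∀ k j : ℕ, k ≤ j → quot M k ^ r * (j + 1) ≤ D * (k + 1) * quot M j ^ r) :
    ∃ C₁ C₂ : ℝ, ∀ h, SlowSeq r h → GrowthSeq (2 * r) (fun j => quot M j / h j) C₁ C₂ := by
  obtain ⟨C₀, H, h2⟩ := hM2
  set E := 2 * D ^ (2 * (2 * r)) with hE
  refine ⟨Real.log E + (2 * (2 * r)) * (Real.log C₀ + 2 * Real.log H) + D ^ 4, D, fun h hh => ?_⟩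
  have hC₀ := h2.1
  have hH := h2.2.1
  set μ := fun j => quot M j / h j with hμ
  have hpos : ∀ j, 0 < μ j := fun j => div_pos (hM.quot_pos j) (hh.pos j)
  have hsum : Summable fun j => ((μ j)⁻¹) ^ (2 * (2 * r)) := by
    have h1 : Summable fun j : ℕ => ((j + 1 : ℝ)⁻¹) ^ 2 := by
      have := (summable_nat_add_iff 1).2 (Real.summable_nat_pow_inv (p := 2) |>.2 (by norm_num))
      simpa [inv_pow] using this
    refine Summable.of_nonneg_of_le (fun j => by have := hpos j; positivity) (fun j => ?_)
      (h1.mul_left (D ^ 4 / μ 0 ^ (2 * (2 * r))))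
    have h3 := hM.quot_div_ratio_le hg hh (Nat.zero_le j)
    have h0 := hpos 0
    change (μ 0 / μ j) ^ _ ≤ _ at h3
    rw [div_pow, div_eq_mul_inv, ← inv_pow, ← le_div_iff₀' (by positivity)] at h3
    refine h3.trans (le_of_eq ?_)
    push_cast
    ring
  have hP : ProdSeq (2 * r) μ := ⟨by omega, hpos, hsum⟩
  refine { toProdSeq := hP, logProd_le := fun k => ?_, le_mul := fun j k hjk =>
    hM.quot_div_le_mul hr hD hg hh hjk }
  have hk0 := hpos k
  rw [logProd, ← (hP.summable_log (μ k)).sum_add_tsum_nat_add (k + 1)]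
  have htail : ∑' j, Real.log (1 + (μ k / μ (j + (k + 1))) ^ (2 * (2 * r))) ≤ D ^ 4 * (k + 1) := by
    refine Real.tsum_le_of_sum_range_le (fun j => ProdSeq.log_nonneg _) fun n => ?_
    calc _ ≤ ∑ j ∈ Finset.range n, D ^ 4 * (k + 1) ^ 2 * ((j + (k + 1) : ℝ) + 1)⁻¹ ^ 2 := by
          refine Finset.sum_le_sum fun j _ => ?_
          have h3 := hM.quot_div_ratio_le hg hh (show k ≤ j + (k + 1) by omega)
          push_cast at h3
          have h4 := ProdSeq.pow_nonneg' (2 * r) (μ k / μ (j + (k + 1)))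
          change (μ k / μ (j + (k + 1))) ^ (2 * (2 * r)) ≤ _ at h3
          refine le_trans ?_ h3
          linarith [Real.log_le_sub_one_of_pos
            (show 0 < 1 + (μ k / μ (j + (k + 1))) ^ (2 * (2 * r)) by linarith)]
      _ ≤ D ^ 4 * (k + 1) ^ 2 * ((k : ℝ) + 1)⁻¹ := by
          rw [← Finset.mul_sum]
          have h5 : (0 : ℝ) ≤ ((k : ℝ) + n + 1)⁻¹ := by positivity
          exact mul_le_mul_of_nonneg_left ((sum_range_inv_sq_le k n).trans (by linarith))
            (by positivity)
      _ = _ := by field_simp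
  have hE0 : 0 < E := by positivity
  have hhead : ∑ j ∈ Finset.range (k + 1), Real.log (1 + (μ k / μ j) ^ (2 * (2 * r))) ≤
      (k + 1) * (Real.log E + (2 * (2 * r)) * (Real.log C₀ + 2 * Real.log H)) := by
    have hprod := hM.prod_quot_div_ratio_le h2 hh k
    have hprod0 : 0 < ∏ j ∈ Finset.range (k + 1), μ k / μ j :=
      Finset.prod_pos fun j _ => div_pos hk0 (hpos j)
    have hlogs : ∑ j ∈ Finset.range (k + 1), Real.log (μ k / μ j) ≤
        Real.log C₀ + 2 * k * Real.log H := by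
      rw [← Real.log_prod fun j _ => (div_pos hk0 (hpos j)).ne']
      refine (Real.log_le_log hprod0 hprod).trans (le_of_eq ?_)
      rw [Real.log_mul (by positivity) (by positivity), Real.log_pow]
      push_cast; ring
    calc _ ≤ ∑ j ∈ Finset.range (k + 1), (Real.log E + (2 * (2 * r)) * Real.log (μ k / μ j)) := by
          refine Finset.sum_le_sum fun j hj => ?_
          have hj0 := hpos j
          have h3 : μ j ≤ D * μ k :=
            hM.quot_div_le_mul hr hD hg hh (Nat.lt_succ_iff.1 (Finset.mem_range.1 hj))
          have h4 : 1 ≤ D * (μ k / μ j) := by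
            rw [mul_div_assoc', one_le_div hj0]; exact h3
          have h5 : 1 ≤ D ^ (2 * (2 * r)) * (μ k / μ j) ^ (2 * (2 * r)) := by
            rw [← mul_pow]; exact one_le_pow₀ h4
          have h6 : (μ k / μ j) ^ (2 * (2 * r)) ≤ D ^ (2 * (2 * r)) * (μ k / μ j) ^ (2 * (2 * r)) :=
            le_mul_of_one_le_left (by positivity) (one_le_pow₀ hD)
          calc _ ≤ Real.log (E * (μ k / μ j) ^ (2 * (2 * r))) := by
                refine Real.log_le_log (by positivity) ?_
                rw [hE]; linarith
            _ = _ := by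
                rw [Real.log_mul hE0.ne' (by positivity), Real.log_pow]; push_cast; ring
      _ = (k + 1) * Real.log E +
          (2 * (2 * r)) * ∑ j ∈ Finset.range (k + 1), Real.log (μ k / μ j) := by
          rw [Finset.sum_add_distrib, Finset.sum_const, Finset.card_range, ← Finset.mul_sum]
          simp
      _ ≤ (k + 1) * Real.log E + (2 * (2 * r)) * ((k + 1) * (Real.log C₀ + 2 * Real.log H)) := by
          gcongr
          refine hlogs.trans ?_
          have h7 := Real.log_nonneg hC₀
          have h8 := Real.log_nonneg hH
          have h9 : (0 : ℝ) ≤ k * Real.log C₀ := by positivity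
          linarith
      _ = _ := by ring
  calc _ ≤ _ := add_le_add hhead htail
    _ = _ := by ring

end IsWeightSeq

theorem exists_slowSeq {r : ℕ} (hr : 0 < r) {s : ℕ → ℕ} (hs : Tendsto s atTop atTop) :
    ∃ h, SlowSeq r h ∧ Tendsto h atTop atTop ∧ (∀ j, 1 ≤ h j) ∧ ∀ j, h j ≤ s j + 1 := by
  set v : ℕ → ℕ → ℝ := fun j i => max 1 ((j + 1 : ℝ) / (i + 1)) * (s i + 1) with hv
  set g : ℕ → ℝ := fun j => ⨅ i, v j i with hg
  have hv1 : ∀ j i, 1 ≤ v j i := fun j i => one_le_mul_of_one_le_of_one_le (le_max_left _ _)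
    (by linarith [(Nat.cast_nonneg (s i) : (0 : ℝ) ≤ s i)])
  have hbdd : ∀ j, BddBelow (Set.range (v j)) := fun j => ⟨1, by rintro _ ⟨i, rfl⟩; exact hv1 j i⟩
  have hg1 : ∀ j, 1 ≤ g j := fun j => le_ciInf (hv1 j)
  have hgs : ∀ j, g j ≤ s j + 1 := fun j => (ciInf_le (hbdd j) j).trans <| by
    have : (j + 1 : ℝ) ≠ 0 := by positivity
    simp [hv, div_self this]
  have hgm : Monotone g := fun j k hjk => ciInf_mono (hbdd j) fun i => by
    have : (j : ℝ) ≤ k := by exact_mod_cast hjk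
    simp only [hv]
    gcongr
  have hgslow : ∀ k j, k ≤ j → g j * (k + 1) ≤ g k * (j + 1) := by
    intro k j hkj
    have hkj' : (k : ℝ) ≤ j := by exact_mod_cast hkj
    have h1 : (0 : ℝ) < j + 1 := by positivity
    rw [← div_le_iff₀ h1]
    refine le_ciInf fun i => ?_
    rw [div_le_iff₀ h1]
    calc g j * (k + 1 : ℝ) ≤ v j i * (k + 1) := by gcongr; exact ciInf_le (hbdd j) i
      _ = (max 1 ((j + 1 : ℝ) / (i + 1)) * (k + 1)) * (s i + 1) := by simp only [hv]; ring
      _ ≤ (max 1 ((k + 1 : ℝ) / (i + 1)) * (j + 1)) * (s i + 1) := by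
          refine mul_le_mul_of_nonneg_right ?_ (by positivity)
          rw [max_mul_of_nonneg _ _ (by positivity), max_mul_of_nonneg _ _ (by positivity)]
          refine max_le ?_ ?_
          · exact le_max_of_le_left (by linarith)
          · exact le_max_of_le_right (le_of_eq (by ring))
      _ = _ := by simp only [hv]; ring
  have hgt : Tendsto g atTop atTop := by
    refine tendsto_atTop.2 fun K => ?_
    obtain ⟨I, hI⟩ := (tendsto_atTop.1 hs ⌈K⌉₊).exists_forall_of_atTop
    have h2 : ∀ᶠ j : ℕ in atTop, |K| * I ≤ j :=
      tendsto_natCast_atTop_atTop.eventually_ge_atTop _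
    filter_upwards [h2] with j hj
    refine le_ciInf fun i => ?_
    have hs0 : (0 : ℝ) ≤ s i := Nat.cast_nonneg _
    rcases le_or_gt I i with hi | hi
    · have h3 : K ≤ s i := (Nat.le_ceil K).trans (by exact_mod_cast hI i hi)
      calc K ≤ 1 * (s i + 1) := by linarith
        _ ≤ _ := by simp only [hv]; gcongr; exact le_max_left _ _
    · have h3 : (i + 1 : ℝ) ≤ I := by exact_mod_cast hi
      have h4 : |K| ≤ (j + 1 : ℝ) / (i + 1) := by
        rw [le_div_iff₀ (by positivity)]
        calc |K| * (i + 1) ≤ |K| * I := by gcongr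
          _ ≤ _ := by linarith
      calc K ≤ |K| * 1 := by linarith [le_abs_self K]
        _ ≤ max 1 ((j + 1 : ℝ) / (i + 1)) * (s i + 1) := by
            gcongr
            · exact le_max_of_le_right h4
            · linarith
  have h2r : 2 * r ≠ 0 := by omega
  have hinv : (0 : ℝ) < ((2 * r : ℕ) : ℝ)⁻¹ := by positivity
  have hinv1 : ((2 * r : ℕ) : ℝ)⁻¹ ≤ 1 :=
    inv_le_one_of_one_le₀ (by exact_mod_cast Nat.one_le_iff_ne_zero.2 h2r)
  have hpow : ∀ j, (g j ^ (((2 * r : ℕ) : ℝ)⁻¹)) ^ (2 * r) = g j := fun j =>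
    Real.rpow_inv_natCast_pow (by linarith [hg1 j]) h2r
  refine ⟨fun j => g j ^ (((2 * r : ℕ) : ℝ)⁻¹), ⟨fun j => ?_, fun j k hjk => ?_, fun k j hkj => ?_⟩,
    (tendsto_rpow_atTop hinv).comp hgt, fun j => Real.one_le_rpow (hg1 j) hinv.le, fun j => ?_⟩
  · have := hg1 j
    positivity
  · exact Real.rpow_le_rpow (by linarith [hg1 j]) (hgm hjk) hinv.le
  · rw [hpow, hpow]
    exact hgslow k j hkj
  · refine le_trans ?_ (hgs j)
    exact (Real.rpow_le_rpow_of_exponent_le (hg1 j) hinv1).trans_eq (Real.rpow_one _)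

theorem exists_diagonal_seq {A : ℕ → ℕ → ℝ} (hA0 : ∀ n p, 0 ≤ A n p)
    (hA : ∀ n, ∀ ρ : ℕ, ∃ C, ∀ p, A n p * (ρ : ℝ) ^ p ≤ C) :
    ∃ s : ℕ → ℕ, Tendsto s atTop atTop ∧ ∀ n, ∀ ρ : ℝ, 0 ≤ ρ → ∀ᶠ p in atTop,
      ∀ t : ℝ, 0 ≤ t → t ≤ s p + 1 → A n p * (ρ * t) ^ p ≤ 1 := by
  choose C hC using fun n (S : ℕ) => hA n (S ^ 2)
  push_cast at hC
  set E : ℕ → ℝ := fun S => ∑ n ∈ Finset.range (S + 1), |C n S| with hE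
  set s : ℕ → ℕ := fun p => Nat.findGreatest (fun S => E S ≤ 2 ^ p) p with hs
  have hst : Tendsto s atTop atTop := by
    refine tendsto_atTop.2 fun S => ?_
    have h2 : ∀ᶠ p : ℕ in atTop, E S ≤ 2 ^ p :=
      (tendsto_pow_atTop_atTop_of_one_lt one_lt_two).eventually_ge_atTop _
    filter_upwards [h2, eventually_ge_atTop S] with p hp hpS
    exact Nat.le_findGreatest hpS hp
  refine ⟨s, hst, fun n ρ hρ => ?_⟩
  filter_upwards [hst.eventually_ge_atTop n, hst.eventually_ge_atTop (⌈4 * ρ⌉₊ + 1)]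
    with p hpn hpρ t ht0 ht
  have h1 : E (s p) ≤ 2 ^ p :=
    Nat.findGreatest_of_ne_zero (P := fun S => E S ≤ 2 ^ p) (n := p) rfl (by omega)
  have h2 : A n p * ((s p : ℝ) ^ 2) ^ p ≤ 2 ^ p := by
    refine (hC n (s p) p).trans (le_trans ?_ h1)
    refine (le_abs_self _).trans ?_
    exact Finset.single_le_sum (f := fun n => |C n (s p)|) (fun _ _ => abs_nonneg _)
      (Finset.mem_range.2 (by omega))
  have h3 : (1 : ℝ) ≤ s p := by exact_mod_cast (show 1 ≤ s p by omega)
  have h4 : 4 * ρ ≤ s p := (Nat.le_ceil _).trans (by exact_mod_cast (show ⌈4 * ρ⌉₊ ≤ s p by omega))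
  have h5 : 2 * (ρ * t) ≤ (s p : ℝ) ^ 2 := by
    have : ρ * t ≤ ρ * (s p + 1) := by gcongr
    nlinarith
  have h6 : 2 ^ p * (A n p * (ρ * t) ^ p) ≤ 2 ^ p * 1 := by
    calc 2 ^ p * (A n p * (ρ * t) ^ p) = A n p * (2 * (ρ * t)) ^ p := by rw [mul_pow 2]; ring
      _ ≤ A n p * ((s p : ℝ) ^ 2) ^ p := by
          have := hA0 n p
          gcongr
      _ ≤ _ := by linarith
  exact le_of_mul_le_mul_left h6 (by positivity)

theorem exists_pow_le_prod {h : ℕ → ℝ} (h0 : ∀ j, 0 < h j) (ht : Tendsto h atTop atTop) {T : ℝ}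
    (hT : 0 < T) : ∃ c, 0 < c ∧ ∀ k, c * T ^ k ≤ ∏ j ∈ Finset.range k, h j := by
  obtain ⟨J, hJ⟩ := (tendsto_atTop.1 ht T).exists_forall_of_atTop
  set u : ℕ → ℝ := fun k => T ^ k / ∏ j ∈ Finset.range k, h j with hu
  have hp : ∀ k, 0 < ∏ j ∈ Finset.range k, h j := fun k => Finset.prod_pos fun j _ => h0 j
  have hu0 : ∀ k, 0 < u k := fun k => div_pos (pow_pos hT k) (hp k)
  have hstep : ∀ i, u (J + i) ≤ u J := by
    intro i
    induction i with
    | zero => simp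
    | succ i ih =>
      refine le_trans ?_ ih
      have h1 := h0 (J + i)
      have h2 := hp (J + i)
      have h3 := hJ (J + i) (by omega)
      simp only [hu]
      rw [← add_assoc, Finset.prod_range_succ, pow_succ, mul_div_mul_comm]
      exact mul_le_of_le_one_right (hu0 (J + i)).le ((div_le_one h1).2 h3)
  have hb : IsBoundedUnder (· ≤ ·) atTop u :=
    ⟨u J, eventually_map.2 ((eventually_ge_atTop J).mono fun k hk => by
      obtain ⟨i, rfl⟩ := Nat.exists_eq_add_of_le hk
      exact hstep i)⟩
  obtain ⟨C, hC⟩ := hb.bddAbove_range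
  have hC' : ∀ k, u k ≤ C := fun k => hC ⟨k, rfl⟩
  have hC0 : 0 < C := (hu0 0).trans_le (hC' 0)
  refine ⟨C⁻¹, by positivity, fun k => ?_⟩
  have := hC' k
  rw [hu, div_le_iff₀ (hp k)] at this
  rw [inv_mul_le_iff₀ hC0]
  exact this

namespace IsWeightSeq

variable {M : ℕ → ℝ} {r : ℕ} {C₀ H : ℝ} {h : ℕ → ℝ}

theorem prod_quot_div (hM : IsWeightSeq M) (h : ℕ → ℝ) (k : ℕ) :
    ∏ j ∈ Finset.range k, quot M j / h j = M k / ∏ j ∈ Finset.range k, h j := by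
  rw [Finset.prod_div_distrib, hM.prod_quot]

theorem pow_le_logProd (hM : IsWeightSeq M) (hh : ∀ j, 0 < h j) {l : ℕ}
    (hP : ProdSeq l fun j => quot M j / h j) (k : ℕ) (x : ℝ) :
    |x| ^ (2 * l * k) ≤ (M k / ∏ j ∈ Finset.range k, h j) ^ (2 * l) *
      Real.exp (logProd l (fun j => quot M j / h j) x) := by
  have h1 := hP.prod_le_exp_logProd (Finset.range k) x
  set G := M k / ∏ j ∈ Finset.range k, h j with hG
  have hG0 : 0 < G := div_pos (hM.1 k) (Finset.prod_pos fun j _ => hh j)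
  rw [← div_le_iff₀' (by positivity)]
  refine le_trans ?_ h1
  have h2 : |x| ^ (2 * l * k) / G ^ (2 * l) =
      ∏ j ∈ Finset.range k, |x| ^ (2 * l) / (quot M j / h j) ^ (2 * l) := by
    rw [Finset.prod_div_distrib, Finset.prod_const, Finset.card_range, Finset.prod_pow,
      hM.prod_quot_div, pow_mul]
  rw [h2]
  refine Finset.prod_le_prod (fun j _ => ?_) fun j _ => ?_
  · have := hM.quot_pos j
    have := hh j
    positivity
  · rw [(even_two_mul l).pow_abs, ← div_pow]
    linarith

theorem exists_norm_iteratedDeriv_factorKernel_le (hM : IsWeightSeq M) (h2 : HasM2 M C₀ H)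
    (hh : ∀ j, 0 < h j) {l : ℕ} {C₁ C₂ : ℝ} (hG : GrowthSeq l (fun j => quot M j / h j) C₁ C₂)
    {T c : ℝ} (hT : 0 < T) (hc : 0 < c) (hTh : ∀ k, c * T ^ k ≤ ∏ j ∈ Finset.range k, h j)
    {n : ℝ} (hn : 0 ≤ n) :
    ∃ C, 0 ≤ C ∧ ∀ p t, (T / (2 * H)) ^ p *
      ‖iteratedDeriv p (factorKernel l fun j => quot M j / h j) t‖ ≤
        C * M p * Real.exp (-n * |t|) := by
  have hl := hG.l_pos
  obtain ⟨D, hD0, hD⟩ := hG.exists_norm_iteratedDeriv_factorKernel_le hn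
  obtain ⟨A, hA0, hA⟩ := hM.exists_pow_le (T / H)
  obtain ⟨B, hB0, hB⟩ := hM.exists_pow_le (T / H * n)
  have hC₀ := h2.1
  have hH := h2.2.1
  set q := 2 * l with hq
  have hq0 : 0 < q := by omega
  have hMq := hM.1 q
  set F := C₀ * H ^ q * M q * (c⁻¹) ^ q * (max 1 T⁻¹) ^ q with hF
  refine ⟨D * (A + B + F), by positivity, fun p t => ?_⟩
  have hMp := hM.1 p
  set k := p / q + 1 with hk
  have hpk : p ≤ q * k := by
    have := Nat.div_add_mod p q
    have := Nat.mod_lt p hq0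
    rw [hk, mul_add]; omega
  have hkp : q * k ≤ p + q := by
    rw [hk, mul_add, mul_one]
    exact Nat.add_le_add_right (Nat.mul_div_le p q) q
  have hHk : 0 < ∏ j ∈ Finset.range k, h j := Finset.prod_pos fun j _ => hh j
  set G := M k / ∏ j ∈ Finset.range k, h j with hGdef
  have hMk := hM.1 k
  have hG0 : 0 < G := div_pos hMk hHk
  have hGq : (T / H) ^ p * G ^ q ≤ F * M p := by
    have e1 : M k ^ q ≤ C₀ * H ^ (p + q) * M p * M q :=
      (hM.pow_le k q).trans ((hM.monotone hkp).trans (h2.2.2 p q))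
    have e2 : (T ^ (q * k))⁻¹ * T ^ p ≤ (max 1 T⁻¹) ^ q := by
      obtain ⟨i, hi⟩ := Nat.exists_eq_add_of_le hpk
      rw [hi, pow_add, mul_inv, mul_comm, ← mul_assoc, mul_inv_cancel₀ (by positivity), one_mul,
        ← inv_pow]
      calc T⁻¹ ^ i ≤ (max 1 T⁻¹) ^ i := by gcongr; exact le_max_right _ _
        _ ≤ _ := pow_le_pow_right₀ (le_max_left _ _) (by omega)
    calc (T / H) ^ p * G ^ q ≤ (T / H) ^ p * (M k / (c * T ^ k)) ^ q := by
          have : G ≤ M k / (c * T ^ k) := div_le_div_of_nonneg_left hMk.le (by positivity) (hTh k)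
          gcongr
      _ = (M k ^ q * (H ^ p)⁻¹ * (c⁻¹) ^ q) * ((T ^ (q * k))⁻¹ * T ^ p) := by
          rw [pow_mul' T q k]
          simp only [div_pow, mul_pow, inv_pow]
          field_simp
      _ ≤ (C₀ * H ^ (p + q) * M p * M q * (H ^ p)⁻¹ * (c⁻¹) ^ q) * (max 1 T⁻¹) ^ q := by gcongr
      _ = _ := by
          rw [hF, pow_add]
          field_simp
  have hS : ∀ x, (|x| + n) ^ p ≤ 2 ^ p * (1 + n ^ p + G ^ q) *
      Real.exp (logProd l (fun j => quot M j / h j) x) := by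
    intro x
    have e1 := hM.pow_le_logProd hh hG.toProdSeq k x
    rw [← hq] at e1
    set N := Real.exp (logProd l (fun j => quot M j / h j) x)
    have e2 : 1 ≤ N := Real.one_le_exp (ProdSeq.logProd_nonneg x)
    have e3 : |x| ^ p ≤ 1 + |x| ^ (q * k) := by
      rcases le_total |x| 1 with hx | hx
      · have := pow_le_one₀ (n := p) (abs_nonneg x) hx
        have : 0 ≤ |x| ^ (q * k) := by positivity
        linarith
      · have := pow_le_pow_right₀ hx hpk
        linarith
    calc (|x| + n) ^ p ≤ 2 ^ (p - 1) * (|x| ^ p + n ^ p) := add_pow_le (abs_nonneg x) hn p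
      _ ≤ 2 ^ p * (|x| ^ p + n ^ p) := by
          gcongr
          · norm_num
          · omega
      _ ≤ 2 ^ p * ((1 + G ^ q * N) + n ^ p) := by gcongr; linarith
      _ ≤ 2 ^ p * ((1 * N + G ^ q * N) + n ^ p * N) := by
          gcongr
          · linarith
          · exact le_mul_of_one_le_right (by positivity) e2
      _ = _ := by ring
  have hfin := hD p _ hS t
  calc _ ≤ (T / (2 * H)) ^ p * (D * (2 ^ p * (1 + n ^ p + G ^ q)) * Real.exp (-n * |t|)) := by
        gcongr
    _ = D * ((T / H) ^ p + (T / H * n) ^ p + (T / H) ^ p * G ^ q) * Real.exp (-n * |t|) := by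
        rw [mul_pow _ n, show T / (2 * H) = T / H / 2 by field_simp, div_pow (T / H)]
        field_simp
    _ ≤ D * (A * M p + B * M p + F * M p) * Real.exp (-n * |t|) := by
        gcongr
        · exact hA p
        · exact hB p
    _ = _ := by ring

end IsWeightSeq

theorem exists_bound_of_eventually_le {u : ℕ → ℝ} {K : ℝ} (h : ∀ᶠ p in atTop, u p ≤ K) :
    ∃ C, ∀ p, u p ≤ C := by
  have hb : IsBoundedUnder (· ≤ ·) atTop u := ⟨K, eventually_map.2 h⟩
  obtain ⟨C, hC⟩ := hb.bddAbove_range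
  exact ⟨C, fun p => hC ⟨p, rfl⟩⟩

namespace IsWeightSeq

variable {M : ℕ → ℝ}

theorem lineWeight_eq (hM : IsWeightSeq M) (l : ℕ) (h : ℕ → ℝ) (C₁ C₂ : ℝ) (k : ℕ) :
    lineWeight l (fun j => quot M j / h j) C₁ C₂ k =
      M k / (∏ j ∈ Finset.range k, h j) / (2 * lossRate l C₁ C₂) ^ k := by
  rw [lineWeight, hM.prod_quot_div]

theorem exists_beurling_factor (hM : IsWeightSeq M) (hM2 : M2 M) (h2s : M2star M)
    {a : ℕ → ℕ → ℝ} (ha0 : ∀ n p, 0 ≤ a n p)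
    (ha : ∀ n, ∀ ρ : ℕ, ∃ C, ∀ p, (ρ : ℝ) ^ p * a n p ≤ C * M p) :
    ∃ (l : ℕ) (μ : ℕ → ℝ) (C₁ C₂ : ℝ), GrowthSeq l μ C₁ C₂ ∧
      (∀ ρ, 0 < ρ → ∀ n, 0 ≤ n → ∃ C, 0 ≤ C ∧ ∀ p t,
        ρ ^ p * ‖iteratedDeriv p (factorKernel l μ) t‖ ≤ C * M p * Real.exp (-n * |t|)) ∧
      ∃ c : ℕ → ℕ → ℝ, (∀ n q, 0 ≤ c n q) ∧
        (∀ n q k, a n (q + k) ≤ c n q * lineWeight l μ C₁ C₂ k) ∧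
        ∀ n, ∀ ρ : ℝ, 0 ≤ ρ → ∃ C, ∀ q, ρ ^ q * c n q ≤ C * M q := by
  obtain ⟨r, hr, D, hD, hg⟩ := hM.exists_quot_growth h2s
  obtain ⟨C₁, C₂, hC⟩ := hM.exists_growthSeq hM2 hr hD hg
  obtain ⟨C₀, H, h2⟩ := hM2
  have hC₀ := h2.1
  have hH := h2.2.1
  obtain ⟨s, hs, hdiag⟩ := exists_diagonal_seq (A := fun n p => a n p / M p)
    (fun n p => div_nonneg (ha0 n p) (hM.1 p).le) fun n ρ => by
      obtain ⟨C, hC⟩ := ha n ρ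
      refine ⟨C, fun p => ?_⟩
      rw [div_mul_eq_mul_div, div_le_iff₀ (hM.1 p), mul_comm]
      exact hC p
  obtain ⟨h, hh, hht, hh1, hhs⟩ := exists_slowSeq hr hs
  have hG := hC h hh
  set L := lossRate (2 * r) C₁ C₂ with hLdef
  have hL : 1 ≤ L := hG.one_le_lossRate
  set μ := fun j => quot M j / h j with hμ
  have hlw : ∀ k, 0 < lineWeight (2 * r) μ C₁ C₂ k := fun k => by
    rw [hμ, hM.lineWeight_eq]
    have := hM.1 k
    have : 0 < ∏ j ∈ Finset.range k, h j := Finset.prod_pos fun j _ => hh.pos j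
    positivity
  have hkey : ∀ n, ∀ ρ : ℝ, 0 ≤ ρ → ∃ C, ∀ q k,
      ρ ^ q * (a n (q + k) / lineWeight (2 * r) μ C₁ C₂ k) ≤ C * M q := by
    intro n ρ hρ
    set R := H * max ρ (2 * L)
    have hR : 0 ≤ R := by positivity
    obtain ⟨K, hK⟩ := exists_bound_of_eventually_le ((hdiag n R hR).mono fun p hp =>
      hp (h p) (hh.pos p).le (hhs p))
    refine ⟨C₀ * K, fun q k => ?_⟩
    have hprod : ∏ j ∈ Finset.range k, h j ≤ h (q + k) ^ (q + k) := by
      calc _ ≤ ∏ j ∈ Finset.range k, h (q + k) :=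
            Finset.prod_le_prod (fun j _ => (hh.pos j).le) fun j hj =>
              hh.mono (by have := Finset.mem_range.1 hj; omega)
        _ = h (q + k) ^ k := by simp
        _ ≤ _ := pow_le_pow_right₀ (hh1 _) (by omega)
    have hHk : 0 < ∏ j ∈ Finset.range k, h j := Finset.prod_pos fun j _ => hh.pos j
    have hMk := hM.1 k
    have hMq := hM.1 q
    have hMqk := hM.1 (q + k)
    have ha' := ha0 n (q + k)
    have hhp := hh.pos (q + k)
    calc ρ ^ q * (a n (q + k) / lineWeight (2 * r) μ C₁ C₂ k)
        = ρ ^ q * (a n (q + k) / M (q + k)) * M (q + k) / M k *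
          (∏ j ∈ Finset.range k, h j) * (2 * L) ^ k := by
          rw [hμ, hM.lineWeight_eq, ← hLdef]
          field_simp
      _ ≤ max ρ (2 * L) ^ q * (a n (q + k) / M (q + k)) * (C₀ * H ^ (q + k) * M q * M k) / M k *
          h (q + k) ^ (q + k) * max ρ (2 * L) ^ k := by
          have h3 := h2.2.2 q k
          have h4 : ρ ^ q ≤ max ρ (2 * L) ^ q := pow_le_pow_left₀ hρ (le_max_left _ _) q
          have h5 : (2 * L) ^ k ≤ max ρ (2 * L) ^ k :=
            pow_le_pow_left₀ (by positivity) (le_max_right _ _) k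
          gcongr
      _ = C₀ * (a n (q + k) / M (q + k) * (R * h (q + k)) ^ (q + k)) * M q := by
          simp only [R, mul_pow, pow_add]
          field_simp
      _ ≤ _ := by
          gcongr
          exact hK (q + k)
  have hc0 : ∀ n q k, 0 ≤ a n (q + k) / lineWeight (2 * r) μ C₁ C₂ k := fun n q k =>
    div_nonneg (ha0 _ _) (hlw k).le
  refine ⟨2 * r, μ, C₁, C₂, hG, fun ρ hρ n hn => ?_,
    fun n q => ⨆ k, a n (q + k) / lineWeight (2 * r) μ C₁ C₂ k,
    fun n q => Real.iSup_nonneg (hc0 n q), fun n q k => ?_, fun n ρ hρ => ?_⟩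
  · obtain ⟨c, hc, hcT⟩ := exists_pow_le_prod hh.pos hht (T := 2 * H * ρ) (by positivity)
    obtain ⟨C, hC, hmain⟩ := hM.exists_norm_iteratedDeriv_factorKernel_le h2 hh.pos hG
      (by positivity) hc hcT hn
    have : 2 * H * ρ / (2 * H) = ρ := by field_simp
    rw [this] at hmain
    exact ⟨C, hC, hmain⟩
  · rw [← div_le_iff₀ (hlw k)]
    obtain ⟨C, hC⟩ := hkey n 1 zero_le_one
    refine le_ciSup (f := fun k => a n (q + k) / lineWeight (2 * r) μ C₁ C₂ k)
      ⟨C * M q, ?_⟩ k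
    rintro _ ⟨k, rfl⟩
    simpa using hC q k
  · obtain ⟨C, hC⟩ := hkey n ρ hρ
    refine ⟨C, fun q => ?_⟩
    rw [Real.mul_iSup_of_nonneg (by positivity)]
    exact ciSup_le (hC q)

theorem exists_roumieu_factor (hM : IsWeightSeq M) (hM2 : M2 M) (h2s : M2star M) {τ : ℝ}
    (hτ : 0 < τ) {a : ℕ → ℕ → ℝ} (ha : ∀ n, ∃ C, 0 ≤ C ∧ ∀ p, τ ^ p * a n p ≤ C * M p) :
    ∃ (l : ℕ) (μ : ℕ → ℝ) (C₁ C₂ : ℝ), GrowthSeq l μ C₁ C₂ ∧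
      (∃ ρ, 0 < ρ ∧ ∀ n, 0 ≤ n → ∃ C, 0 ≤ C ∧ ∀ p t,
        ρ ^ p * ‖iteratedDeriv p (factorKernel l μ) t‖ ≤ C * M p * Real.exp (-n * |t|)) ∧
      ∃ c : ℕ → ℕ → ℝ, (∀ n q, 0 ≤ c n q) ∧
        (∀ n q k, a n (q + k) ≤ c n q * lineWeight l μ C₁ C₂ k) ∧
        ∃ ρ, 0 < ρ ∧ ∀ n, ∃ C, ∀ q, ρ ^ q * c n q ≤ C * M q := by
  obtain ⟨r, hr, D, hD, hg⟩ := hM.exists_quot_growth h2s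
  obtain ⟨C₁, C₂, hC⟩ := hM.exists_growthSeq hM2 hr hD hg
  obtain ⟨C₀, H, h2⟩ := hM2
  have hC₀ := h2.1
  have hH := h2.2.1
  have hL : 1 ≤ lossRate (2 * r) C₁ C₂ :=
    (hC _ (SlowSeq.const r one_pos)).one_le_lossRate
  set L := lossRate (2 * r) C₁ C₂ with hLdef
  set h : ℕ → ℝ := fun _ => τ / (2 * L * H)
  have hpos : 0 < τ / (2 * L * H) := by positivity
  have hh : SlowSeq r h := SlowSeq.const r hpos
  have hG := hC h hh
  choose K hK0 hK using ha
  refine ⟨2 * r, _, C₁, C₂, hG, ⟨τ / (2 * L * H) / (2 * H), by positivity, fun n hn =>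
    hM.exists_norm_iteratedDeriv_factorKernel_le h2 hh.pos hG hpos one_pos (fun k => ?_) hn⟩,
    fun n q => K n * C₀ * (H / τ) ^ q * M q, fun n q => ?_, fun n q k => ?_,
    τ / H, by positivity, fun n => ⟨K n * C₀, fun q => ?_⟩⟩
  · simp [h, div_pow]
  · have := hM.1 q
    have := hK0 n
    positivity
  · rw [hM.lineWeight_eq, ← hLdef]
    have hMk := hM.1 k
    have hMq := hM.1 q
    have hKn := hK0 n
    have h3 := hK n (q + k)
    rw [← le_div_iff₀' (by positivity)] at h3
    calc _ ≤ _ := h3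
      _ ≤ K n * (C₀ * H ^ (q + k) * M q * M k) / τ ^ (q + k) := by
          gcongr
          exact h2.2.2 q k
      _ = _ := by
          simp only [h, Finset.prod_const, Finset.card_range, div_pow, mul_pow, pow_add]
          field_simp
  · have := hM.1 q
    refine le_of_eq ?_
    simp only [div_pow]
    field_simp

end IsWeightSeq

/-- Iterated convolution along coordinate directions as a single integral. -/
theorem foldr_convAlong_eq_integral {d : ℕ} {κ : ℝ} (hκ : 0 ≤ κ) {χ : Rd d → ℂ}
    (hχ : Continuous χ) {C : ℝ} (hb : ∀ x, ‖χ x‖ ≤ C * Real.exp (κ * ‖x‖)) :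
    ∀ (n : ℕ) (e : Fin n → Fin d) (ψ : Fin n → ℝ → ℂ), (∀ j, Continuous (ψ j)) →
      (∀ j, Integrable fun t => ‖ψ j t‖ * Real.exp (κ * |t|)) → ∀ x,
      (List.finRange n).foldr (fun j g => convAlong volume (ψ j) (lineMap (e j)) g) χ x =
        ∫ t : Fin n → ℝ, (∏ j, ψ j (t j)) * χ (x - ∑ j, lineMap (e j) (t j)) := by
  intro n
  induction n with
  | zero =>
    intro e ψ _ _ x
    simp [integral_unique, Measure.real, volume_pi]
  | succ n ih =>
    intro e ψ hψ hint x
    have hnorm : ∀ t : Fin (n + 1) → ℝ, Real.exp (κ * ‖∑ j, lineMap (e j) (t j)‖) ≤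
        ∏ j, Real.exp (κ * |t j|) := fun t => by
      rw [← Real.exp_sum, ← Finset.mul_sum]
      gcongr
      exact (norm_sum_le _ _).trans (le_of_eq (by simp [norm_lineMap]))
    have hcont : Continuous fun t : Fin (n + 1) → ℝ =>
        (∏ j, ψ j (t j)) * χ (x - ∑ j, lineMap (e j) (t j)) := by
      refine (continuous_finsetProd _ fun j _ => (hψ j).comp (continuous_apply j)).mul
        (hχ.comp (continuous_const.sub (continuous_finsetSum _ fun j _ => ?_)))
      exact continuous_lineMap.comp (continuous_apply j)
    have hI : Integrable fun t : Fin (n + 1) → ℝ =>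
        (∏ j, ψ j (t j)) * χ (x - ∑ j, lineMap (e j) (t j)) := by
      refine ((Integrable.fintype_prod hint).const_mul (C * Real.exp (κ * ‖x‖))).mono'
        hcont.aestronglyMeasurable (Eventually.of_forall fun t => ?_)
      have h1 := norm_comp_sub_le hκ hb x (∑ j, lineMap (e j) (t j))
      have hC : 0 ≤ C := by simpa using (norm_nonneg _).trans (hb 0)
      rw [norm_mul, norm_prod, Finset.prod_mul_distrib]
      calc _ ≤ (∏ j, ‖ψ j (t j)‖) * (C * Real.exp (κ * ‖x‖) *
            Real.exp (κ * ‖∑ j, lineMap (e j) (t j)‖)) := by gcongr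
        _ ≤ (∏ j, ‖ψ j (t j)‖) * (C * Real.exp (κ * ‖x‖) * ∏ j, Real.exp (κ * |t j|)) := by
            gcongr
            exact hnorm t
        _ = _ := by ring
    rw [List.finRange_succ, List.foldr_cons, List.foldr_map]
    have hmp := (volume_preserving_piFinSuccAbove (fun _ : Fin (n + 1) => ℝ) 0).symm
    rw [← hmp.integral_comp']
    have hI' := (hmp.integrable_comp_emb (MeasurableEquiv.measurableEmbedding _)).2 hI
    rw [Measure.volume_eq_prod] at hI' ⊢
    have hprod := integral_prod _ hI'
    simp only [Function.comp] at hprod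
    rw [hprod, convAlong]
    congr 1
    ext s
    rw [ih (fun j => e j.succ) (fun j => ψ j.succ) (fun j => hψ _) (fun j => hint _),
      ← integral_const_mul]
    congr 1
    ext t
    simp only [MeasurableEquiv.piFinSuccAbove_symm_apply, Fin.insertNthEquiv_apply,
      Fin.prod_univ_succ, Fin.sum_univ_succ, Fin.insertNth_zero, Fin.cons_zero, Fin.cons_succ,
      mul_assoc, sub_sub, cast_eq]

/-- Tensor product of functions on the line. -/
def tensor {d : ℕ} (ψ : Fin d → ℝ → ℂ) (x : Rd d) : ℂ := ∏ j, ψ j (x j)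

theorem sum_lineMap {d : ℕ} (x : Rd d) : ∑ j, lineMap j (x j) = x := by
  ext i
  simp [lineMap, Finset.sum_apply, Pi.single_apply]

theorem norm_le_sum_abs {d : ℕ} (x : Rd d) : ‖x‖ ≤ ∑ j, |x j| := by
  conv_lhs => rw [← sum_lineMap x]
  exact (norm_sum_le _ _).trans (le_of_eq (by simp [norm_lineMap]))

theorem convF_tensor {d : ℕ} {κ : ℝ} (hκ : 0 ≤ κ) {χ : Rd d → ℂ}
    (hχ : Continuous χ) {C : ℝ} (hb : ∀ x, ‖χ x‖ ≤ C * Real.exp (κ * ‖x‖))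
    {ψ : Fin d → ℝ → ℂ} (hψ : ∀ j, Continuous (ψ j))
    (hint : ∀ j, Integrable fun t => ‖ψ j t‖ * Real.exp (κ * |t|)) :
    convF (tensor ψ) χ =
      (List.finRange d).foldr (fun j g => convAlong volume (ψ j) (lineMap j) g) χ := by
  ext x
  have h := foldr_convAlong_eq_integral hκ hχ hb d id ψ hψ hint x
  simp only [id] at h
  rw [h, convF,
    ← (PiLp.volume_preserving_ofLp (Fin d)).integral_comp
      (MeasurableEquiv.toLp 2 (Fin d → ℝ)).symm.measurableEmbedding]
  congr 1
  ext t
  rw [tensor]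
  congr 2
  conv_lhs => rw [← sum_lineMap t]

theorem dop_tensor {d : ℕ} {ψ : Fin d → ℝ → ℂ} (hψ : ∀ j, Differentiable ℝ (ψ j)) (i : Fin d) :
    dop i (tensor ψ) = tensor (Function.update ψ i (deriv (ψ i))) := by
  ext x
  have h1 : HasFDerivAt (tensor ψ) (∑ j, (∏ k ∈ Finset.univ.erase j, ψ k (x k)) •
      ((EuclideanSpace.proj j : Rd d →L[ℝ] ℝ).smulRight (deriv (ψ j) (x j)))) x := by
    refine HasFDerivAt.finsetProd fun j _ => ?_
    have h2 : HasFDerivAt (fun y : Rd d => y j) (EuclideanSpace.proj j : Rd d →L[ℝ] ℝ) x :=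
      (EuclideanSpace.proj j : Rd d →L[ℝ] ℝ).hasFDerivAt
    exact ((hψ j (x j)).hasDerivAt.hasFDerivAt.comp x h2).congr_fderiv (by ext; simp)
  rw [dop, h1.fderiv, tensor, ← Finset.mul_prod_erase _ _ (Finset.mem_univ i)]
  simp only [sum_apply, smul_apply, ContinuousLinearMap.smulRight_apply, Function.update_self]
  rw [Finset.sum_eq_single i]
  · have : ∏ k ∈ Finset.univ.erase i, Function.update ψ i (deriv (ψ i)) k (x k) =
        ∏ k ∈ Finset.univ.erase i, ψ k (x k) :=
      Finset.prod_congr rfl fun k hk => by rw [Function.update_of_ne (Finset.ne_of_mem_erase hk)]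
    rw [this]
    simp [mul_comm]
  · intro j _ hj
    simp [hj]
  · simp

theorem wD_tensor {d : ℕ} {ψ : Fin d → ℝ → ℂ} (hψ : ∀ j, ContDiff ℝ (⊤ : ℕ∞) (ψ j))
    (L : List (Fin d)) : wD L (tensor ψ) = tensor fun j => iteratedDeriv (L.count j) (ψ j) := by
  induction L with
  | nil => simp [wD]
  | cons i L ih =>
    rw [wD_cons, ih, dop_tensor fun j => (hψ j).differentiable_iteratedDeriv _
      (by exact_mod_cast WithTop.coe_lt_top _)]
    congr 1
    ext j t
    rcases eq_or_ne j i with rfl | hj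
    · rw [Function.update_self, List.count_cons_self, iteratedDeriv_succ]
    · rw [Function.update_of_ne hj, List.count_cons_of_ne hj.symm]

theorem contDiff_tensor {d : ℕ} {ψ : Fin d → ℝ → ℂ} (hψ : ∀ j, ContDiff ℝ (⊤ : ℕ∞) (ψ j)) :
    ContDiff ℝ (⊤ : ℕ∞) (tensor ψ) := by
  refine contDiff_prod fun j _ => (hψ j).comp ?_
  exact (EuclideanSpace.proj j : Rd d →L[ℝ] ℝ).contDiff

/-- Smooth kernels on the line with derivatives controlled by `M p / ρ ^ p`, decaying faster than
any exponential. -/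
def LineKernel (M : ℕ → ℝ) (ρ : ℝ) (ψ : ℝ → ℂ) : Prop :=
  ContDiff ℝ (⊤ : ℕ∞) ψ ∧ ∀ n, 0 ≤ n → ∃ C, 0 ≤ C ∧ ∀ p t,
    ρ ^ p * ‖iteratedDeriv p ψ t‖ ≤ C * M p * Real.exp (-n * |t|)

namespace LineKernel

variable {M : ℕ → ℝ} {ρ : ℝ}

theorem mono {ρ' : ℝ} {ψ : ℝ → ℂ} (h : LineKernel M ρ ψ) (h0 : 0 ≤ ρ') (hρ : ρ' ≤ ρ) :
    LineKernel M ρ' ψ := by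
  refine ⟨h.1, fun n hn => ?_⟩
  obtain ⟨C, hC, hb⟩ := h.2 n hn
  refine ⟨C, hC, fun p t => le_trans ?_ (hb p t)⟩
  gcongr

theorem integrable {ψ : ℝ → ℂ} (h : LineKernel M ρ ψ) {κ : ℝ} (hκ : 0 ≤ κ) :
    Integrable fun t => ‖ψ t‖ * Real.exp (κ * |t|) := by
  obtain ⟨C, hC, hb⟩ := h.2 (κ + 1) (by linarith)
  refine ((integrable_exp_neg_mul_abs one_pos).const_mul (C * M 0)).mono' ?_
    (Eventually.of_forall fun t => ?_)
  · have := h.1.continuous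
    exact (by fun_prop : Continuous fun t => ‖ψ t‖ * Real.exp (κ * |t|)).aestronglyMeasurable
  · have := hb 0 t
    simp only [pow_zero, one_mul, iteratedDeriv_zero] at this
    rw [Real.norm_of_nonneg (by positivity)]
    calc _ ≤ C * M 0 * Real.exp (-(κ + 1) * |t|) * Real.exp (κ * |t|) := by gcongr
      _ = _ := by
        rw [mul_assoc, ← Real.exp_add]
        ring_nf

theorem tensor_bound (hM : IsWeightSeq M) (hρ : 0 ≤ ρ) {d : ℕ} {ψ : Fin d → ℝ → ℂ}
    (h : ∀ j, LineKernel M ρ (ψ j)) (n : ℕ) : ∃ C : ℝ, ∀ (α : Fin d → ℕ) (x : Rd d),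
      ρ ^ msize α * ‖pD α (tensor ψ) x‖ * Real.exp ((n : ℝ) * ‖x‖) ≤ C * M (msize α) := by
  choose C hC0 hC using fun j => (h j).2 n (Nat.cast_nonneg n)
  refine ⟨∏ j, C j, fun α x => ?_⟩
  rw [pD_eq_wD, wD_tensor fun j => (h j).1]
  simp only [count_multiWord, tensor, norm_prod]
  have h1 : Real.exp ((n : ℝ) * ‖x‖) ≤ ∏ j, Real.exp (n * |x j|) := by
    rw [← Real.exp_sum, ← Finset.mul_sum]
    gcongr
    exact norm_le_sum_abs x
  calc _ ≤ (∏ j, ρ ^ α j) * (∏ j, ‖iteratedDeriv (α j) (ψ j) (x j)‖) *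
        ∏ j, Real.exp (n * |x j|) := by
        rw [msize, ← Finset.prod_pow_eq_pow_sum]
        have : 0 ≤ ∏ j, ρ ^ α j := Finset.prod_nonneg fun j _ => by positivity
        gcongr
    _ = ∏ j, ρ ^ α j * ‖iteratedDeriv (α j) (ψ j) (x j)‖ * Real.exp (n * |x j|) := by
        rw [Finset.prod_mul_distrib, Finset.prod_mul_distrib]
    _ ≤ ∏ j, C j * M (α j) := by
        refine Finset.prod_le_prod (fun j _ => by positivity) fun j _ => ?_
        calc _ ≤ C j * M (α j) * Real.exp (-n * |x j|) * Real.exp (n * |x j|) := by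
              exact mul_le_mul_of_nonneg_right (hC j _ _) (Real.exp_nonneg _)
          _ = _ := by rw [mul_assoc, ← Real.exp_add]; simp
    _ = (∏ j, C j) * ∏ j, M (α j) := Finset.prod_mul_distrib
    _ ≤ _ := by
        gcongr
        · exact Finset.prod_nonneg fun j _ => hC0 j
        · exact hM.prod_le _ _

theorem kBeu_tensor (hM : IsWeightSeq M) {d : ℕ} {ψ : Fin d → ℝ → ℂ}
    (h : ∀ j, ∀ ρ, 0 < ρ → LineKernel M ρ (ψ j)) : KBeu d M (tensor ψ) :=
  ⟨contDiff_tensor fun j => (h j 1 one_pos).1, fun k hk n =>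
    tensor_bound hM hk.le (fun j => h j k hk) n⟩

theorem kRou_tensor (hM : IsWeightSeq M) {d : ℕ} {ψ : Fin d → ℝ → ℂ}
    (h : ∀ j, ∃ ρ, 0 < ρ ∧ LineKernel M ρ (ψ j)) : KRou d M (tensor ψ) := by
  choose ρ hρ h using h
  obtain ⟨k, hk⟩ := Finite.exists_ge fun j => (⟨ρ j, hρ j⟩ : {x : ℝ // 0 < x})
  exact ⟨contDiff_tensor fun j => (h j).1, k, k.2, fun n =>
    tensor_bound hM k.2.le (fun j => (h j).mono k.2.le (hk j)) n⟩

end LineKernel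

/-- Composing one-directional factorizations. -/
theorem exists_foldr_factorization {d : ℕ} {P : Set (Rd d → ℂ) → Prop} {Q : (ℝ → ℂ) → Prop}
    (step : ∀ B, P B → ∀ i, ∃ ψ, ∃ T : (Rd d → ℂ) → Rd d → ℂ, Q ψ ∧ P (T '' B) ∧
      ∀ φ ∈ B, convAlong volume ψ (lineMap i) (T φ) = φ) (ψ₀ : Fin d → ℝ → ℂ) :
    ∀ L : List (Fin d), L.Nodup → ∀ B, P B → ∃ ψ : Fin d → ℝ → ℂ,
      ∃ T : (Rd d → ℂ) → Rd d → ℂ, (∀ i ∈ L, Q (ψ i)) ∧ P (T '' B) ∧ ∀ φ ∈ B,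
        L.foldr (fun i g => convAlong volume (ψ i) (lineMap i) g) (T φ) = φ := by
  intro L
  induction L with
  | nil => exact fun _ B hB => ⟨ψ₀, id, by simp, by simpa using hB, fun φ _ => rfl⟩
  | cons i L ih =>
    intro hL B hB
    rw [List.nodup_cons] at hL
    obtain ⟨ψ', T', hQ', hP', hT'⟩ := step B hB i
    obtain ⟨ψ, T, hQ, hP, hT⟩ := ih hL.2 _ hP'
    have hne : ∀ j ∈ L, j ≠ i := fun j hj h => hL.1 (h ▸ hj)
    refine ⟨Function.update ψ i ψ', T ∘ T', fun j hj => ?_, by rwa [Set.image_comp],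
      fun φ hφ => ?_⟩
    · rcases List.mem_cons.1 hj with rfl | hj
      · rwa [Function.update_self]
      · rw [Function.update_of_ne (hne j hj)]
        exact hQ j hj
    · have h1 : L.foldr (fun j g => convAlong volume (Function.update ψ i ψ' j) (lineMap j) g)
          (T (T' φ)) = L.foldr (fun j g => convAlong volume (ψ j) (lineMap j) g) (T (T' φ)) :=
        List.foldr_ext _ _ _ fun j hj _ => by rw [Function.update_of_ne (hne j hj)]
      rw [List.foldr_cons, Function.comp, h1, hT _ ⟨φ, hφ, rfl⟩, Function.update_self]
      exact hT' φ hφ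

theorem BBeuWBdd.exists_wD_le {d : ℕ} {M : ℕ → ℝ} {w : ℕ → Rd d → ℝ} {B : Set (Rd d → ℂ)}
    (hM : IsWeightSeq M) (hw : IncWS d w) (hB : BBeuWBdd d M w B) (n ρ : ℕ) :
    ∃ C, 0 ≤ C ∧ ∀ φ ∈ B, ∀ L x,
      (ρ : ℝ) ^ L.length * ‖wD L φ x‖ * w n x ≤ C * M L.length := by
  obtain ⟨C, hC⟩ := hB.2 (max n ρ)
  refine ⟨|C|, abs_nonneg C, fun φ hφ => (forall_pD_iff_forall_wD (hB.1 φ hφ).1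
    fun k f => ∀ x, (ρ : ℝ) ^ k * ‖f x‖ * w n x ≤ |C| * M k).1 fun α x => ?_⟩
  have h1 : (ρ : ℝ) ≤ (max n ρ : ℕ) := by exact_mod_cast le_max_right n ρ
  have h2 := hw.2.2.1 n (max n ρ) (le_max_left n ρ) x
  have h3 := hw.1 n x
  have h4 := hM.1 (msize α)
  calc _ ≤ ((max n ρ : ℕ) : ℝ) ^ msize α * ‖pD α φ x‖ * w (max n ρ) x := by gcongr
    _ ≤ C * M (msize α) := hC φ hφ α x
    _ ≤ _ := by gcongr; exact le_abs_self C

theorem BhWBdd.exists_wD_le {d : ℕ} {M : ℕ → ℝ} {h : ℝ} {w : ℕ → Rd d → ℝ} {B : Set (Rd d → ℂ)}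
    (hM : IsWeightSeq M) (hB : BhWBdd d M h w B) (n : ℕ) :
    ∃ C, 0 ≤ C ∧ ∀ φ ∈ B, ∀ L x, h ^ L.length * ‖wD L φ x‖ * w n x ≤ C * M L.length := by
  obtain ⟨C, hC⟩ := hB.2 n
  refine ⟨|C|, abs_nonneg C, fun φ hφ => (forall_pD_iff_forall_wD (hB.1 φ hφ).1
    fun k f => ∀ x, h ^ k * ‖f x‖ * w n x ≤ |C| * M k).1 fun α x => (hC φ hφ α x).trans ?_⟩
  have h4 := hM.1 (msize α)
  gcongr
  exact le_abs_self C

theorem BBeuWBdd.of_wD {d : ℕ} {M : ℕ → ℝ} {w : ℕ → Rd d → ℝ} {B : Set (Rd d → ℂ)}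
    (hs : ∀ φ ∈ B, ContDiff ℝ (⊤ : ℕ∞) φ) (h : ∀ n : ℕ, ∃ C, ∀ φ ∈ B, ∀ L x,
      (n : ℝ) ^ L.length * ‖wD L φ x‖ * w n x ≤ C * M L.length) : BBeuWBdd d M w B := by
  have key : ∀ n : ℕ, ∃ C, ∀ φ ∈ B, ∀ α x,
      (n : ℝ) ^ msize α * ‖pD α φ x‖ * w n x ≤ C * M (msize α) := fun n => by
    obtain ⟨C, hC⟩ := h n
    exact ⟨C, fun φ hφ => (forall_pD_iff_forall_wD (hs φ hφ)
      fun k f => ∀ x, (n : ℝ) ^ k * ‖f x‖ * w n x ≤ C * M k).2 (hC φ hφ)⟩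
  exact ⟨fun φ hφ => ⟨hs φ hφ, fun n => (key n).imp fun C hC => hC φ hφ⟩, key⟩

theorem BhWBdd.of_wD {d : ℕ} {M : ℕ → ℝ} {r : ℝ} {w : ℕ → Rd d → ℝ} {B : Set (Rd d → ℂ)}
    (hs : ∀ φ ∈ B, ContDiff ℝ (⊤ : ℕ∞) φ) (h : ∀ n : ℕ, ∃ C, ∀ φ ∈ B, ∀ L x,
      r ^ L.length * ‖wD L φ x‖ * w n x ≤ C * M L.length) : BhWBdd d M r w B := by
  have key : ∀ n : ℕ, ∃ C, ∀ φ ∈ B, ∀ α x,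
      r ^ msize α * ‖pD α φ x‖ * w n x ≤ C * M (msize α) := fun n => by
    obtain ⟨C, hC⟩ := h n
    exact ⟨C, fun φ hφ => (forall_pD_iff_forall_wD (hs φ hφ)
      fun k f => ∀ x, r ^ k * ‖f x‖ * w n x ≤ C * M k).2 (hC φ hφ)⟩
  exact ⟨fun φ hφ => ⟨hs φ hφ, fun n => (key n).imp fun C hC => hC φ hφ⟩, key⟩

theorem BBeuWBdd.exists_line_factor {d : ℕ} {M : ℕ → ℝ} {w : ℕ → Rd d → ℝ}
    (hM : IsWeightSeq M) (hM2 : M2 M) (h2s : M2star M) (hw : IncWS d w) (B : Set (Rd d → ℂ))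
    (hB : BBeuWBdd d M w B) (i : Fin d) : ∃ ψ, ∃ T : (Rd d → ℂ) → Rd d → ℂ,
      (∀ ρ, 0 < ρ → LineKernel M ρ ψ) ∧ BBeuWBdd d M w (T '' B) ∧
        ∀ φ ∈ B, convAlong volume ψ (lineMap i) (T φ) = φ := by
  choose C hC0 hC using hB.exists_wD_le hM hw
  set a : ℕ → ℕ → ℝ := fun n p => ⨅ ρ : ℕ, C n (ρ + 1) * M p / ((ρ + 1 : ℕ) : ℝ) ^ p with ha
  have hnn : ∀ n p (ρ : ℕ), 0 ≤ C n (ρ + 1) * M p / ((ρ + 1 : ℕ) : ℝ) ^ p := fun n p ρ => by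
    have := (hM.1 p).le
    have := hC0 n (ρ + 1)
    positivity
  have hbdd : ∀ n p, BddBelow (Set.range fun ρ : ℕ =>
      C n (ρ + 1) * M p / ((ρ + 1 : ℕ) : ℝ) ^ p) := fun n p =>
    ⟨0, by rintro _ ⟨ρ, rfl⟩; exact hnn n p ρ⟩
  have ha0 : ∀ n p, 0 ≤ a n p := fun n p => le_ciInf (hnn n p)
  have haM : ∀ n, ∀ ρ : ℕ, ∃ C, ∀ p, (ρ : ℝ) ^ p * a n p ≤ C * M p := fun n ρ => by
    refine ⟨C n (ρ + 1), fun p => ?_⟩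
    have h1 : a n p ≤ C n (ρ + 1) * M p / ((ρ + 1 : ℕ) : ℝ) ^ p := ciInf_le (hbdd n p) ρ
    have h2 : (0 : ℝ) < ((ρ + 1 : ℕ) : ℝ) ^ p := by positivity
    rw [le_div_iff₀ h2] at h1
    refine le_trans ?_ h1
    rw [mul_comm]
    have := ha0 n p
    gcongr
    simp
  have hfa : ∀ n, ∀ φ ∈ B, ∀ L x, ‖wD L φ x‖ * w n x ≤ a n L.length := fun n φ hφ L x => by
    refine le_ciInf fun ρ => ?_
    have h2 : (0 : ℝ) < ((ρ + 1 : ℕ) : ℝ) ^ L.length := by positivity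
    rw [le_div_iff₀ h2]
    refine le_trans (le_of_eq ?_) (hC n (ρ + 1) φ hφ L x)
    ring
  obtain ⟨l, μ, C₁, C₂, hG, hK, c, hc0, hac, hcM⟩ := hM.exists_beurling_factor hM2 h2s ha0 haM
  obtain ⟨h1, h2⟩ := hG.exists_invOp_weighted hw i (fun φ hφ => (hB.1 φ hφ).1) hc0
    (fun n φ hφ L k x => (hfa n φ hφ _ x).trans <| by
      simpa [add_comm] using hac n L.length k)
  refine ⟨factorKernel l μ, invOp i l μ, fun ρ hρ => ⟨hG.contDiff_factorKernel, hK ρ hρ⟩,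
    BBeuWBdd.of_wD ?_ fun n => ?_, fun φ hφ => (h1 φ hφ).2⟩
  · rintro _ ⟨φ, hφ, rfl⟩
    exact (h1 φ hφ).1
  · obtain ⟨m, D, hD0, hD⟩ := h2 n
    obtain ⟨E, hE⟩ := hcM m n (Nat.cast_nonneg n)
    refine ⟨D * E, ?_⟩
    rintro _ ⟨φ, hφ, rfl⟩ L x
    calc _ = (n : ℝ) ^ L.length * (‖wD L (invOp i l μ φ) x‖ * w n x) := by ring
      _ ≤ (n : ℝ) ^ L.length * (D * c m L.length) := by
        exact mul_le_mul_of_nonneg_left (hD φ hφ L x) (by positivity)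
      _ = D * ((n : ℝ) ^ L.length * c m L.length) := by ring
      _ ≤ D * (E * M L.length) := by
        exact mul_le_mul_of_nonneg_left (hE _) hD0
      _ = _ := by ring

theorem BhWBdd.exists_line_factor {d : ℕ} {M : ℕ → ℝ} {w : ℕ → Rd d → ℝ}
    (hM : IsWeightSeq M) (hM2 : M2 M) (h2s : M2star M) (hw : IncWS d w) (B : Set (Rd d → ℂ))
    (hB : ∃ τ, 0 < τ ∧ BhWBdd d M τ w B) (i : Fin d) : ∃ ψ, ∃ T : (Rd d → ℂ) → Rd d → ℂ,
      (∃ ρ, 0 < ρ ∧ LineKernel M ρ ψ) ∧ (∃ τ, 0 < τ ∧ BhWBdd d M τ w (T '' B)) ∧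
        ∀ φ ∈ B, convAlong volume ψ (lineMap i) (T φ) = φ := by
  obtain ⟨τ, hτ, hB⟩ := hB
  choose C hC0 hC using hB.exists_wD_le hM
  have haM : ∀ n, ∃ D, 0 ≤ D ∧ ∀ p, τ ^ p * (C n * M p / τ ^ p) ≤ D * M p := fun n =>
    ⟨C n, hC0 n, fun p => le_of_eq <| by field_simp⟩
  have hfa : ∀ n, ∀ φ ∈ B, ∀ L x, ‖wD L φ x‖ * w n x ≤ C n * M L.length / τ ^ L.length :=
    fun n φ hφ L x => by
      rw [le_div_iff₀ (by positivity)]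
      refine le_trans (le_of_eq ?_) (hC n φ hφ L x)
      ring
  obtain ⟨l, μ, C₁, C₂, hG, ⟨ρ, hρ, hK⟩, c, hc0, hac, σ, hσ, hcM⟩ :=
    hM.exists_roumieu_factor hM2 h2s hτ haM
  obtain ⟨h1, h2⟩ := hG.exists_invOp_weighted hw i (fun φ hφ => (hB.1 φ hφ).1) hc0
    (fun n φ hφ L k x => (hfa n φ hφ _ x).trans <| by
      simpa [add_comm] using hac n L.length k)
  refine ⟨factorKernel l μ, invOp i l μ, ⟨ρ, hρ, hG.contDiff_factorKernel, hK⟩,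
    ⟨σ, hσ, BhWBdd.of_wD ?_ fun n => ?_⟩, fun φ hφ => (h1 φ hφ).2⟩
  · rintro _ ⟨φ, hφ, rfl⟩
    exact (h1 φ hφ).1
  · obtain ⟨m, D, hD0, hD⟩ := h2 n
    obtain ⟨E, hE⟩ := hcM m
    refine ⟨D * E, ?_⟩
    rintro _ ⟨φ, hφ, rfl⟩ L x
    calc _ = σ ^ L.length * (‖wD L (invOp i l μ φ) x‖ * w n x) := by ring
      _ ≤ σ ^ L.length * (D * c m L.length) := by
        exact mul_le_mul_of_nonneg_left (hD φ hφ L x) (by positivity)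
      _ = D * (σ ^ L.length * c m L.length) := by ring
      _ ≤ D * (E * M L.length) := by
        exact mul_le_mul_of_nonneg_left (hE _) hD0
      _ = _ := by ring

section Factorization

variable {d : ℕ} {M : ℕ → ℝ} {w : ℕ → Rd d → ℝ}

theorem BBeuWBdd.bhWBdd (hM : IsWeightSeq M) (hw : IncWS d w) {B : Set (Rd d → ℂ)}
    (hB : BBeuWBdd d M w B) (ρ : ℕ) : BhWBdd d M ρ w B :=
  BhWBdd.of_wD (fun φ hφ => (hB.1 φ hφ).1) fun n => by
    obtain ⟨C, -, hC⟩ := hB.exists_wD_le hM hw n ρ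
    exact ⟨C, hC⟩

theorem BhWBdd.singleton {h : ℝ} {φ : Rd d → ℂ} (hφ : BhW d M h w φ) :
    BhWBdd d M h w {φ} :=
  ⟨by rintro _ rfl; exact hφ, fun n => (hφ.2 n).imp fun C hC => by rintro _ rfl; exact hC⟩

theorem BBeuWBdd.singleton {φ : Rd d → ℂ} (hφ : BBeuW d M w φ) : BBeuWBdd d M w {φ} :=
  ⟨by rintro _ rfl; exact hφ, fun n => (hφ.2 n).imp fun C hC => by rintro _ rfl; exact hC⟩

theorem BBeuW.bhW (hM : IsWeightSeq M) (hw : IncWS d w) {φ : Rd d → ℂ}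
    (hφ : BBeuW d M w φ) (ρ : ℕ) : BhW d M ρ w φ :=
  ((BBeuWBdd.singleton hφ).bhWBdd hM hw ρ).1 φ rfl

theorem IncWS.exists_expGrowth (hw : IncWS d w) (hM : IsWeightSeq M) : ∃ κ, 0 ≤ κ ∧
    ∀ h, 0 < h → ∀ φ, BhW d M h w φ → φ ∈ expGrowth d κ := by
  obtain ⟨m, κ, C, hκ, hC, h1⟩ := hw.exists_one_le
  refine ⟨κ, hκ, fun h hh φ hφ => ⟨hφ.1, fun L => ?_⟩⟩
  obtain ⟨D, hD0, hD⟩ := (BhWBdd.singleton hφ).exists_wD_le hM m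
  refine ⟨D * M L.length / h ^ L.length * C, fun x => ?_⟩
  have h2 : ‖wD L φ x‖ * w m x ≤ D * M L.length / h ^ L.length := by
    rw [le_div_iff₀ (by positivity)]
    refine le_trans (le_of_eq ?_) (hD φ rfl L x)
    ring
  calc ‖wD L φ x‖ = ‖wD L φ x‖ * 1 := (mul_one _).symm
    _ ≤ ‖wD L φ x‖ * (C * w m x * Real.exp (κ * ‖x‖)) := by
      gcongr
      exact h1 x
    _ = (‖wD L φ x‖ * w m x) * C * Real.exp (κ * ‖x‖) := by ring
    _ ≤ _ := by gcongr

theorem integrable_exp_neg_norm (d : ℕ) : Integrable fun t : Rd d => Real.exp (-‖t‖) := by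
  have h := (integrable_one_add_norm (E := Rd d) (μ := volume) (r := d + 1) (by simp)).const_mul
    ((d + 1).factorial * Real.exp 1)
  refine h.mono' (by fun_prop) (Eventually.of_forall fun t => ?_)
  have h0 : 0 < 1 + ‖t‖ := by positivity
  have h1 := Real.pow_div_factorial_le_exp (1 + ‖t‖) h0.le (d + 1)
  rw [div_le_iff₀ (by positivity), Real.exp_add] at h1
  rw [Real.norm_of_nonneg (Real.exp_nonneg _), Real.rpow_neg h0.le, Real.exp_neg,
    inv_le_iff_one_le_mul₀ (Real.exp_pos _)]
  have h2 : (1 + ‖t‖) ^ ((d : ℝ) + 1) = (1 + ‖t‖) ^ (d + 1) := by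
    rw [← Real.rpow_natCast]
    simp
  rw [h2, mul_assoc, mul_comm, mul_assoc, inv_mul_eq_div, one_le_div (by positivity)]
  linarith

theorem integrable_norm_mul_exp {ψ : Rd d → ℂ} (hc : Continuous ψ)
    (hb : ∀ n : ℕ, ∃ C, ∀ x, ‖ψ x‖ * Real.exp (n * ‖x‖) ≤ C) (κ : ℝ) :
    Integrable fun t => ‖ψ t‖ * Real.exp (κ * ‖t‖) := by
  obtain ⟨n, hn⟩ := exists_nat_ge (κ + 1)
  obtain ⟨C, hC⟩ := hb n
  refine ((integrable_exp_neg_norm d).const_mul C).mono'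
    (by fun_prop : Continuous fun t => ‖ψ t‖ * Real.exp (κ * ‖t‖)).aestronglyMeasurable
    (Eventually.of_forall fun t => ?_)
  rw [Real.norm_of_nonneg (by positivity)]
  calc _ ≤ ‖ψ t‖ * (Real.exp (n * ‖t‖) * Real.exp (-‖t‖)) := by
        rw [← Real.exp_add]
        gcongr
        nlinarith [norm_nonneg t]
    _ = (‖ψ t‖ * Real.exp (n * ‖t‖)) * Real.exp (-‖t‖) := by ring
    _ ≤ _ := by
        gcongr
        exact hC t

/-- Convolution with a rapidly decaying kernel preserves `ℬ^{M,h}_𝒲`. -/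
theorem BhW.convF (hM : IsWeightSeq M) (hw : IncWS d w) {ψ : Rd d → ℂ} (hc : Continuous ψ)
    (hb : ∀ n : ℕ, ∃ C, ∀ x, ‖ψ x‖ * Real.exp (n * ‖x‖) ≤ C) {h : ℝ} (hh : 0 < h)
    {φ : Rd d → ℂ} (hφ : BhW d M h w φ) : BhW d M h w (convF ψ φ) := by
  obtain ⟨κ, hκ, hexp⟩ := hw.exists_expGrowth hM
  obtain ⟨h1, h2⟩ := contDiff_convAlong (ν := volume) (ℓ := id) hκ hc.aestronglyMeasurable
    aestronglyMeasurable_id (integrable_norm_mul_exp hc hb κ) (hexp h hh φ hφ)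
  change BhW d M h w (convAlong volume ψ id φ)
  refine (BhWBdd.of_wD (B := {convAlong volume ψ id φ}) (by rintro _ rfl; exact h1)
    fun n => ?_).1 _ rfl
  obtain ⟨m, κ', C, hκ', hC, hmn⟩ := hw.exists_sub_le n
  obtain ⟨D, hD0, hD⟩ := (BhWBdd.singleton hφ).exists_wD_le hM m
  have hint := integrable_norm_mul_exp hc hb κ'
  refine ⟨C * D * ∫ t, ‖ψ t‖ * Real.exp (κ' * ‖t‖), ?_⟩
  rintro _ rfl L x
  rw [h2 L]
  have hMp := hM.1 L.length
  have h3 : ‖h ^ L.length • w n x • convAlong volume ψ id (wD L φ) x‖ ≤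
      ∫ t, C * D * M L.length * (‖ψ t‖ * Real.exp (κ' * ‖t‖)) := by
    rw [convAlong, ← integral_smul, ← integral_smul]
    refine norm_integral_le_of_norm_le (hint.const_mul _) (Eventually.of_forall fun t => ?_)
    have := hw.1 n x
    have := hw.1 m (x - t)
    rw [norm_smul, norm_smul, norm_mul, Real.norm_of_nonneg (by positivity),
      Real.norm_of_nonneg (hw.1 n x).le]
    calc _ ≤ h ^ L.length * ((C * w m (x - t) * Real.exp (κ' * ‖t‖)) *
          (‖ψ t‖ * ‖wD L φ (x - t)‖)) := by
          gcongr
          · exact hmn x t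
          · exact le_rfl
      _ = C * (‖ψ t‖ * Real.exp (κ' * ‖t‖)) *
          (h ^ L.length * ‖wD L φ (x - t)‖ * w m (x - t)) := by ring
      _ ≤ C * (‖ψ t‖ * Real.exp (κ' * ‖t‖)) * (D * M L.length) := by
          exact mul_le_mul_of_nonneg_left (hD φ rfl L (x - t)) (by positivity)
      _ = _ := by ring
  rw [integral_const_mul, norm_smul, norm_smul, Real.norm_of_nonneg (by positivity),
    Real.norm_of_nonneg (hw.1 n x).le] at h3
  refine le_trans (le_of_eq ?_) (h3.trans_eq ?_) <;> ring

theorem KBeu.exists_norm_mul_exp_le {ψ : Rd d → ℂ} (h : KBeu d M ψ) (n : ℕ) :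
    ∃ C, ∀ x, ‖ψ x‖ * Real.exp (n * ‖x‖) ≤ C := by
  obtain ⟨C, hC⟩ := h.2 1 one_pos n
  refine ⟨C * M 0, fun x => ?_⟩
  simpa [msize, pD] using hC 0 x

theorem KRou.exists_norm_mul_exp_le {ψ : Rd d → ℂ} (h : KRou d M ψ) (n : ℕ) :
    ∃ C, ∀ x, ‖ψ x‖ * Real.exp (n * ‖x‖) ≤ C := by
  obtain ⟨k, -, hk⟩ := h.2
  obtain ⟨C, hC⟩ := hk n
  refine ⟨C * M 0, fun x => ?_⟩
  simpa [msize, pD] using hC 0 x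

theorem convF_tensor_image (hM : IsWeightSeq M) (hw : IncWS d w) {B : Set (Rd d → ℂ)}
    {ψ : Fin d → ℝ → ℂ} {T : (Rd d → ℂ) → Rd d → ℂ}
    (hψ : ∀ j, ∃ ρ, LineKernel M ρ (ψ j)) {h : ℝ} (hh : 0 < h) (hT : BhWBdd d M h w (T '' B))
    (hTB : ∀ φ ∈ B, (List.finRange d).foldr
      (fun i g => convAlong volume (ψ i) (lineMap i) g) (T φ) = φ) :
    (fun χ => convF (tensor ψ) χ) '' (T '' B) = B := by
  obtain ⟨κ, hκ, hexp⟩ := hw.exists_expGrowth hM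
  choose ρ hρ using hψ
  have key : ∀ φ ∈ B, convF (tensor ψ) (T φ) = φ := fun φ hφ => by
    obtain ⟨h1, h2⟩ := hexp h hh _ (hT.1 _ ⟨φ, hφ, rfl⟩)
    obtain ⟨C, hC⟩ := h2 []
    rw [convF_tensor hκ h1.continuous hC (fun j => (hρ j).1.continuous)
      fun j => (hρ j).integrable hκ]
    exact hTB φ hφ
  rw [Set.image_image]
  exact (Set.image_congr key).trans (Set.image_id' B)

theorem BBeuWBdd.exists_factorization (hM : IsWeightSeq M) (hM2 : M2 M) (h2s : M2star M)
    (hw : IncWS d w) (B : Set (Rd d → ℂ)) (hB : BBeuWBdd d M w B) : ∃ ψ, KBeu d M ψ ∧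
      ∃ A : Set (Rd d → ℂ), BBeuWBdd d M w A ∧ (fun χ => convF ψ χ) '' A = B := by
  obtain ⟨ψ, T, hψ, hT, hTB⟩ := exists_foldr_factorization
    (fun B hB i => hB.exists_line_factor hM hM2 h2s hw B i) (fun _ _ => 0) (List.finRange d)
    (List.nodup_finRange d) B hB
  have hψ' := fun j => hψ j (List.mem_finRange j)
  refine ⟨tensor ψ, LineKernel.kBeu_tensor hM hψ', T '' B, hT,
    convF_tensor_image hM hw (fun j => ⟨1, hψ' j 1 one_pos⟩) (h := (1 : ℕ)) (by simp)
      (hT.bhWBdd hM hw 1) hTB⟩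

theorem BhWBdd.exists_factorization (hM : IsWeightSeq M) (hM2 : M2 M) (h2s : M2star M)
    (hw : IncWS d w) {h : ℝ} (hh : 0 < h) (B : Set (Rd d → ℂ)) (hB : BhWBdd d M h w B) :
    ∃ ψ, KRou d M ψ ∧ ∃ k : ℝ, 0 < k ∧
      ∃ A : Set (Rd d → ℂ), BhWBdd d M k w A ∧ (fun χ => convF ψ χ) '' A = B := by
  obtain ⟨ψ, T, hψ, ⟨k, hk, hT⟩, hTB⟩ := exists_foldr_factorization
    (BhWBdd.exists_line_factor hM hM2 h2s hw) (fun _ _ => 0) (List.finRange d)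
    (List.nodup_finRange d) B ⟨h, hh, hB⟩
  have hψ' := fun j => hψ j (List.mem_finRange j)
  exact ⟨tensor ψ, LineKernel.kRou_tensor hM hψ', k, hk, T '' B, hT,
    convF_tensor_image hM hw (fun j => (hψ' j).imp fun _ => And.right) hk hT hTB⟩

end Factorization

/-- Strong factorization for weighted spaces `ℬ^{[M]}_𝒲` over an increasing weight
system (Theorem 7.12(i)). -/
theorem stmt18 (d : ℕ) (M : ℕ → ℝ) (hM : IsWeightSeq M) (hM2 : M2 M) (h2s : M2star M)
    (w : ℕ → Rd d → ℝ) (hw : IncWS d w) :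
    convSet {f | KBeu d M f} {f | BBeuW d M w f} = {f | BBeuW d M w f} ∧
    convSet {f | KRou d M f} {f | BRouW d M w f} = {f | BRouW d M w f} ∧
    (∀ B : Set (Rd d → ℂ), BBeuWBdd d M w B →
      ∃ ψ : Rd d → ℂ, KBeu d M ψ ∧
        ∃ A : Set (Rd d → ℂ), BBeuWBdd d M w A ∧ (fun χ => convF ψ χ) '' A = B) ∧
    (∀ h : ℝ, 0 < h → ∀ B : Set (Rd d → ℂ), BhWBdd d M h w B →
      ∃ ψ : Rd d → ℂ, KRou d M ψ ∧ ∃ k : ℝ, 0 < k ∧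
        ∃ A : Set (Rd d → ℂ), BhWBdd d M k w A ∧ (fun χ => convF ψ χ) '' A = B) := by
  refine ⟨Set.Subset.antisymm ?_ fun φ hφ => ?_, Set.Subset.antisymm ?_ ?_,
    BBeuWBdd.exists_factorization hM hM2 h2s hw,
    fun h hh => BhWBdd.exists_factorization hM hM2 h2s hw hh⟩
  · rintro _ ⟨ψ, hψ, χ, hχ, rfl⟩
    have key : ∀ ρ : ℕ, 0 < ρ → BhW d M ρ w (convF ψ χ) := fun ρ hρ =>
      BhW.convF hM hw hψ.1.continuous hψ.exists_norm_mul_exp_le (Nat.cast_pos.2 hρ)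
        (hχ.bhW hM hw ρ)
    refine (BBeuWBdd.of_wD (B := {convF ψ χ}) (by rintro _ rfl; exact (key 1 one_pos).1)
      fun n => ?_).1 _ rfl
    obtain ⟨C, -, hC⟩ := (BhWBdd.singleton (key (n + 1) n.succ_pos)).exists_wD_le hM n
    refine ⟨C, fun φ hφ L x => le_trans ?_ (hC φ hφ L x)⟩
    have := hw.1 n x
    gcongr
    simp
  · obtain ⟨ψ, hψ, A, hA, hAB⟩ := BBeuWBdd.exists_factorization hM hM2 h2s hw {φ}
      (BBeuWBdd.singleton hφ)
    obtain ⟨χ, hχ, h⟩ := hAB.ge (Set.mem_singleton φ)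
    exact ⟨ψ, hψ, χ, hA.1 χ hχ, h.symm⟩
  · rintro _ ⟨ψ, hψ, χ, ⟨h, hh, hχ⟩, rfl⟩
    exact ⟨h, hh, BhW.convF hM hw hψ.1.continuous hψ.exists_norm_mul_exp_le hh hχ⟩
  · rintro φ ⟨h, hh, hφ⟩
    obtain ⟨ψ, hψ, k, hk, A, hA, hAB⟩ := BhWBdd.exists_factorization hM hM2 h2s hw hh {φ}
      (BhWBdd.singleton hφ)
    obtain ⟨χ, hχ, h⟩ := hAB.ge (Set.mem_singleton φ)
    exact ⟨ψ, hψ, χ, ⟨k, hk, hA.1 χ hχ⟩, h.symm⟩
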